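/- (Weighted W^{2,p} estimate for the singular Keldysh operator.) Let n ≥ 2, b > 1 and p ∈ (1,∞). Then there exists a constant C, depending only on p, n, b, such that for every bounded measurable f : ℝⁿ₊ → ℝ with compact support, the function u = T_b f satisfies Σ_{i,j=1}^n ‖∂_{ij}u‖_{L^p_{μ_b}(ℝⁿ₊)} + ‖(∂_n u)/x_n‖_{L^p_{μ_b}(ℝⁿ₊)} ≤ C ‖f‖_{L^p_{μ_b}(ℝⁿ₊)}. -/

import Mathlib

open MeasureTheory
open scoped ENNReal

noncomputable section

/-- Euclidean n-space. -/
abbrev Eu (n : ℕ) := EuclideanSpace ℝ (Fin n)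

/-- Partial derivative ∂ψ/∂xᵢ. -/
def pd {n : ℕ} (ψ : Eu n → ℝ) (i : Fin n) (x : Eu n) : ℝ :=
  fderiv ℝ ψ x (EuclideanSpace.single i 1)

/-- Second partial derivative ∂²ψ/∂xᵢ∂xⱼ. -/
def pd2 {n : ℕ} (ψ : Eu n → ℝ) (i j : Fin n) (x : Eu n) : ℝ :=
  pd (pd ψ j) i x


/-- The constant `D_b = 2^{b-2} π^{-n/2} Γ((n+b-2)/2)/Γ(b/2)`. -/
def Db (n : ℕ) (b : ℝ) : ℝ :=
  2 ^ (b - 2) * Real.pi ^ (-(n : ℝ) / 2) *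
    Real.Gamma (((n : ℝ) + b - 2) / 2) / Real.Gamma (b / 2)

/-- Reflection `y* = (y₁,…,y_{n-1},−y_n)` across the hyperplane `{y_n = 0}`. -/
def reflLn {n : ℕ} (ln : Fin n) (y : Eu n) : Eu n :=
  (EuclideanSpace.equiv (Fin n) ℝ).symm (fun i => if i = ln then -(y i) else y i)

/-- Horiuchi's Green function `K_b(x,y)`. -/
def Kb (n : ℕ) (ln : Fin n) (b : ℝ) (x y : Eu n) : ℝ :=
  Db n b * ∫ τ in (0 : ℝ)..1,
    (‖x - y‖ ^ 2 * (1 - τ) + ‖x - reflLn ln y‖ ^ 2 * τ) ^ (-(((n : ℝ) - 2 + b) / 2)) *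
      (τ * (1 - τ)) ^ (b / 2 - 1)

/-- The solution operator `T_b f(x) = ∫_{ℝⁿ₊} K_b(x,y) yₙ^b f(y) dy`. -/
def Tb (n : ℕ) (ln : Fin n) (b : ℝ) (f : Eu n → ℝ) (x : Eu n) : ℝ :=
  ∫ y in {y : Eu n | 0 < y ln}, Kb n ln b x y * (y ln) ^ b * f y

/-- The measure `μ_b` on `ℝⁿ₊` with density `xₙ^b` w.r.t. Lebesgue measure. -/
def mub (n : ℕ) (ln : Fin n) (b : ℝ) : Measure (Eu n) :=
  (volume.restrict {x : Eu n | 0 < x ln}).withDensity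
    fun x => ENNReal.ofReal ((x ln) ^ b)

lemma bellman_hessian_algebra {p q K a c A D X Z m u v : ℝ} (hp : 2 ≤ p) (hq : 1 < q) (hq2 : q ≤ 2)
    (hK : 17 * q ^ 2 + 1 ≤ K * (q * (q - 1))) (hK0 : 0 ≤ K)
    (ha : 0 < a) (hc : 0 < c) (hA : 0 < A) (hD : 0 < D) (hX : X = A + D)
    (hZ : 0 < Z) (hm : 0 < m) (hDm : D * m = c) (hmZ : m ≤ Z) (haZ : a * Z ≤ X)
    (huv : |u| * Z * (D * |v|) ≤ X * c) (hv : v ^ 2 ≤ c) (ξ η : ℝ) :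
    m * ξ ^ 2 + η ^ 2 / m ≤
      K * ((p * (p - 2) * (A / a ^ 2) * u ^ 2 * ξ ^ 2 + p * (A / a) * ξ ^ 2)
          + (q * (q - 2) * (D / c ^ 2) * v ^ 2 * η ^ 2 + q * (D / c) * η ^ 2))
        + 2 * ξ ^ 2 * Z
        + 4 * u * ξ * ((1 - 2 / p) * (Z / X) * (p * (A / a) * u * ξ + q * (D / c) * v * η))
        + a * ((1 - 2 / p) * (Z / X) *
            ((p * (p - 2) * (A / a ^ 2) * u ^ 2 * ξ ^ 2 + p * (A / a) * ξ ^ 2)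
              + (q * (q - 2) * (D / c ^ 2) * v ^ 2 * η ^ 2 + q * (D / c) * η ^ 2))
          + (1 - 2 / p) * ((1 - 2 / p) - 1) * (Z / X ^ 2) *
            (p * (A / a) * u * ξ + q * (D / c) * v * η) ^ 2) := by
  have hXpos : 0 < X := by rw [hX]; positivity
  have hp0 : 0 < p := by linarith
  set α : ℝ := 1 - 2 / p with hα
  have h2p : 2 / p ≤ 1 := by rw [div_le_one hp0]; exact hp
  have hα0 : 0 ≤ α := by rw [hα]; linarith
  have hα1 : α ≤ 1 := by rw [hα]; have : 0 < 2 / p := by positivity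
                         linarith
  have hDc : D / c = 1 / m := by rw [← hDm]; field_simp
  set A2 := p * (p - 2) * (A / a ^ 2) * u ^ 2 * ξ ^ 2 + p * (A / a) * ξ ^ 2 with hA2
  set D2 := q * (q - 2) * (D / c ^ 2) * v ^ 2 * η ^ 2 + q * (D / c) * η ^ 2 with hD2
  have hA2n : 0 ≤ A2 := by
    have : 0 ≤ p - 2 := by linarith
    positivity
  have hD2n : q * (q - 1) * (η ^ 2 / m) ≤ D2 := by
    have h1 : D / c ^ 2 * v ^ 2 ≤ D / c := by
      have : D / c ^ 2 * v ^ 2 = D / c * (v ^ 2 / c) := by field_simp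
      rw [this]
      exact mul_le_of_le_one_right (by positivity) ((div_le_one hc).2 hv)
    have h2 : q * (2 - q) * η ^ 2 * (D / c ^ 2 * v ^ 2) ≤ q * (2 - q) * η ^ 2 * (D / c) := by
      apply mul_le_mul_of_nonneg_left h1
      have : 0 ≤ 2 - q := by linarith
      positivity
    have h3 : q * (q - 1) * (η ^ 2 / m) = q * (q - 1) * (D / c) * η ^ 2 := by
      rw [hDc]; field_simp
    rw [h3, hD2]; nlinarith
  have hηm : 0 ≤ η ^ 2 / m := by positivity
  have hD2p : 0 ≤ D2 := le_trans (by have : 0 < q - 1 := by linarith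
                                     positivity) hD2n
  set W : ℝ := u * Z * (D * v) / (X * c) with hW
  have hWabs : |W| ≤ 1 := by
    rw [hW, abs_div, abs_mul, abs_mul, abs_mul, abs_of_pos hZ, abs_of_pos hD,
      abs_of_pos (mul_pos hXpos hc), div_le_one (mul_pos hXpos hc)]
    exact huv
  set Y : ℝ := (Z / X) * (A / a) * u ^ 2 * ξ ^ 2 with hY
  have hY0 : 0 ≤ Y := by positivity
  have hAX : A / X ≤ 1 := by rw [div_le_one hXpos, hX]; linarith
  have hDX : D / X ≤ 1 := by rw [div_le_one hXpos, hX]; linarith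
  have e1 : 4 * u * ξ * (α * (Z / X) * (p * (A / a) * u * ξ + q * (D / c) * v * η))
      = 4 * α * p * Y + 4 * α * q * (W * (ξ * η)) := by
    rw [hY, hW]; field_simp; try ring
  have e2 : a * (α * (α - 1) * (Z / X ^ 2) * (p * (A / a) * u * ξ + q * (D / c) * v * η) ^ 2)
      = -(2 * α * p * (Y * (A / X))) - 4 * α * q * ((A / X) * (W * (ξ * η)))
        - α * (2 / p) * q ^ 2 * ((a * Z / X) * ((D / X) * ((v ^ 2 / c) * (D / c * η ^ 2)))) := by
    have : α - 1 = - (2 / p) := by rw [hα]; ring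
    rw [this, hY, hW]; field_simp; try ring
  have hq0 : 0 < q := by linarith
  have h4q : 4 * α * q ≤ 4 * q := by
    have := mul_le_mul_of_nonneg_right hα1 hq0.le
    linarith
  rw [mul_add a, e1, e2]
  clear e1 e2
  clear_value W Y α A2 D2
  have hWb : |W * (ξ * η)| ≤ |ξ * η| := by
    rw [abs_mul]; exact mul_le_of_le_one_left (abs_nonneg _) hWabs
  have i1 : -(4 * q * |ξ * η|) ≤ 4 * α * q * (W * (ξ * η)) := by
    have := neg_abs_le (4 * α * q * (W * (ξ * η)))
    have h2 : |4 * α * q * (W * (ξ * η))| ≤ 4 * q * |ξ * η| := by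
      rw [abs_mul, abs_of_nonneg (by positivity : 0 ≤ 4 * α * q)]
      exact mul_le_mul h4q hWb (abs_nonneg _) (by positivity)
    linarith
  have i2 : 4 * α * q * ((A / X) * (W * (ξ * η))) ≤ 4 * q * |ξ * η| := by
    refine (le_abs_self _).trans ?_
    rw [abs_mul, abs_of_nonneg (by positivity : 0 ≤ 4 * α * q), abs_mul,
      abs_of_nonneg (by positivity : 0 ≤ A / X)]
    apply mul_le_mul h4q _ (by positivity) (by positivity)
    · exact (mul_le_of_le_one_left (abs_nonneg _) hAX).trans hWb
  have i3 : α * (2 / p) * q ^ 2 * ((a * Z / X) * ((D / X) * ((v ^ 2 / c) * (D / c * η ^ 2))))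
      ≤ q ^ 2 * (η ^ 2 / m) := by
    have h1 : D / c * η ^ 2 = η ^ 2 / m := by rw [hDc]; field_simp
    rw [h1]
    have h2 : (v ^ 2 / c) * (η ^ 2 / m) ≤ η ^ 2 / m :=
      mul_le_of_le_one_left hηm ((div_le_one hc).2 hv)
    have h3 : (D / X) * ((v ^ 2 / c) * (η ^ 2 / m)) ≤ η ^ 2 / m :=
      (mul_le_of_le_one_left (by positivity) hDX).trans h2
    have h4 : (a * Z / X) * ((D / X) * ((v ^ 2 / c) * (η ^ 2 / m))) ≤ η ^ 2 / m :=
      (mul_le_of_le_one_left (by positivity) ((div_le_one hXpos).2 haZ)).trans h3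
    apply mul_le_mul _ h4 (by positivity) (by positivity)
    have : α * (2 / p) ≤ 1 := mul_le_one₀ hα1 (by positivity) h2p
    exact mul_le_of_le_one_left (sq_nonneg q) this
  have i4 : Y * (A / X) ≤ Y := mul_le_of_le_one_right hY0 hAX
  have i5 : 0 ≤ a * (α * (Z / X) * (A2 + D2)) := by positivity
  have i6 : m * ξ ^ 2 ≤ Z * ξ ^ 2 := mul_le_mul_of_nonneg_right hmZ (sq_nonneg _)
  have i7 : 8 * q * |ξ * η| ≤ m * ξ ^ 2 + 16 * q ^ 2 * (η ^ 2 / m) := by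
    have h1 : 0 ≤ (m * |ξ| - 4 * q * |η|) ^ 2 / m := by positivity
    have h2 : (m * |ξ| - 4 * q * |η|) ^ 2 / m =
        m * ξ ^ 2 + 16 * q ^ 2 * (η ^ 2 / m) - 8 * q * |ξ * η| := by
      rw [abs_mul, ← sq_abs ξ, ← sq_abs η]; field_simp; try ring
    linarith
  have i8 : K * (q * (q - 1)) * (η ^ 2 / m) ≤ K * (A2 + D2) := by
    have h1 := mul_le_mul_of_nonneg_left hD2n hK0
    have h2 := mul_nonneg hK0 hA2n
    linarith
  have i9 : (17 * q ^ 2 + 1) * (η ^ 2 / m) ≤ K * (q * (q - 1)) * (η ^ 2 / m) :=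
    mul_le_mul_of_nonneg_right hK hηm
  have i10 : α * p * (Y * (A / X)) ≤ α * p * Y := mul_le_mul_of_nonneg_left i4 (by positivity)
  have i11 : 0 ≤ α * p * Y := by positivity
  linarith

lemma hasDerivAt_line {B : ℝ × ℝ → ℝ} (hB : ContDiff ℝ 2 B) (z d : ℝ × ℝ) (s : ℝ) :
    HasDerivAt (fun s : ℝ => B (z + s • d)) (fderiv ℝ B (z + s • d) d) s := by
  have h1 : HasFDerivAt B (fderiv ℝ B (z + s • d)) (z + s • d) :=
    ((hB.differentiable (by norm_num)) _).hasFDerivAt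
  have h2 : HasDerivAt (fun s : ℝ => z + s • d) d s := by
    simpa using ((hasDerivAt_id s).smul_const d).const_add z
  exact h1.comp_hasDerivAt s h2

lemma hasDerivAt_line_fderiv {B : ℝ × ℝ → ℝ} (hB : ContDiff ℝ 2 B) (z d : ℝ × ℝ) :
    HasDerivAt (fun s : ℝ => fderiv ℝ B (z + s • d) d) (fderiv ℝ (fderiv ℝ B) z d d) 0 := by
  have h0 : ContDiff ℝ 1 (fderiv ℝ B) := hB.fderiv_right (by norm_num)
  have h1 : HasFDerivAt (fderiv ℝ B) (fderiv ℝ (fderiv ℝ B) (z + (0 : ℝ) • d)) (z + (0 : ℝ) • d) :=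
    ((h0.differentiable (by norm_num)) _).hasFDerivAt
  have h2 : HasDerivAt (fun s : ℝ => z + s • d) d 0 := by
    simpa using ((hasDerivAt_id (0 : ℝ)).smul_const d).const_add z
  have h3 := h1.comp_hasDerivAt (0 : ℝ) h2
  simp only [zero_smul, add_zero] at h3
  exact h3.clm_apply (hasDerivAt_const (0 : ℝ) d) |>.congr_deriv (by simp)

/-- The Bellman function. -/
def bellman (p q K ε : ℝ) (z : ℝ × ℝ) : ℝ :=
  K * ((z.1 ^ 2 + ε) ^ (p / 2) + (z.2 ^ 2 + ε) ^ (q / 2)) +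
    (z.1 ^ 2 + ε) * ((z.1 ^ 2 + ε) ^ (p / 2) + (z.2 ^ 2 + ε) ^ (q / 2)) ^ (1 - 2 / p)

lemma contDiff_bellman (p q K : ℝ) {ε : ℝ} (hε : 0 < ε) : ContDiff ℝ 2 (bellman p q K ε) := by
  have h1 : ContDiff ℝ 2 (fun z : ℝ × ℝ => z.1 ^ 2 + ε) := by fun_prop
  have h2 : ContDiff ℝ 2 (fun z : ℝ × ℝ => z.2 ^ 2 + ε) := by fun_prop
  have h3 : ContDiff ℝ 2
      (fun z : ℝ × ℝ => (z.1 ^ 2 + ε) ^ (p / 2) + (z.2 ^ 2 + ε) ^ (q / 2)) :=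
    (h1.rpow_const_of_ne fun z => by positivity).add (h2.rpow_const_of_ne fun z => by positivity)
  exact (contDiff_const.mul h3).add (h1.mul (h3.rpow_const_of_ne fun z => by positivity))

/-- First derivative of the Bellman function along a line. -/
lemma fderiv_bellman_line (p q K : ℝ) {ε : ℝ} (hε : 0 < ε) (u v ξ η s : ℝ) :
    fderiv ℝ (bellman p q K ε) ((u, v) + s • (ξ, η)) (ξ, η) =
      K * ((2 * (u + s * ξ) * ξ) * (p / 2) * ((u + s * ξ) ^ 2 + ε) ^ (p / 2 - 1)
        + (2 * (v + s * η) * η) * (q / 2) * ((v + s * η) ^ 2 + ε) ^ (q / 2 - 1))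
      + ((2 * (u + s * ξ) * ξ) *
          (((u + s * ξ) ^ 2 + ε) ^ (p / 2) + ((v + s * η) ^ 2 + ε) ^ (q / 2)) ^ (1 - 2 / p)
        + ((u + s * ξ) ^ 2 + ε) *
          (((2 * (u + s * ξ) * ξ) * (p / 2) * ((u + s * ξ) ^ 2 + ε) ^ (p / 2 - 1)
            + (2 * (v + s * η) * η) * (q / 2) * ((v + s * η) ^ 2 + ε) ^ (q / 2 - 1))
            * (1 - 2 / p) *
          (((u + s * ξ) ^ 2 + ε) ^ (p / 2) + ((v + s * η) ^ 2 + ε) ^ (q / 2))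
            ^ ((1 - 2 / p) - 1))) := by
  refine (hasDerivAt_line (contDiff_bellman p q K hε) (u, v) (ξ, η) s).unique ?_
  have h1 : HasDerivAt (fun s : ℝ => (u + s * ξ) ^ 2 + ε) (2 * (u + s * ξ) * ξ) s := by
    have := ((((hasDerivAt_id s).mul_const ξ).const_add u).pow 2).add_const ε
    simpa using this
  have h2 : HasDerivAt (fun s : ℝ => (v + s * η) ^ 2 + ε) (2 * (v + s * η) * η) s := by
    have := ((((hasDerivAt_id s).mul_const η).const_add v).pow 2).add_const ε
    simpa using this
  have h3 := h1.rpow_const (p := p / 2) (Or.inl (by positivity))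
  have h4 := h2.rpow_const (p := q / 2) (Or.inl (by positivity))
  have h5 := h3.add h4
  have h6 := h5.rpow_const (p := 1 - 2 / p) (Or.inl (by simp only [Pi.add_apply]; positivity))
  have h7 := (h5.const_mul K).add (h1.mul h6)
  exact h7

lemma fderiv2_bellman (p q K : ℝ) {ε : ℝ} (hε : 0 < ε) (u v ξ η : ℝ) :
    fderiv ℝ (fderiv ℝ (bellman p q K ε)) (u, v) (ξ, η) (ξ, η) =
      let a := u ^ 2 + ε
      let c := v ^ 2 + ε
      let A := a ^ (p / 2)
      let D := c ^ (q / 2)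
      let X := A + D
      let Z := X ^ (1 - 2 / p)
      K * ((p * (p - 2) * (A / a ^ 2) * u ^ 2 * ξ ^ 2 + p * (A / a) * ξ ^ 2)
          + (q * (q - 2) * (D / c ^ 2) * v ^ 2 * η ^ 2 + q * (D / c) * η ^ 2))
        + 2 * ξ ^ 2 * Z
        + 4 * u * ξ * ((1 - 2 / p) * (Z / X) * (p * (A / a) * u * ξ + q * (D / c) * v * η))
        + a * ((1 - 2 / p) * (Z / X) *
            ((p * (p - 2) * (A / a ^ 2) * u ^ 2 * ξ ^ 2 + p * (A / a) * ξ ^ 2)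
              + (q * (q - 2) * (D / c ^ 2) * v ^ 2 * η ^ 2 + q * (D / c) * η ^ 2))
          + (1 - 2 / p) * ((1 - 2 / p) - 1) * (Z / X ^ 2) *
            (p * (A / a) * u * ξ + q * (D / c) * v * η) ^ 2) := by
  extract_lets a c A D X Z
  have hB := hasDerivAt_line_fderiv (contDiff_bellman p q K hε) (u, v) (ξ, η)
  simp only [fderiv_bellman_line p q K hε] at hB
  refine hB.unique ?_
  have g1 : HasDerivAt (fun s : ℝ => 2 * (u + s * ξ) * ξ) (2 * ξ * ξ) 0 := by
    have := ((((hasDerivAt_id (0:ℝ)).mul_const ξ).const_add u).const_mul 2).mul_const ξ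
    simpa using this
  have g2 : HasDerivAt (fun s : ℝ => 2 * (v + s * η) * η) (2 * η * η) 0 := by
    have := ((((hasDerivAt_id (0:ℝ)).mul_const η).const_add v).const_mul 2).mul_const η
    simpa using this
  have h1 : HasDerivAt (fun s : ℝ => (u + s * ξ) ^ 2 + ε) (2 * u * ξ) 0 := by
    have := ((((hasDerivAt_id (0:ℝ)).mul_const ξ).const_add u).pow 2).add_const ε
    simpa using this
  have h2 : HasDerivAt (fun s : ℝ => (v + s * η) ^ 2 + ε) (2 * v * η) 0 := by
    have := ((((hasDerivAt_id (0:ℝ)).mul_const η).const_add v).pow 2).add_const ε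
    simpa using this
  have h3 := h1.rpow_const (p := p / 2) (Or.inl (by positivity))
  have h4 := h2.rpow_const (p := q / 2) (Or.inl (by positivity))
  have h3' := h1.rpow_const (p := p / 2 - 1) (Or.inl (by positivity))
  have h4' := h2.rpow_const (p := q / 2 - 1) (Or.inl (by positivity))
  have h5 := h3.add h4
  have h6 := h5.rpow_const (p := 1 - 2 / p) (Or.inl (by simp only [Pi.add_apply]; positivity))
  have h6' := h5.rpow_const (p := (1 - 2 / p) - 1) (Or.inl (by simp only [Pi.add_apply]; positivity))
  have h8 := ((g1.mul_const (p / 2)).mul h3').add ((g2.mul_const (q / 2)).mul h4')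
  have h9 := (h8.const_mul K).add ((g1.mul h6).add (h1.mul ((h8.mul_const (1 - 2 / p)).mul h6')))
  have ha : 0 < a := by positivity
  have hc : 0 < c := by positivity
  have hA : 0 < A := by positivity
  have hD : 0 < D := by positivity
  have hX : 0 < X := by positivity
  refine HasDerivAt.congr_deriv h9 ?_
  symm
  simp only [Pi.add_apply, Pi.mul_apply, zero_mul, add_zero]
  have e3 : u ^ 2 + ε = a := rfl
  have e4 : v ^ 2 + ε = c := rfl
  simp only [e3, e4]
  have f1 : a ^ (p / 2 - 1) = A / a := Real.rpow_sub_one ha.ne' _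
  have f2 : c ^ (q / 2 - 1) = D / c := Real.rpow_sub_one hc.ne' _
  have f1' : a ^ (p / 2 - 1 - 1) = A / a ^ 2 := by
    rw [Real.rpow_sub_one ha.ne', f1]; field_simp
  have f2' : c ^ (q / 2 - 1 - 1) = D / c ^ 2 := by
    rw [Real.rpow_sub_one hc.ne', f2]; field_simp
  have eX : A + D = X := rfl
  have e5 : a ^ (p / 2) = A := rfl
  have e6 : c ^ (q / 2) = D := rfl
  have f3 : X ^ (1 - 2 / p - 1) = Z / X := Real.rpow_sub_one hX.ne' _
  have f3' : X ^ (1 - 2 / p - 1 - 1) = Z / X ^ 2 := by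
    rw [Real.rpow_sub_one hX.ne', f3]; field_simp
  have f4 : X ^ (1 - 2 / p) = Z := rfl
  simp only [e5, e6, f1, f2, f1', f2', eX, f3, f3', f4]
  generalize 1 - 2 / p = α
  clear_value A D X Z a c
  ring

lemma add_rpow_le_two_rpow_mul {x y s : ℝ} (hx : 0 ≤ x) (hy : 0 ≤ y) (hs : 0 ≤ s) :
    (x + y) ^ s ≤ 2 ^ s * (x ^ s + y ^ s) := by
  have h1 : x + y ≤ 2 * max x y := by
    have := le_max_left x y; have := le_max_right x y; linarith
  have h2 : (max x y) ^ s ≤ x ^ s + y ^ s := by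
    have := Real.rpow_nonneg hx s; have := Real.rpow_nonneg hy s
    rcases max_choice x y with h | h <;> rw [h] <;> linarith
  calc (x + y) ^ s ≤ (2 * max x y) ^ s := Real.rpow_le_rpow (by positivity) h1 hs
    _ = 2 ^ s * (max x y) ^ s := Real.mul_rpow (by norm_num) (le_max_of_le_left hx)
    _ ≤ _ := mul_le_mul_of_nonneg_left h2 (by positivity)

/-- Properties of the Bellman function used in the bilinear estimate. -/
structure IsBellman (p q δ C : ℝ) (B : ℝ × ℝ → ℝ) : Prop where
  smooth : ContDiff ℝ 2 B
  nonneg : ∀ z, 0 ≤ B z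
  le : ∀ z, B z ≤ C * (|z.1| ^ p + |z.2| ^ q + δ)
  sign_fst : ∀ z, 0 ≤ z.1 * fderiv ℝ B z (1, 0)
  sign_snd : ∀ z, 0 ≤ z.2 * fderiv ℝ B z (0, 1)
  hess : ∀ z, ∃ m : ℝ, 0 < m ∧ ∀ ξ η : ℝ,
    m * ξ ^ 2 + η ^ 2 / m ≤ fderiv ℝ (fderiv ℝ B) z (ξ, η) (ξ, η)

lemma exists_isBellman_of_two_le {p q : ℝ} (hpq : p.HolderConjugate q) (hp : 2 ≤ p) :
    ∃ C : ℝ, 0 < C ∧ ∀ δ : ℝ, 0 < δ → ∃ B, IsBellman p q δ C B := by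
  have hp0 : 0 < p := hpq.pos
  have hq1 : 1 < q := hpq.symm.lt
  have hq0 : 0 < q := hpq.symm.pos
  have hinv : p⁻¹ + q⁻¹ = 1 := hpq.inv_add_inv_eq_one
  have hpq' : q + p = p * q := by field_simp at hinv; linarith
  have hq2 : q ≤ 2 := by nlinarith
  have hqq : 0 < q * (q - 1) := by apply mul_pos <;> linarith
  obtain ⟨K, hK0, hK⟩ : ∃ K : ℝ, 0 < K ∧ 17 * q ^ 2 + 1 ≤ K * (q * (q - 1)) :=
    ⟨(17 * q ^ 2 + 1) / (q * (q - 1)), by positivity, by rw [div_mul_cancel₀ _ hqq.ne']⟩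
  have hα0 : 0 ≤ 1 - 2 / p := by
    rw [sub_nonneg, div_le_one hp0]; exact hp
  set M : ℝ := 2 ^ (p / 2) + 2 ^ (q / 2) with hM
  have hM0 : 0 < M := by positivity
  refine ⟨(K + 1) * (2 * M), by positivity, fun δ hδ => ?_⟩
  set ε : ℝ := min (δ ^ (2 / p)) (δ ^ (2 / q)) with hεdef
  have hε : 0 < ε := by positivity
  have hεp : ε ^ (p / 2) ≤ δ := by
    calc ε ^ (p / 2) ≤ (δ ^ (2 / p)) ^ (p / 2) :=
          Real.rpow_le_rpow hε.le (min_le_left _ _) (by positivity)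
      _ = δ := by rw [← Real.rpow_mul hδ.le, show 2 / p * (p / 2) = 1 by field_simp, Real.rpow_one]
  have hεq : ε ^ (q / 2) ≤ δ := by
    calc ε ^ (q / 2) ≤ (δ ^ (2 / q)) ^ (q / 2) :=
          Real.rpow_le_rpow hε.le (min_le_right _ _) (by positivity)
      _ = δ := by rw [← Real.rpow_mul hδ.le, show 2 / q * (q / 2) = 1 by field_simp, Real.rpow_one]
  have hsq : ∀ (x s : ℝ), (x ^ 2) ^ (s / 2) = |x| ^ s := fun x s => by
    rw [← sq_abs, ← Real.rpow_natCast, ← Real.rpow_mul (abs_nonneg x)]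
    congr 1; push_cast; ring
  -- the elementary inequality `a * X ^ (1 - 2 / p) ≤ X`
  have haZ : ∀ u v : ℝ, (u ^ 2 + ε) *
      ((u ^ 2 + ε) ^ (p / 2) + (v ^ 2 + ε) ^ (q / 2)) ^ (1 - 2 / p) ≤
      (u ^ 2 + ε) ^ (p / 2) + (v ^ 2 + ε) ^ (q / 2) := fun u v => by
    have hX : 0 < (u ^ 2 + ε) ^ (p / 2) + (v ^ 2 + ε) ^ (q / 2) := by positivity
    set X := (u ^ 2 + ε) ^ (p / 2) + (v ^ 2 + ε) ^ (q / 2) with hXdef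
    have h1 : u ^ 2 + ε ≤ X ^ (2 / p) := by
      calc u ^ 2 + ε = ((u ^ 2 + ε) ^ (p / 2)) ^ (2 / p) := by
            rw [← Real.rpow_mul (by positivity), show p / 2 * (2 / p) = 1 by field_simp,
              Real.rpow_one]
        _ ≤ _ := Real.rpow_le_rpow (by positivity)
            (by rw [hXdef]; exact le_add_of_nonneg_right (by positivity)) (by positivity)
    calc (u ^ 2 + ε) * X ^ (1 - 2 / p) ≤ X ^ (2 / p) * X ^ (1 - 2 / p) := by gcongr
      _ = X := by rw [← Real.rpow_add hX]; norm_num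
  refine ⟨bellman p q K ε, contDiff_bellman p q K hε, fun z => ?_, fun z => ?_, fun z => ?_,
    fun z => ?_, fun z => ?_⟩
  · unfold bellman; positivity
  · have h1 : (z.1 ^ 2 + ε) ^ (p / 2) ≤ 2 ^ (p / 2) * (|z.1| ^ p + δ) := by
      refine (add_rpow_le_two_rpow_mul (sq_nonneg _) hε.le (by positivity)).trans ?_
      rw [hsq]; gcongr
    have h2 : (z.2 ^ 2 + ε) ^ (q / 2) ≤ 2 ^ (q / 2) * (|z.2| ^ q + δ) := by
      refine (add_rpow_le_two_rpow_mul (sq_nonneg _) hε.le (by positivity)).trans ?_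
      rw [hsq]; gcongr
    have h3 := haZ z.1 z.2
    have h4 : (z.1 ^ 2 + ε) ^ (p / 2) + (z.2 ^ 2 + ε) ^ (q / 2) ≤
        2 * M * (|z.1| ^ p + |z.2| ^ q + δ) := by
      have : (0:ℝ) < 2 ^ (p / 2) := by positivity
      have : (0:ℝ) < 2 ^ (q / 2) := by positivity
      have : 0 ≤ |z.1| ^ p := by positivity
      have : 0 ≤ |z.2| ^ q := by positivity
      rw [hM]
      nlinarith [mul_nonneg (show (0:ℝ) ≤ 2 ^ (p / 2) by positivity) (show 0 ≤ |z.2| ^ q by positivity),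
        mul_nonneg (show (0:ℝ) ≤ 2 ^ (q / 2) by positivity) (show 0 ≤ |z.1| ^ p by positivity),
        mul_nonneg (show (0:ℝ) ≤ 2 ^ (p / 2) by positivity) (show 0 ≤ |z.1| ^ p by positivity),
        mul_nonneg (show (0:ℝ) ≤ 2 ^ (q / 2) by positivity) (show 0 ≤ |z.2| ^ q by positivity)]
    unfold bellman
    calc _ ≤ (K + 1) * ((z.1 ^ 2 + ε) ^ (p / 2) + (z.2 ^ 2 + ε) ^ (q / 2)) := by linarith
      _ ≤ (K + 1) * (2 * M * (|z.1| ^ p + |z.2| ^ q + δ)) := by gcongr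
      _ = _ := by ring
  · have h := fderiv_bellman_line p q K hε z.1 z.2 1 0 0
    simp only [zero_smul, add_zero, zero_mul, mul_zero, mul_one] at h
    have e : z.1 * fderiv ℝ (bellman p q K ε) z (1, 0) =
        2 * z.1 ^ 2 * (K * ((p / 2) * (z.1 ^ 2 + ε) ^ (p / 2 - 1)) +
          (((z.1 ^ 2 + ε) ^ (p / 2) + (z.2 ^ 2 + ε) ^ (q / 2)) ^ (1 - 2 / p)
          + (z.1 ^ 2 + ε) * (((p / 2) * (z.1 ^ 2 + ε) ^ (p / 2 - 1)) * (1 - 2 / p) *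
            ((z.1 ^ 2 + ε) ^ (p / 2) + (z.2 ^ 2 + ε) ^ (q / 2)) ^ (1 - 2 / p - 1)))) := by
      rw [show z = (z.1, z.2) from rfl, h]; ring
    rw [e]; positivity
  · have h := fderiv_bellman_line p q K hε z.1 z.2 0 1 0
    simp only [zero_smul, add_zero, zero_mul, mul_zero, mul_one, zero_add] at h
    have e : z.2 * fderiv ℝ (bellman p q K ε) z (0, 1) =
        2 * z.2 ^ 2 * (K * ((q / 2) * (z.2 ^ 2 + ε) ^ (q / 2 - 1)) +
          ((z.1 ^ 2 + ε) * (((q / 2) * (z.2 ^ 2 + ε) ^ (q / 2 - 1)) * (1 - 2 / p) *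
            ((z.1 ^ 2 + ε) ^ (p / 2) + (z.2 ^ 2 + ε) ^ (q / 2)) ^ (1 - 2 / p - 1)))) := by
      rw [show z = (z.1, z.2) from rfl, h]; ring
    rw [e]; positivity
  · obtain ⟨u, v⟩ := z
    have ha : 0 < u ^ 2 + ε := by positivity
    have hc : 0 < v ^ 2 + ε := by positivity
    refine ⟨(v ^ 2 + ε) ^ ((2 - q) / 2), by positivity, fun ξ η => ?_⟩
    rw [fderiv2_bellman p q K hε]
    have hX : 0 < (u ^ 2 + ε) ^ (p / 2) + (v ^ 2 + ε) ^ (q / 2) := by positivity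
    have hDX : (v ^ 2 + ε) ^ (q / 2) ≤ (u ^ 2 + ε) ^ (p / 2) + (v ^ 2 + ε) ^ (q / 2) :=
      le_add_of_nonneg_left (by positivity)
    have hAX : (u ^ 2 + ε) ^ (p / 2) ≤ (u ^ 2 + ε) ^ (p / 2) + (v ^ 2 + ε) ^ (q / 2) :=
      le_add_of_nonneg_right (by positivity)
    refine bellman_hessian_algebra hp hq1 hq2 hK hK0.le ha hc (by positivity) (by positivity) rfl
      (by positivity) (by positivity) ?_ ?_ (haZ u v) ?_ (by linarith) ξ η
    · rw [← Real.rpow_add hc, show q / 2 + (2 - q) / 2 = 1 by ring, Real.rpow_one]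
    · calc (v ^ 2 + ε) ^ ((2 - q) / 2) = ((v ^ 2 + ε) ^ (q / 2)) ^ (1 - 2 / p) := by
            rw [← Real.rpow_mul hc.le]; congr 1; field_simp; nlinarith
        _ ≤ _ := Real.rpow_le_rpow (by positivity) hDX hα0
    · set X := (u ^ 2 + ε) ^ (p / 2) + (v ^ 2 + ε) ^ (q / 2) with hXdef
      have h1 : |u| ≤ X ^ (1 / p) := by
        calc |u| = (|u| ^ p) ^ (1 / p) := by
              rw [← Real.rpow_mul (abs_nonneg u), mul_one_div_cancel hp0.ne', Real.rpow_one]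
          _ ≤ _ := Real.rpow_le_rpow (by positivity) (by
              rw [← hsq]
              exact (Real.rpow_le_rpow (by positivity) (by linarith) (by positivity)).trans hAX)
              (by positivity)
      have h2 : (v ^ 2 + ε) ^ (q / 2) * |v| ≤ (v ^ 2 + ε) * X ^ (1 / p) := by
        have h3 : |v| ≤ (v ^ 2 + ε) ^ ((1:ℝ) / 2) := by
          calc |v| = (v ^ 2) ^ ((1:ℝ) / 2) := by rw [hsq, Real.rpow_one]
            _ ≤ _ := Real.rpow_le_rpow (by positivity) (by linarith) (by positivity)
        calc (v ^ 2 + ε) ^ (q / 2) * |v| ≤ (v ^ 2 + ε) ^ (q / 2) * (v ^ 2 + ε) ^ ((1:ℝ) / 2) := by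
              gcongr
          _ = (v ^ 2 + ε) * ((v ^ 2 + ε) ^ (q / 2)) ^ (1 / p) := by
              rw [← Real.rpow_add hc, ← Real.rpow_mul hc.le]
              nth_rewrite 2 [← Real.rpow_one (v ^ 2 + ε)]
              rw [← Real.rpow_add hc]
              congr 1; field_simp; nlinarith
          _ ≤ _ := by gcongr
      calc |u| * X ^ (1 - 2 / p) * ((v ^ 2 + ε) ^ (q / 2) * |v|)
          ≤ X ^ (1 / p) * X ^ (1 - 2 / p) * ((v ^ 2 + ε) * X ^ (1 / p)) := by gcongr
        _ = (X ^ (1 / p) * X ^ (1 - 2 / p) * X ^ (1 / p)) * (v ^ 2 + ε) := by ring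
        _ = X * (v ^ 2 + ε) := by
            rw [← Real.rpow_add hX, ← Real.rpow_add hX,
              show 1 / p + (1 - 2 / p) + 1 / p = 1 by ring, Real.rpow_one]

lemma IsBellman.swap {p q δ C : ℝ} {B : ℝ × ℝ → ℝ} (h : IsBellman p q δ C B) :
    IsBellman q p δ C (fun z => B z.swap) := by
  let e : (ℝ × ℝ) ≃L[ℝ] (ℝ × ℝ) := ContinuousLinearEquiv.prodComm ℝ ℝ ℝ
  have he : (fun z : ℝ × ℝ => B z.swap) = B ∘ e := rfl
  have h1 : ∀ z d, fderiv ℝ (fun z : ℝ × ℝ => B z.swap) z d = fderiv ℝ B z.swap d.swap := by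
    intro z d
    rw [he, e.comp_right_fderiv]; rfl
  have hd : Differentiable ℝ (fderiv ℝ B) :=
    (h.smooth.fderiv_right (m := 1) (by norm_num)).differentiable (by norm_num)
  have hs : ContDiff ℝ 2 (fun z : ℝ × ℝ => B z.swap) := h.smooth.comp e.contDiff
  have h2 : ∀ z d, fderiv ℝ (fderiv ℝ (fun z : ℝ × ℝ => B z.swap)) z d d =
      fderiv ℝ (fderiv ℝ B) z.swap d.swap d.swap := by
    intro z d
    refine (hasDerivAt_line_fderiv hs z d).unique ?_
    simp only [h1]
    exact hasDerivAt_line_fderiv h.smooth z.swap d.swap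
  refine ⟨hs, fun z => h.nonneg _, fun z => (h.le _).trans (le_of_eq ?_), fun z => ?_, fun z => ?_,
    fun z => ?_⟩
  · simp only [Prod.fst_swap, Prod.snd_swap]; ring
  · rw [h1]; exact h.sign_snd z.swap
  · rw [h1]; exact h.sign_fst z.swap
  · obtain ⟨m, hm, hh⟩ := h.hess z.swap
    refine ⟨m⁻¹, inv_pos.2 hm, fun ξ η => ?_⟩
    rw [h2]
    refine le_trans (le_of_eq ?_) (hh η ξ)
    field_simp; ring

lemma exists_isBellman {p q : ℝ} (hpq : p.HolderConjugate q) :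
    ∃ C : ℝ, 0 < C ∧ ∀ δ : ℝ, 0 < δ → ∃ B, IsBellman p q δ C B := by
  rcases le_total 2 p with hp | hp
  · exact exists_isBellman_of_two_le hpq hp
  · have hq : 2 ≤ q := by
      have hinv : p⁻¹ + q⁻¹ = 1 := hpq.inv_add_inv_eq_one
      have hp0 : 0 < p := hpq.pos
      have hq0 : 0 < q := hpq.symm.pos
      have hpq' : q + p = p * q := by field_simp at hinv; linarith
      nlinarith
    obtain ⟨C, hC, h⟩ := exists_isBellman_of_two_le hpq.symm hq
    refine ⟨C, hC, fun δ hδ => ?_⟩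
    obtain ⟨B, hB⟩ := h δ hδ
    exact ⟨_, hB.swap⟩

/-- The weight `(x_n)₊ ^ b`. -/
def wt {n : ℕ} (ln : Fin n) (b : ℝ) (x : Eu n) : ℝ := (max (x ln) 0) ^ b

section Weight

variable {n : ℕ} {ln : Fin n} {b : ℝ}

lemma hasDerivAt_max_rpow {b : ℝ} (hb : 1 < b) (s : ℝ) :
    HasDerivAt (fun s : ℝ => (max s 0) ^ b) (b * (max s 0) ^ (b - 1)) s := by
  rcases lt_trichotomy s 0 with h | h | h
  · have e : (fun s : ℝ => (max s 0) ^ b) =ᶠ[nhds s] fun _ => 0 := by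
      filter_upwards [gt_mem_nhds h] with y hy
      rw [max_eq_right hy.le, Real.zero_rpow (by linarith)]
    rw [max_eq_right h.le, Real.zero_rpow (by linarith), mul_zero]
    exact (hasDerivAt_const s (0 : ℝ)).congr_of_eventuallyEq e
  · subst h
    rw [max_self, Real.zero_rpow (by linarith), mul_zero]
    rw [hasDerivAt_iff_isLittleO_nhds_zero]
    simp only [zero_add, max_self, Real.zero_rpow (by linarith : b ≠ 0), sub_zero, smul_zero]
    have h1 : HasDerivAt (fun s : ℝ => |s| ^ b) 0 0 := by
      have := hasDerivAt_abs_rpow 0 hb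
      simpa using this
    rw [hasDerivAt_iff_isLittleO_nhds_zero] at h1
    simp only [zero_add, abs_zero, Real.zero_rpow (by linarith : b ≠ 0), sub_zero, smul_zero] at h1
    refine Asymptotics.IsBigO.trans_isLittleO (Asymptotics.IsBigO.of_bound 1 ?_) h1
    refine Filter.Eventually.of_forall fun y => ?_
    rw [one_mul, Real.norm_of_nonneg (by positivity), Real.norm_of_nonneg (by positivity)]
    exact Real.rpow_le_rpow (by positivity) (max_le (le_abs_self _) (abs_nonneg _)) (by linarith)
  · have e : (fun s : ℝ => (max s 0) ^ b) =ᶠ[nhds s] fun s => s ^ b := by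
      filter_upwards [lt_mem_nhds h] with y hy
      rw [max_eq_left hy.le]
    rw [max_eq_left h.le]
    exact (Real.hasDerivAt_rpow_const (Or.inl h.ne')).congr_of_eventuallyEq e

lemma wt_nonneg (x : Eu n) : 0 ≤ wt ln b x := by unfold wt; positivity

lemma wt_of_pos {x : Eu n} (h : 0 < x ln) : wt ln b x = (x ln) ^ b := by
  rw [wt, max_eq_left h.le]

lemma wt_of_nonpos (hb : 0 < b) {x : Eu n} (h : x ln ≤ 0) : wt ln b x = 0 := by
  rw [wt, max_eq_right h, Real.zero_rpow hb.ne']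

lemma continuous_wt (hb : 0 ≤ b) : Continuous (wt (n := n) ln b) := by
  unfold wt
  exact Continuous.rpow_const (by fun_prop) fun _ => Or.inr hb

lemma hasFDerivAt_wt (hb : 1 < b) (x : Eu n) :
    HasFDerivAt (wt ln b)
      ((b * wt ln (b - 1) x) • (EuclideanSpace.proj ln : Eu n →L[ℝ] ℝ)) x := by
  have h1 : HasFDerivAt (fun x : Eu n => x ln) (EuclideanSpace.proj ln : Eu n →L[ℝ] ℝ) x :=
    (EuclideanSpace.proj ln : Eu n →L[ℝ] ℝ).hasFDerivAt
  exact (hasDerivAt_max_rpow hb (x ln)).comp_hasFDerivAt x h1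

lemma fderiv_wt_single (hb : 1 < b) (x : Eu n) (i : Fin n) :
    fderiv ℝ (wt ln b) x (EuclideanSpace.single i 1) =
      if i = ln then b * wt ln (b - 1) x else 0 := by
  rw [(hasFDerivAt_wt hb x).fderiv]
  by_cases h : i = ln
  · subst h; simp
  · have : ln ≠ i := fun h' => h h'.symm
    simp [h, this]

lemma mub_eq (hb : 0 < b) :
    mub n ln b = (volume : Measure (Eu n)).withDensity fun x => ENNReal.ofReal (wt ln b x) := by
  unfold mub
  have hm : MeasurableSet {x : Eu n | 0 < x ln} :=
    measurableSet_lt measurable_const (by fun_prop)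
  rw [← withDensity_indicator hm]
  congr 1
  ext x
  by_cases h : 0 < x ln
  · rw [Set.indicator_of_mem (by exact h), wt_of_pos h]
  · rw [Set.indicator_of_notMem (by exact h), wt_of_nonpos hb (not_lt.1 h), ENNReal.ofReal_zero]

/-- `wt * (Δ + (b / x_n) ∂_n)`, written without singular coefficients. -/
def Lw (ln : Fin n) (b : ℝ) (g : Eu n → ℝ) (x : Eu n) : ℝ :=
  wt ln b x * ∑ i, pd2 g i i x + b * wt ln (b - 1) x * pd g ln x

lemma ContDiff.pd {k m : WithTop ℕ∞} {g : Eu n → ℝ} (hg : ContDiff ℝ k g) (hmk : m + 1 ≤ k)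
    (i : Fin n) : ContDiff ℝ m (_root_.pd g i) :=
  (hg.fderiv_right hmk).clm_apply contDiff_const

lemma ContDiff.continuous_pd {g : Eu n → ℝ} (hg : ContDiff ℝ 1 g) (i : Fin n) :
    Continuous (_root_.pd g i) :=
  (hg.pd (m := 0) (by norm_num) i).continuous

lemma ContDiff.continuous_pd2 {g : Eu n → ℝ} (hg : ContDiff ℝ 2 g) (i j : Fin n) :
    Continuous (_root_.pd2 g i j) :=
  (hg.pd (m := 1) (by norm_num) j).continuous_pd i

lemma integral_mul_Lw (hb : 1 < b) {f g : Eu n → ℝ} (hf : ContDiff ℝ 1 f) (hg : ContDiff ℝ 2 g)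
    (h1 : ∀ i, Integrable fun x => f x * (wt ln b x * pd2 g i i x))
    (h2 : Integrable fun x => f x * (b * wt ln (b - 1) x * pd g ln x))
    (h3 : ∀ i, Integrable fun x => pd f i x * (wt ln b x * pd g i x))
    (h4 : ∀ i, Integrable fun x => f x * (wt ln b x * pd g i x)) :
    ∫ x, f x * Lw ln b g x = -∑ i, ∫ x, pd f i x * (wt ln b x * pd g i x) := by
  have key : ∀ i, ∫ x, f x * (wt ln b x * pd2 g i i x +
      (if i = ln then b * wt ln (b - 1) x else 0) * pd g i x) =
      -∫ x, pd f i x * (wt ln b x * pd g i x) := by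
    intro i
    have hd : ∀ x, fderiv ℝ (fun x => wt ln b x * pd g i x) x (EuclideanSpace.single i 1) =
        wt ln b x * pd2 g i i x + (if i = ln then b * wt ln (b - 1) x else 0) * pd g i x := by
      intro x
      have hg1 := ((hg.pd (m := 1) (by norm_num) i).differentiable (by norm_num)) x
      change fderiv ℝ (wt ln b * pd g i) x _ = _
      rw [((hasFDerivAt_wt hb x).mul hg1.hasFDerivAt).fderiv, ← fderiv_wt_single hb x i,
        (hasFDerivAt_wt hb x).fderiv]
      simp only [add_apply, smul_apply, smul_eq_mul]
      change wt ln b x * pd2 g i i x + pd g i x * _ = _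
      ring
    have hi : Integrable fun x => f x * (wt ln b x * pd2 g i i x +
        (if i = ln then b * wt ln (b - 1) x else 0) * pd g i x) := by
      by_cases h : i = ln
      · subst h
        refine ((h1 i).add h2).congr (Filter.Eventually.of_forall fun x => ?_)
        simp only [Pi.add_apply, if_true]; ring
      · simpa only [h, if_false, zero_mul, add_zero] using h1 i
    have := integral_mul_fderiv_eq_neg_fderiv_mul_of_integrable (μ := (volume : Measure (Eu n)))
      (f := f) (g := fun x => wt ln b x * pd g i x) (v := EuclideanSpace.single i 1)
      (h3 i) (by simpa only [hd] using hi) (h4 i) (fun x _ => hf.differentiable (by norm_num) x)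
      (fun x _ => ((hasFDerivAt_wt hb x).differentiableAt).mul
        (((hg.pd (m := 1) (by norm_num) i).differentiable (by norm_num)) x))
    simp only [hd] at this
    exact this
  rw [← Finset.sum_neg_distrib, ← Finset.sum_congr rfl fun i _ => key i]
  have hi : ∀ i, Integrable fun x => f x * (wt ln b x * pd2 g i i x +
        (if i = ln then b * wt ln (b - 1) x else 0) * pd g i x) := by
    intro i
    by_cases h : i = ln
    · subst h
      refine ((h1 i).add h2).congr (Filter.Eventually.of_forall fun x => ?_)
      simp only [Pi.add_apply, if_true]; ring
    · simpa only [h, if_false, zero_mul, add_zero] using h1 i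
  rw [← integral_finsetSum _ fun i _ => hi i]
  congr 1; ext x
  rw [← Finset.mul_sum, Finset.sum_add_distrib, Lw, Finset.mul_sum]
  simp

end Weight

section Rapid

variable {n : ℕ} {ln : Fin n}

/-- Jointly continuous functions of `(t, x)` that decay faster than any power of `x`, uniformly
for `t ∈ [0, T]`. -/
structure RapidOn (T : ℝ) (F : ℝ → Eu n → ℝ) : Prop where
  cont : Continuous (Function.uncurry F)
  decay : ∀ N : ℕ, ∃ C : ℝ, ∀ t ∈ Set.Icc 0 T, ∀ x, (1 + ‖x‖) ^ N * |F t x| ≤ C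

/-- Jointly continuous functions of `(t, x)` of polynomial growth. -/
structure PolyOn (T : ℝ) (F : ℝ → Eu n → ℝ) : Prop where
  cont : Continuous (Function.uncurry F)
  bound : ∃ (C : ℝ) (k : ℕ), ∀ t ∈ Set.Icc 0 T, ∀ x, |F t x| ≤ C * (1 + ‖x‖) ^ k

variable {T : ℝ} {F G : ℝ → Eu n → ℝ}

lemma RapidOn.polyOn (h : RapidOn T F) : PolyOn T F := by
  obtain ⟨C, hC⟩ := h.decay 0
  exact ⟨h.cont, C, 0, fun t ht x => by simpa using hC t ht x⟩

lemma RapidOn.add (hF : RapidOn T F) (hG : RapidOn T G) : RapidOn T fun t x => F t x + G t x := by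
  refine ⟨hF.cont.add hG.cont, fun N => ?_⟩
  obtain ⟨C, hC⟩ := hF.decay N
  obtain ⟨D, hD⟩ := hG.decay N
  refine ⟨C + D, fun t ht x => ?_⟩
  have := abs_add_le (F t x) (G t x)
  have h1 := hC t ht x
  have h2 := hD t ht x
  have h3 : (0 : ℝ) ≤ (1 + ‖x‖) ^ N := by positivity
  nlinarith

lemma RapidOn.mul_polyOn (hF : RapidOn T F) (hG : PolyOn T G) :
    RapidOn T fun t x => F t x * G t x := by
  refine ⟨hF.cont.mul hG.cont, fun N => ?_⟩
  obtain ⟨C, k, hC⟩ := hG.bound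
  obtain ⟨D, hD⟩ := hF.decay (N + k)
  refine ⟨D * |C|, fun t ht x => ?_⟩
  have h1 := hC t ht x
  have h2 := hD t ht x
  have h3 : C * (1 + ‖x‖) ^ k ≤ |C| * (1 + ‖x‖) ^ k := by gcongr; exact le_abs_self C
  calc (1 + ‖x‖) ^ N * |F t x * G t x| = (1 + ‖x‖) ^ N * |F t x| * |G t x| := by
        rw [abs_mul]; ring
    _ ≤ (1 + ‖x‖) ^ N * |F t x| * (|C| * (1 + ‖x‖) ^ k) := by gcongr; exact h1.trans h3
    _ = (1 + ‖x‖) ^ (N + k) * |F t x| * |C| := by rw [pow_add]; ring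
    _ ≤ D * |C| := by gcongr

lemma RapidOn.mul (hF : RapidOn T F) (hG : RapidOn T G) : RapidOn T fun t x => F t x * G t x :=
  hF.mul_polyOn hG.polyOn

lemma PolyOn.const (c : ℝ) : PolyOn T (fun _ (_ : Eu n) => c) :=
  ⟨by unfold Function.uncurry; fun_prop, |c|, 0, fun t _ x => by simp⟩

lemma PolyOn.coord (i : Fin n) : PolyOn T (fun _ (x : Eu n) => x i) := by
  refine ⟨by unfold Function.uncurry; fun_prop, 1, 1, fun t _ x => ?_⟩
  have := EuclideanSpace.norm_eq x
  have h := PiLp.norm_apply_le x i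
  rw [Real.norm_eq_abs] at h
  linarith

lemma RapidOn.const_mul (c : ℝ) (hF : RapidOn T F) : RapidOn T fun t x => c * F t x := by
  simpa only [mul_comm] using hF.mul_polyOn (PolyOn.const c)

lemma RapidOn.neg (hF : RapidOn T F) : RapidOn T fun t x => -F t x := by
  simpa only [neg_one_mul] using hF.const_mul (-1)

lemma RapidOn.zero : RapidOn T fun _ (_ : Eu n) => (0 : ℝ) :=
  ⟨by unfold Function.uncurry; fun_prop, fun N => ⟨0, fun t _ x => by simp⟩⟩

lemma RapidOn.sum {ι : Type*} (s : Finset ι) {F : ι → ℝ → Eu n → ℝ}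
    (h : ∀ i ∈ s, RapidOn T (F i)) : RapidOn T fun t x => ∑ i ∈ s, F i t x := by
  classical
  induction s using Finset.induction_on with
  | empty => simpa using RapidOn.zero
  | insert a s ha ih =>
    simp only [Finset.sum_insert ha]
    exact (h a (Finset.mem_insert_self _ _)).add (ih fun i hi => h i (Finset.mem_insert_of_mem hi))

lemma RapidOn.at (hF : RapidOn T F) {t : ℝ} (ht : t ∈ Set.Icc 0 T) (T' : ℝ) :
    RapidOn T' fun _ => F t := by
  refine ⟨hF.cont.comp (by fun_prop : Continuous fun z : ℝ × Eu n => (t, z.2)), fun N => ?_⟩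
  obtain ⟨C, hC⟩ := hF.decay N
  exact ⟨C, fun _ _ x => hC t ht x⟩

lemma RapidOn.reparam (hF : RapidOn T F) {T' : ℝ} {s : ℝ → ℝ} (hs : Continuous s)
    (hs' : ∀ t ∈ Set.Icc 0 T', s t ∈ Set.Icc 0 T) : RapidOn T' fun t => F (s t) := by
  refine ⟨hF.cont.comp (by fun_prop : Continuous fun z : ℝ × Eu n => (s z.1, z.2)), fun N => ?_⟩
  obtain ⟨C, hC⟩ := hF.decay N
  exact ⟨C, fun t ht x => hC _ (hs' t ht) x⟩

lemma RapidOn.of_support (hF : Continuous (Function.uncurry F)) {R : ℝ}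
    (h : ∀ t x, R ≤ ‖x‖ → F t x = 0) : RapidOn T F := by
  refine ⟨hF, fun N => ?_⟩
  have hK : IsCompact (Set.Icc 0 T ×ˢ Metric.closedBall (0 : Eu n) R) :=
    isCompact_Icc.prod (isCompact_closedBall _ _)
  obtain ⟨C, hC⟩ := hK.exists_bound_of_continuousOn
    (f := fun z : ℝ × Eu n => (1 + ‖z.2‖) ^ N * F z.1 z.2)
    (Continuous.continuousOn (by
      refine Continuous.mul (by fun_prop) hF))
  refine ⟨|C|, fun t ht x => ?_⟩
  by_cases hx : R ≤ ‖x‖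
  · rw [h t x hx]; simp
  · have := hC (t, x) ⟨ht, by simpa using (not_le.1 hx).le⟩
    rw [Real.norm_eq_abs, abs_mul, abs_of_nonneg (by positivity)] at this
    exact this.trans (le_abs_self C)

lemma wt_le (a : ℝ) (ha : 0 ≤ a) (x : Eu n) : wt ln a x ≤ (1 + ‖x‖) ^ ⌈a⌉₊ := by
  have h := PiLp.norm_apply_le x ln
  rw [Real.norm_eq_abs] at h
  have h1 : max (x ln) 0 ≤ 1 + ‖x‖ := max_le (by linarith [le_abs_self (x ln)]) (by positivity)
  calc wt ln a x ≤ (1 + ‖x‖) ^ a := Real.rpow_le_rpow (by positivity) h1 ha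
    _ ≤ (1 + ‖x‖) ^ (⌈a⌉₊ : ℝ) :=
        Real.rpow_le_rpow_of_exponent_le (by linarith [norm_nonneg x]) (Nat.le_ceil a)
    _ = _ := Real.rpow_natCast _ _

lemma polyOn_wt {a : ℝ} (ha : 0 ≤ a) : PolyOn T (fun _ (x : Eu n) => wt ln a x) :=
  ⟨(continuous_wt ha).comp continuous_snd, 1, ⌈a⌉₊, fun t _ x => by
    rw [abs_of_nonneg (wt_nonneg x), one_mul]; exact wt_le a ha x⟩

lemma integrable_one_add_norm_pow :
    Integrable fun x : Eu n => ((1 + ‖x‖) ^ (n + 1))⁻¹ := by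
  have := integrable_one_add_norm (E := Eu n) (μ := volume) (r := (n : ℝ) + 1) (by simp)
  refine this.congr (Filter.Eventually.of_forall fun x => ?_)
  simp only
  rw [Real.rpow_neg (by positivity)]
  congr 1
  exact_mod_cast Real.rpow_natCast (1 + ‖x‖) (n + 1)

lemma RapidOn.exists_bound (hF : RapidOn T F) :
    ∃ C : ℝ, ∀ t ∈ Set.Icc 0 T, ∀ x, |F t x| ≤ C * ((1 + ‖x‖) ^ (n + 1))⁻¹ := by
  obtain ⟨C, hC⟩ := hF.decay (n + 1)
  refine ⟨C, fun t ht x => ?_⟩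
  rw [← div_eq_mul_inv, le_div_iff₀ (by positivity), mul_comm]
  exact hC t ht x

lemma RapidOn.integrable (hF : RapidOn T F) {t : ℝ} (ht : t ∈ Set.Icc 0 T) :
    Integrable (F t) := by
  obtain ⟨C, hC⟩ := hF.exists_bound
  refine (integrable_one_add_norm_pow.const_mul C).mono' ?_
    (Filter.Eventually.of_forall fun x => hC t ht x)
  exact (hF.cont.comp (by fun_prop : Continuous fun x : Eu n => (t, x))).aestronglyMeasurable

lemma RapidOn.integrable_prod (hF : RapidOn T F) :
    Integrable (Function.uncurry F)
      ((volume.restrict (Set.Ioc 0 T)).prod (volume : Measure (Eu n))) := by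
  obtain ⟨C, hC⟩ := hF.exists_bound
  have h1 : Integrable (fun _ : ℝ => (1 : ℝ)) (volume.restrict (Set.Ioc 0 T)) :=
    integrable_const _
  refine (h1.mul_prod (integrable_one_add_norm_pow.const_mul C)).mono'
    hF.cont.aestronglyMeasurable ?_
  have : ∀ᵐ t ∂(volume.restrict (Set.Ioc 0 T)), t ∈ Set.Ioc 0 T :=
    ae_restrict_mem measurableSet_Ioc
  have h2 := (Measure.quasiMeasurePreserving_fst (μ := volume.restrict (Set.Ioc 0 T))
    (ν := (volume : Measure (Eu n)))).ae this
  filter_upwards [h2] with z hz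
  rw [one_mul]
  exact hC z.1 ⟨hz.1.le, hz.2⟩ z.2

lemma RapidOn.wt_mul (hF : RapidOn T F) {a : ℝ} (ha : 0 ≤ a) :
    RapidOn T fun t x => wt ln a x * F t x := by
  simpa only [mul_comm] using hF.mul_polyOn (polyOn_wt (ln := ln) ha)

lemma RapidOn.continuous_integral (hF : RapidOn T F) :
    ContinuousOn (fun t => ∫ x, F t x) (Set.Icc 0 T) := by
  obtain ⟨C, hC⟩ := hF.exists_bound
  refine continuousOn_of_dominated (bound := fun x => C * ((1 + ‖x‖) ^ (n + 1))⁻¹) ?_ ?_ ?_ ?_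
  · intro t _
    exact (hF.cont.comp (by fun_prop : Continuous fun x : Eu n => (t, x))).aestronglyMeasurable
  · exact fun t ht => Filter.Eventually.of_forall fun x => hC t ht x
  · exact integrable_one_add_norm_pow.const_mul C
  · exact Filter.Eventually.of_forall fun x =>
      (hF.cont.comp (by fun_prop : Continuous fun t : ℝ => (t, x))).continuousOn

/-- The fundamental theorem of calculus in `t`, integrated in `x`. -/
lemma RapidOn.integral_sub (hT : 0 ≤ T) (hF : RapidOn T F) (hG : RapidOn T G)
    (hd : ∀ x, ∀ t ∈ Set.Ioo 0 T, HasDerivAt (fun s => F s x) (G t x) t) :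
    (∫ x, F T x) - ∫ x, F 0 x = ∫ t in (0 : ℝ)..T, ∫ x, G t x := by
  rw [← MeasureTheory.integral_sub (hF.integrable ⟨hT, le_rfl⟩) (hF.integrable ⟨le_rfl, hT⟩)]
  rw [intervalIntegral.integral_of_le hT, integral_integral_swap hG.integrable_prod]
  congr 1; ext x
  rw [← intervalIntegral.integral_of_le hT]
  symm
  refine intervalIntegral.integral_eq_sub_of_hasDerivAt_of_le hT ?_ (hd x) ?_
  · exact (hF.cont.comp (by fun_prop : Continuous fun t : ℝ => (t, x))).continuousOn
  · exact (hG.cont.comp (by fun_prop : Continuous fun t : ℝ => (t, x))).intervalIntegrable _ _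

end Rapid

section Flow

variable {n : ℕ} {ln : Fin n} {b : ℝ}

/-- Rapidly decaying `C²` functions. -/
structure Rapid2 (g : Eu n → ℝ) : Prop where
  smooth : ContDiff ℝ 2 g
  self : RapidOn 0 fun _ => g
  pd : ∀ i, RapidOn 0 fun _ => pd g i
  pd2 : ∀ i j, RapidOn 0 fun _ => pd2 g i j

lemma Rapid2.integral_mul_Lw (hb : 1 < b) {f g : Eu n → ℝ} (hf : Rapid2 f) (hg : Rapid2 g) :
    ∫ x, f x * Lw ln b g x = -∑ i, ∫ x, _root_.pd f i x * (wt ln b x * _root_.pd g i x) := by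
  have h0 : (0 : ℝ) ∈ Set.Icc (0 : ℝ) 0 := by simp
  have hb0 : 0 ≤ b := by linarith
  have hb1 : 0 ≤ b - 1 := by linarith
  refine _root_.integral_mul_Lw hb (hf.smooth.of_le (by norm_num)) hg.smooth
    (fun i => (hf.self.mul ((hg.pd2 i i).wt_mul hb0)).integrable h0) ?_
    (fun i => ((hf.pd i).mul ((hg.pd i).wt_mul hb0)).integrable h0)
    (fun i => (hf.self.mul ((hg.pd i).wt_mul hb0)).integrable h0)
  have := (hf.self.mul (((hg.pd ln).wt_mul (ln := ln) hb1).const_mul b)).integrable h0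
  simpa only [mul_assoc] using this

lemma Rapid2.integral_mul_Lw_comm (hb : 1 < b) {f g : Eu n → ℝ} (hf : Rapid2 f) (hg : Rapid2 g) :
    ∫ x, f x * Lw ln b g x = ∫ x, g x * Lw ln b f x := by
  rw [hf.integral_mul_Lw hb hg, hg.integral_mul_Lw hb hf]
  congr 1
  refine Finset.sum_congr rfl fun i _ => integral_congr_ae (Filter.Eventually.of_forall fun x => ?_)
  simp only; ring

/-- Solutions of `∂_t U = Δ U + (b / x_n) ∂_n U - (κ / x_n²) U` on `x_n > 0` that are `C²` up to and
across the boundary and rapidly decaying. -/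
structure IsFlow (ln : Fin n) (b κ : ℝ) (U Ut : ℝ → Eu n → ℝ) : Prop where
  smooth : ∀ t, ContDiff ℝ 2 (U t)
  self : ∀ T, RapidOn T U
  pd : ∀ T i, RapidOn T fun t => pd (U t) i
  pd2 : ∀ T i j, RapidOn T fun t => pd2 (U t) i j
  dt : ∀ T, RapidOn T Ut
  hasDeriv : ∀ t, 0 < t → ∀ x, HasDerivAt (fun s => U s x) (Ut t x) t
  eq : ∀ t, 0 < t → ∀ x : Eu n, 0 < x ln →
    Ut t x = ∑ i, _root_.pd2 (U t) i i x + b * _root_.pd (U t) ln x / x ln - κ * U t x / x ln ^ 2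

variable {κ : ℝ} {U Ut V Vt : ℝ → Eu n → ℝ}

lemma IsFlow.rapid2 (h : IsFlow ln b κ U Ut) {t : ℝ} (ht : 0 ≤ t) : Rapid2 (U t) :=
  ⟨h.smooth t, (h.self t).at ⟨ht, le_rfl⟩ 0, fun i => (h.pd t i).at ⟨ht, le_rfl⟩ 0,
    fun i j => (h.pd2 t i j).at ⟨ht, le_rfl⟩ 0⟩

lemma Lw_of_pos {x : Eu n} (h : 0 < x ln) (g : Eu n → ℝ) :
    Lw ln b g x = wt ln b x * (∑ i, pd2 g i i x + b * pd g ln x / x ln) := by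
  rw [Lw, wt_of_pos h, wt_of_pos h, Real.rpow_sub_one h.ne']
  ring

lemma Lw_of_nonpos (hb : 1 < b) {x : Eu n} (h : x ln ≤ 0) (g : Eu n → ℝ) : Lw ln b g x = 0 := by
  rw [Lw, wt_of_nonpos (by linarith) h, wt_of_nonpos (by linarith) h]
  ring

lemma IsFlow.wt_mul_dt (hb : 1 < b) (h : IsFlow ln b κ U Ut) {t : ℝ} (ht : 0 < t) (x : Eu n) :
    wt ln b x * Ut t x = Lw ln b (U t) x - κ * (wt ln b x / x ln ^ 2) * U t x := by
  rcases lt_or_ge 0 (x ln) with hx | hx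
  · rw [Lw_of_pos hx, h.eq t ht x hx]; ring
  · rw [Lw_of_nonpos hb hx, wt_of_nonpos (by linarith) hx]; ring

/-- The semigroup is symmetric. -/
lemma IsFlow.pairing (hb : 1 < b) (hU : IsFlow ln b κ U Ut) (hV : IsFlow ln b κ V Vt) {t : ℝ}
    (ht : 0 ≤ t) :
    ∫ x, wt ln b x * (U (2 * t) x * V 0 x) = ∫ x, wt ln b x * (U t x * V t x) := by
  have hb0 : 0 ≤ b := by linarith
  have hs : Continuous fun s : ℝ => 2 * t - s := by fun_prop
  have hs' : ∀ s ∈ Set.Icc 0 t, 2 * t - s ∈ Set.Icc 0 (2 * t) := fun s hs =>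
    ⟨by linarith [hs.2], by linarith [hs.1]⟩
  have key := RapidOn.integral_sub ht
    (F := fun s x => wt ln b x * (U (2 * t - s) x * V s x))
    (G := fun s x => wt ln b x * (U (2 * t - s) x * Vt s x + -Ut (2 * t - s) x * V s x))
    ((((hU.self (2 * t)).reparam hs hs').mul (hV.self t)).wt_mul hb0)
    (((((hU.self (2 * t)).reparam hs hs').mul (hV.dt t)).add
      (((hU.dt (2 * t)).reparam hs hs').neg.mul (hV.self t))).wt_mul hb0) ?_
  · have hz : ∫ s in (0 : ℝ)..t, ∫ x, wt ln b x *
        (U (2 * t - s) x * Vt s x + -Ut (2 * t - s) x * V s x) = 0 := by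
      rw [intervalIntegral.integral_of_le ht, integral_Ioc_eq_integral_Ioo]
      refine setIntegral_eq_zero_of_forall_eq_zero fun s hs => ?_
      have e : ∀ x, wt ln b x * (U (2 * t - s) x * Vt s x + -Ut (2 * t - s) x * V s x) =
          U (2 * t - s) x * Lw ln b (V s) x - V s x * Lw ln b (U (2 * t - s)) x := by
        intro x
        have h1 := hV.wt_mul_dt hb hs.1 x
        have h2 := hU.wt_mul_dt hb (t := 2 * t - s) (by linarith [hs.2, hs.1]) x
        linear_combination U (2 * t - s) x * h1 - V s x * h2
      simp only [e]
      have r1 := hU.rapid2 (t := 2 * t - s) (by linarith [hs.2, hs.1])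
      have r2 := hV.rapid2 hs.1.le
      have h0 : (0 : ℝ) ∈ Set.Icc (0 : ℝ) 0 := by simp
      have hb1 : 0 ≤ b - 1 := by linarith
      have L : ∀ {g : Eu n → ℝ}, Rapid2 g → RapidOn 0 fun _ => Lw ln b g := by
        intro g hg
        have := ((RapidOn.sum Finset.univ fun i _ => hg.pd2 i i).wt_mul (ln := ln) hb0).add
          (((hg.pd ln).wt_mul (ln := ln) hb1).const_mul b)
        simp only [← mul_assoc] at this
        exact this
      rw [MeasureTheory.integral_sub ((r1.self.mul (L r2)).integrable h0)
        ((r2.self.mul (L r1)).integrable h0), r1.integral_mul_Lw_comm hb r2, sub_self]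
    rw [hz] at key
    have : 2 * t - t = t := by ring
    simp only [this, sub_zero] at key
    linarith
  · intro x s hs
    have h1 : HasDerivAt (fun s => U (2 * t - s) x) (-Ut (2 * t - s) x) s := by
      have h2 : HasDerivAt (fun s : ℝ => 2 * t - s) (-1) s := by
        simpa using (hasDerivAt_id s).const_sub (2 * t)
      have := (hU.hasDeriv (2 * t - s) (by linarith [hs.2, hs.1]) x).comp s h2
      rw [mul_neg_one] at this
      exact this
    have h3 := ((h1.mul (hV.hasDeriv s hs.1 x)).const_mul (wt ln b x))
    refine h3.congr_deriv ?_
    ring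

end Flow

section Cutoff

variable {n : ℕ} {ln : Fin n} {b : ℝ}

lemma pd_radial {χ : ℝ → ℝ} (hχ : Differentiable ℝ χ) (c : ℝ) (i : Fin n) (x : Eu n) :
    pd (fun x : Eu n => χ (c * ‖x‖ ^ 2)) i x = deriv χ (c * ‖x‖ ^ 2) * (2 * c * x i) := by
  have h1 : HasFDerivAt (fun x : Eu n => c * ‖x‖ ^ 2) (c • (2 • innerSL ℝ x)) x :=
    (hasStrictFDerivAt_norm_sq x).hasFDerivAt.const_mul c
  have h2 := (hχ (c * ‖x‖ ^ 2)).hasDerivAt.comp_hasFDerivAt x h1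
  have h3 : fderiv ℝ (fun x : Eu n => χ (c * ‖x‖ ^ 2)) x = _ := h2.fderiv
  rw [pd, h3]
  simp only [smul_apply, innerSL_apply_apply, smul_eq_mul, nsmul_eq_mul]
  rw [EuclideanSpace.inner_single_right]
  simp only [one_mul, conj_trivial]
  push_cast
  ring

lemma exists_cutoff (n : ℕ) (ln : Fin n) (b : ℝ) (hb : 1 < b) :
    ∃ M : ℝ, 0 ≤ M ∧ ∀ R : ℝ, 0 < R → ∃ β : Eu n → ℝ, ContDiff ℝ 2 β ∧ (∀ x, 0 ≤ β x) ∧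
      (∀ x, β x ≤ 1) ∧ (∀ x, ‖x‖ ≤ R → β x = 1) ∧ (∀ x, 2 * R ≤ ‖x‖ → β x = 0) ∧
      (∀ x, |Lw ln b β x| ≤ M / R ^ 2 * wt ln b x) ∧ ∀ x, 2 * R ≤ ‖x‖ → Lw ln b β x = 0 := by
  set χ : ℝ → ℝ := fun s => Real.smoothTransition (2 - s) with hχ
  have hχs : ContDiff ℝ 2 χ := Real.smoothTransition.contDiff.comp (by fun_prop)
  have hχ1 : ContDiff ℝ 1 (deriv χ) := ((contDiff_succ_iff_deriv (n := 1)).1 (by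
    rw [one_add_one_eq_two]; exact hχs)).2.2
  have hχ2 : Continuous (deriv (deriv χ)) := (contDiff_one_iff_deriv.1 hχ1).2
  set Ψ : ℝ → ℝ := fun s => 4 * s * deriv (deriv χ) s + (2 * n + 2 * b) * deriv χ s with hΨ
  have hΨc : Continuous Ψ := by
    have := hχ1.continuous
    fun_prop
  obtain ⟨M, hM⟩ := (isCompact_Icc (a := (0 : ℝ)) (b := 4)).exists_bound_of_continuousOn
    hΨc.continuousOn
  have hχ0 : ∀ s, 2 < s → χ =ᶠ[nhds s] fun _ => 0 := fun s hs => by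
    filter_upwards [lt_mem_nhds hs] with y hy
    exact Real.smoothTransition.zero_of_nonpos (by linarith)
  have hd0 : ∀ s, 2 < s → deriv χ s = 0 := fun s hs => by
    rw [(hχ0 s hs).deriv_eq]; simp
  have hdd0 : ∀ s, 2 < s → deriv (deriv χ) s = 0 := fun s hs => by
    rw [(hχ0 s hs).deriv.deriv_eq]; simp
  have hΨ0 : ∀ s, 2 < s → Ψ s = 0 := fun s hs => by
    rw [hΨ]; simp only; rw [hd0 s hs, hdd0 s hs]; ring
  refine ⟨|M|, abs_nonneg _, fun R hR => ?_⟩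
  set c : ℝ := (R ^ 2)⁻¹ with hc
  have hc0 : 0 < c := by positivity
  have hLw : ∀ x, Lw ln b (fun x : Eu n => χ (c * ‖x‖ ^ 2)) x =
      wt ln b x * (c * Ψ (c * ‖x‖ ^ 2)) := by
    intro x
    have hp1 : ∀ i, pd (fun x : Eu n => χ (c * ‖x‖ ^ 2)) i =
        fun x => deriv χ (c * ‖x‖ ^ 2) * (2 * c * x i) := fun i => by
      ext x; exact pd_radial (hχs.differentiable (by norm_num)) c i x
    have hp2 : ∀ i, pd2 (fun x : Eu n => χ (c * ‖x‖ ^ 2)) i i x =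
        deriv (deriv χ) (c * ‖x‖ ^ 2) * (2 * c * x i) ^ 2 + deriv χ (c * ‖x‖ ^ 2) * (2 * c) := by
      intro i
      rw [pd2, hp1 i]
      have hA : DifferentiableAt ℝ (fun x : Eu n => deriv χ (c * ‖x‖ ^ 2)) x := by
        have h1 : Differentiable ℝ (deriv χ) := hχ1.differentiable (by norm_num)
        exact (h1 _).comp x (by
          exact ((hasStrictFDerivAt_norm_sq x).hasFDerivAt.const_mul c).differentiableAt)
      have hB : HasFDerivAt (fun x : Eu n => 2 * c * x i)
          ((2 * c) • (EuclideanSpace.proj i : Eu n →L[ℝ] ℝ)) x :=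
        ((EuclideanSpace.proj i : Eu n →L[ℝ] ℝ).hasFDerivAt).const_mul (2 * c)
      have h3 := hA.hasFDerivAt.mul hB
      have h4 : fderiv ℝ (fun x : Eu n => deriv χ (c * ‖x‖ ^ 2) * (2 * c * x i)) x = _ := h3.fderiv
      rw [pd, h4]
      have h5 := pd_radial (hχ1.differentiable (by norm_num)) c i x
      rw [pd] at h5
      simp only [add_apply, smul_apply, smul_eq_mul, h5]
      simp
      ring
    have hsum : ∑ i, pd2 (fun x : Eu n => χ (c * ‖x‖ ^ 2)) i i x =
        4 * c * (c * ‖x‖ ^ 2) * deriv (deriv χ) (c * ‖x‖ ^ 2) +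
          n * (deriv χ (c * ‖x‖ ^ 2) * (2 * c)) := by
      simp only [hp2]
      rw [Finset.sum_add_distrib, ← Finset.mul_sum]
      simp only [mul_pow]
      rw [← Finset.mul_sum, ← EuclideanSpace.real_norm_sq_eq]
      simp
      ring
    have hx : wt ln (b - 1) x * x ln = wt ln b x := by
      rcases lt_or_ge 0 (x ln) with h | h
      · rw [wt_of_pos h, wt_of_pos h, Real.rpow_sub_one h.ne']; field_simp
      · rw [wt_of_nonpos (by linarith) h, wt_of_nonpos (by linarith) h, zero_mul]
    rw [Lw, hsum, hp1, hΨ]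
    simp only
    linear_combination (2 * b * c * deriv χ (c * ‖x‖ ^ 2)) * hx
  have hfar : ∀ x : Eu n, 2 * R ≤ ‖x‖ → 4 ≤ c * ‖x‖ ^ 2 := fun x hx => by
    rw [hc, inv_mul_eq_div, le_div_iff₀ (by positivity)]
    nlinarith
  refine ⟨fun x => χ (c * ‖x‖ ^ 2), ?_, fun x => Real.smoothTransition.nonneg _,
    fun x => Real.smoothTransition.le_one _, fun x hx => ?_, fun x hx => ?_, fun x => ?_,
    fun x hx => ?_⟩
  · exact hχs.comp (contDiff_const.mul (contDiff_norm_sq ℝ))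
  · refine Real.smoothTransition.one_of_one_le ?_
    have : c * ‖x‖ ^ 2 ≤ 1 := by
      rw [hc, inv_mul_eq_div, div_le_one (by positivity)]
      nlinarith [norm_nonneg x]
    linarith
  · exact Real.smoothTransition.zero_of_nonpos (by linarith [hfar x hx])
  · rw [hLw, abs_mul, abs_of_nonneg (wt_nonneg x), mul_comm]
    refine mul_le_mul_of_nonneg_right ?_ (wt_nonneg x)
    rw [abs_mul, abs_of_pos hc0, div_eq_inv_mul]
    refine mul_le_mul_of_nonneg_left ?_ hc0.le
    rcases le_or_gt (c * ‖x‖ ^ 2) 4 with h | h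
    · have := hM (c * ‖x‖ ^ 2) ⟨by positivity, h⟩
      rw [Real.norm_eq_abs] at this
      exact this.trans (le_abs_self M)
    · rw [hΨ0 _ (by linarith), abs_zero]; positivity
  · rw [hLw, hΨ0 _ (by linarith [hfar x hx])]; ring

end Cutoff

section Bilinear

variable {n : ℕ} {ln : Fin n} {b : ℝ}

lemma RapidOn.of_hasCompactSupport {f : Eu n → ℝ} (hf : Continuous f) (h : HasCompactSupport f)
    (T : ℝ) : RapidOn T fun _ => f := by
  obtain ⟨R, hR⟩ := h.isCompact.isBounded.subset_closedBall (0 : Eu n)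
  refine RapidOn.of_support (R := R + 1) (hf.comp continuous_snd) fun t x hx => ?_
  by_contra hne
  have := hR (subset_tsupport f hne)
  rw [mem_closedBall_zero_iff] at this
  linarith

lemma HasCompactSupport.pd {f : Eu n → ℝ} (h : HasCompactSupport f) (i : Fin n) :
    HasCompactSupport (pd f i) :=
  (h.fderiv (𝕜 := ℝ)).comp_left (g := fun L : Eu n →L[ℝ] ℝ => L (EuclideanSpace.single i 1)) rfl

lemma continuous_Lw (hb : 1 < b) {g : Eu n → ℝ} (hg : ContDiff ℝ 2 g) :
    Continuous (Lw ln b g) := by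
  have h1 := continuous_wt (ln := ln) (b := b) (by linarith)
  have h2 := continuous_wt (ln := ln) (b := b - 1) (by linarith)
  have h3 := fun i => hg.continuous_pd2 i i
  have h4 := (hg.of_le (by norm_num)).continuous_pd ln
  unfold Lw
  fun_prop

lemma integral_mul_Lw_comm_of_hasCompactSupport (hb : 1 < b) {f g : Eu n → ℝ}
    (hf : ContDiff ℝ 2 f) (hs : HasCompactSupport f) (hg : ContDiff ℝ 2 g) :
    ∫ x, f x * Lw ln b g x = ∫ x, g x * Lw ln b f x := by
  have w1 := continuous_wt (ln := ln) (b := b) (by linarith)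
  have w2 := continuous_wt (ln := ln) (b := b - 1) (by linarith)
  have f0 := hf.continuous
  have g0 := hg.continuous
  have f1 := fun i => (hf.of_le (by norm_num)).continuous_pd i
  have g1 := fun i => (hg.of_le (by norm_num)).continuous_pd i
  have f2 := fun i => hf.continuous_pd2 i i
  have g2 := fun i => hg.continuous_pd2 i i
  have I : ∀ {F G : Eu n → ℝ}, Continuous F → Continuous G → HasCompactSupport F →
      Integrable fun x => F x * G x := fun hF hG h =>
    (hF.mul hG).integrable_of_hasCompactSupport h.mul_right
  have I' : ∀ {F G : Eu n → ℝ}, Continuous F → Continuous G → HasCompactSupport F →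
      Integrable fun x => G x * F x := fun hF hG h =>
    (hG.mul hF).integrable_of_hasCompactSupport h.mul_left
  rw [integral_mul_Lw hb (hf.of_le (by norm_num)) hg
      (fun i => I f0 (w1.mul (g2 i)) hs) (I f0 ((continuous_const.mul w2).mul (g1 ln)) hs)
      (fun i => I (f1 i) (w1.mul (g1 i)) (hs.pd i)) (fun i => I f0 (w1.mul (g1 i)) hs),
    integral_mul_Lw hb (hg.of_le (by norm_num)) hf
      (fun i => I' (w1.mul (f2 i)) g0 ((hs.pd i).pd i).mul_left)
      (I' ((continuous_const.mul w2).mul (f1 ln)) g0 (hs.pd ln).mul_left)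
      (fun i => I' (w1.mul (f1 i)) (g1 i) (hs.pd i).mul_left)
      (fun i => I' (w1.mul (f1 i)) g0 (hs.pd i).mul_left)]
  congr 1
  refine Finset.sum_congr rfl fun i _ => integral_congr_ae (Filter.Eventually.of_forall fun x => ?_)
  simp only; ring

lemma RapidOn.abs_rpow {T : ℝ} {F : ℝ → Eu n → ℝ} (hF : RapidOn T F) {p : ℝ} (hp : 1 < p) :
    RapidOn T fun t x => |F t x| ^ p := by
  refine ⟨hF.cont.abs.rpow_const fun _ => Or.inr (by linarith), fun N => ?_⟩
  obtain ⟨C, hC⟩ := hF.decay 0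
  obtain ⟨D, hD⟩ := hF.decay N
  refine ⟨D * |C| ^ (p - 1), fun t ht x => ?_⟩
  have h1 : |F t x| ≤ |C| := by simpa using (hC t ht x).trans (le_abs_self C)
  have h2 : |F t x| ^ p = |F t x| * |F t x| ^ (p - 1) := by
    rw [← Real.rpow_one_add' (abs_nonneg _) (by linarith)]; congr 1; ring
  rw [abs_of_nonneg (by positivity), h2, ← mul_assoc]
  have h3 := hD t ht x
  exact mul_le_mul h3 (Real.rpow_le_rpow (abs_nonneg _) h1 (by linarith)) (by positivity)
    (le_trans (by positivity) h3)

variable {p q δ C κ : ℝ} {B : ℝ × ℝ → ℝ}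

lemma pd_comp_pair (hB : ContDiff ℝ 2 B) {u v : Eu n → ℝ} (hu : ContDiff ℝ 2 u)
    (hv : ContDiff ℝ 2 v) (k : Fin n) (x : Eu n) :
    pd (fun x => B (u x, v x)) k x = fderiv ℝ B (u x, v x) (pd u k x, pd v k x) := by
  have h1 := ((hu.differentiable (by norm_num)) x).hasFDerivAt
  have h2 := ((hv.differentiable (by norm_num)) x).hasFDerivAt
  have h3 := ((hB.differentiable (by norm_num)) (u x, v x)).hasFDerivAt.comp x (h1.prodMk h2)
  have h4 : fderiv ℝ (fun x => B (u x, v x)) x = _ := h3.fderiv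
  rw [pd, h4]
  rfl

lemma pd2_comp_pair (hB : ContDiff ℝ 2 B) {u v : Eu n → ℝ} (hu : ContDiff ℝ 2 u)
    (hv : ContDiff ℝ 2 v) (k : Fin n) (x : Eu n) :
    pd2 (fun x => B (u x, v x)) k k x =
      fderiv ℝ (fderiv ℝ B) (u x, v x) (pd u k x, pd v k x) (pd u k x, pd v k x) +
        fderiv ℝ B (u x, v x) (pd2 u k k x, pd2 v k k x) := by
  have e : pd (fun x => B (u x, v x)) k =
      fun x => fderiv ℝ B (u x, v x) (pd u k x, pd v k x) := by
    ext y; exact pd_comp_pair hB hu hv k y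
  have h1 := ((hu.differentiable (by norm_num)) x).hasFDerivAt
  have h2 := ((hv.differentiable (by norm_num)) x).hasFDerivAt
  have hB1 : Differentiable ℝ (fderiv ℝ B) :=
    (hB.fderiv_right (m := 1) (by norm_num)).differentiable (by norm_num)
  have h3 := (hB1 (u x, v x)).hasFDerivAt.comp x (h1.prodMk h2)
  have h5 := (((hu.pd (m := 1) (by norm_num) k).differentiable (by norm_num)) x).hasFDerivAt
  have h6 := (((hv.pd (m := 1) (by norm_num) k).differentiable (by norm_num)) x).hasFDerivAt
  have h7 := h3.clm_apply (h5.prodMk h6)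
  rw [pd2, e]
  have h8 : fderiv ℝ (fun x => fderiv ℝ B (u x, v x) (pd u k x, pd v k x)) x = _ := h7.fderiv
  rw [pd, h8, add_comm]
  rfl

variable {U Ut V Vt : ℝ → Eu n → ℝ}

lemma bellman_pointwise (hb : 1 < b) (hκ : 0 ≤ κ) (hB : IsBellman p q δ C B)
    (hU : IsFlow ln b 0 U Ut) (hV : IsFlow ln b κ V Vt) {t : ℝ} (ht : 0 < t) (i j : Fin n)
    (x : Eu n) :
    2 * (wt ln b x * (|pd (U t) j x| * |pd (V t) i x|)) ≤
      Lw ln b (fun x => B (U t x, V t x)) x -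
        wt ln b x * fderiv ℝ B (U t x, V t x) (Ut t x, Vt t x) := by
  rcases lt_or_ge 0 (x ln) with hx | hx
  swap
  · rw [Lw_of_nonpos hb hx, wt_of_nonpos (by linarith) hx]; simp
  obtain ⟨m, hm, hh⟩ := hB.hess (U t x, V t x)
  have hlin : ∀ a c : ℝ, fderiv ℝ B (U t x, V t x) (a, c) =
      a * fderiv ℝ B (U t x, V t x) (1, 0) + c * fderiv ℝ B (U t x, V t x) (0, 1) := by
    intro a c
    have : ((a, c) : ℝ × ℝ) = a • (1, 0) + c • (0, 1) := by simp
    rw [this, map_add, map_smul, map_smul, smul_eq_mul, smul_eq_mul]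
  have hs : 0 ≤ V t x * fderiv ℝ B (U t x, V t x) (0, 1) := hB.sign_snd (U t x, V t x)
  generalize fderiv ℝ B (U t x, V t x) (1, 0) = c₁ at hlin
  generalize fderiv ℝ B (U t x, V t x) (0, 1) = c₂ at hlin hs
  have hsum : 2 * (|pd (U t) j x| * |pd (V t) i x|) ≤
      ∑ k, fderiv ℝ (fderiv ℝ B) (U t x, V t x) (pd (U t) k x, pd (V t) k x)
        (pd (U t) k x, pd (V t) k x) := by
    have h1 : ∑ k, (m * pd (U t) k x ^ 2 + pd (V t) k x ^ 2 / m) ≤ _ :=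
      Finset.sum_le_sum fun k (_ : k ∈ Finset.univ) => hh (pd (U t) k x) (pd (V t) k x)
    refine le_trans ?_ h1
    rw [Finset.sum_add_distrib]
    have h2 : m * pd (U t) j x ^ 2 ≤ ∑ k, m * pd (U t) k x ^ 2 :=
      Finset.single_le_sum (f := fun k => m * pd (U t) k x ^ 2)
        (fun k _ => by positivity) (Finset.mem_univ j)
    have h3 : pd (V t) i x ^ 2 / m ≤ ∑ k, pd (V t) k x ^ 2 / m :=
      Finset.single_le_sum (f := fun k => pd (V t) k x ^ 2 / m)
        (fun k _ => by positivity) (Finset.mem_univ i)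
    have h4 : 2 * (|pd (U t) j x| * |pd (V t) i x|) ≤
        m * pd (U t) j x ^ 2 + pd (V t) i x ^ 2 / m := by
      rw [← sq_abs (pd (U t) j x), ← sq_abs (pd (V t) i x)]
      have : m * |pd (U t) j x| ^ 2 + |pd (V t) i x| ^ 2 / m - 2 * (|pd (U t) j x| * |pd (V t) i x|)
        = (m * |pd (U t) j x| - |pd (V t) i x|) ^ 2 / m := by field_simp; ring
      have h5 : 0 ≤ (m * |pd (U t) j x| - |pd (V t) i x|) ^ 2 / m := by positivity
      linarith
    linarith
  rw [Lw_of_pos hx, ← mul_sub, mul_left_comm]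
  refine mul_le_mul_of_nonneg_left (hsum.trans ?_) (wt_nonneg x)
  simp only [pd2_comp_pair hB.smooth (hU.smooth t) (hV.smooth t),
    pd_comp_pair hB.smooth (hU.smooth t) (hV.smooth t)]
  rw [Finset.sum_add_distrib, hU.eq t ht x hx, hV.eq t ht x hx]
  simp only [hlin]
  rw [Finset.sum_add_distrib, ← Finset.sum_mul, ← Finset.sum_mul]
  have hk : 0 ≤ κ * (V t x * c₂) / x ln ^ 2 := by positivity
  have : ∀ S a c d e f g h : ℝ, S ≤ (S + (a * c + d * e)) + b * (f * c + g * e) / x ln -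
      ((a + b * f / x ln - 0 * h / x ln ^ 2) * c + (d + b * g / x ln - κ * V t x / x ln ^ 2) * e) ↔
      0 ≤ κ * (V t x * e) / x ln ^ 2 := by
    intro S a c d e f g h
    rw [← sub_nonneg]
    have : (S + (a * c + d * e)) + b * (f * c + g * e) / x ln -
      ((a + b * f / x ln - 0 * h / x ln ^ 2) * c + (d + b * g / x ln - κ * V t x / x ln ^ 2) * e) - S
      = κ * (V t x * e) / x ln ^ 2 := by ring
    rw [this]
  exact (this _ _ _ _ _ _ _ _).2 hk

end Bilinear

section Bilinear

variable {n : ℕ} {ln : Fin n} {b : ℝ} {p q δ C κ : ℝ} {B : ℝ × ℝ → ℝ} {U Ut V Vt : ℝ → Eu n → ℝ}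

lemma RapidOn.abs {T : ℝ} {F : ℝ → Eu n → ℝ} (hF : RapidOn T F) : RapidOn T fun t x => |F t x| :=
  ⟨hF.cont.abs, fun N => by simpa only [abs_abs] using hF.decay N⟩

lemma IsFlow.rapid_gradients (hb : 1 < b) (hU : IsFlow ln b 0 U Ut) (hV : IsFlow ln b κ V Vt)
    (T : ℝ) (i j : Fin n) :
    RapidOn T fun t x => wt ln b x * (|_root_.pd (U t) j x| * |_root_.pd (V t) i x|) :=
  ((hU.pd T j).abs.mul (hV.pd T i).abs).wt_mul (by linarith)

lemma integral_cutoff_gradients_le (hb : 1 < b) (hp : 1 < p) (hq : 1 < q) (hκ : 0 ≤ κ)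
    (hC : 0 < C)
    (hδ : 0 < δ) (hB : IsBellman p q δ C B)
    (hU : IsFlow ln b 0 U Ut) (hV : IsFlow ln b κ V Vt) {T : ℝ} (hT : 0 ≤ T) (i j : Fin n)
    {β : Eu n → ℝ} {R L : ℝ} (hL : 0 ≤ L) (hβ : ContDiff ℝ 2 β) (hβ0 : ∀ x, 0 ≤ β x)
    (hβ1 : ∀ x, β x ≤ 1) (hβR : ∀ x, 2 * R ≤ ‖x‖ → β x = 0)
    (hLβ : ∀ x, |Lw ln b β x| ≤ L * wt ln b x) (hLβR : ∀ x, 2 * R ≤ ‖x‖ → Lw ln b β x = 0) :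
    2 * ∫ t in (0 : ℝ)..T, ∫ x, β x * (wt ln b x * (|pd (U t) j x| * |pd (V t) i x|)) ≤
      L * C * (∫ t in (0 : ℝ)..T, ∫ x, wt ln b x * (|U t x| ^ p + |V t x| ^ q)) +
      C * (∫ x, wt ln b x * (|U 0 x| ^ p + |V 0 x| ^ q)) +
      δ * ((L * C * T + C) * ∫ x in Metric.closedBall 0 (2 * R), wt ln b x) := by
  have hb0 : 0 ≤ b := by linarith
  have w1 := continuous_wt (ln := ln) (b := b) hb0
  have hBc := hB.smooth.continuous
  have hBd : Continuous (fderiv ℝ B) := (hB.smooth.fderiv_right (m := 1) (by norm_num)).continuous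
  have cU := (hU.self T).cont
  have cV := (hV.self T).cont
  have cUt := (hU.dt T).cont
  have cVt := (hV.dt T).cont
  have hsupp : HasCompactSupport β := by
    refine HasCompactSupport.of_support_subset_isCompact (isCompact_closedBall 0 (2 * R)) ?_
    intro x hx
    rw [mem_closedBall_zero_iff]
    by_contra h
    exact hx (hβR x (not_le.1 h).le)
  set vol := ∫ x in Metric.closedBall (0 : Eu n) (2 * R), wt ln b x with hvol
  have ivol : Integrable ((Metric.closedBall (0 : Eu n) (2 * R)).indicator (wt ln b)) :=
    (w1.continuousOn.integrableOn_compact (isCompact_closedBall _ _)).integrable_indicator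
      measurableSet_closedBall
  have evol : ∫ x, (Metric.closedBall (0 : Eu n) (2 * R)).indicator (wt ln b) x = vol :=
    integral_indicator measurableSet_closedBall
  have rΛ := hU.rapid_gradients hb hV T i j
  have rβ : PolyOn T fun _ => β := (RapidOn.of_hasCompactSupport hβ.continuous hsupp T).polyOn
  have rβΛ : RapidOn T fun t x => β x * (wt ln b x * (|pd (U t) j x| * |pd (V t) i x|)) := by
    simpa only [mul_comm] using rΛ.mul_polyOn rβ
  have ra : RapidOn T fun t x => wt ln b x * (|U t x| ^ p + |V t x| ^ q) :=
    (((hU.self T).abs_rpow hp).add ((hV.self T).abs_rpow hq)).wt_mul hb0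
  have rG : RapidOn T fun t x => β x * (wt ln b x * B (U t x, V t x)) := by
    refine RapidOn.of_support (R := 2 * R) ?_ fun t x hx => by rw [hβR x hx, zero_mul]
    exact (hβ.continuous.comp continuous_snd).mul ((w1.comp continuous_snd).mul
      (hBc.comp (cU.prodMk cV)))
  have rGt : RapidOn T fun t x =>
      β x * (wt ln b x * fderiv ℝ B (U t x, V t x) (Ut t x, Vt t x)) := by
    refine RapidOn.of_support (R := 2 * R) ?_ fun t x hx => by rw [hβR x hx, zero_mul]
    exact (hβ.continuous.comp continuous_snd).mul ((w1.comp continuous_snd).mul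
      ((hBd.comp (cU.prodMk cV)).clm_apply (cUt.prodMk cVt)))
  have ftc := RapidOn.integral_sub hT rG rGt (fun x t ht => by
    have h1 := (hU.hasDeriv t ht.1 x).prodMk (hV.hasDeriv t ht.1 x)
    have h2 := ((hB.smooth.differentiable (by norm_num)) (U t x, V t x)).hasFDerivAt
    exact ((h2.comp_hasDerivAt t h1).const_mul (wt ln b x)).const_mul (β x))
  have hGle : ∀ t x, wt ln b x * B (U t x, V t x) ≤
      C * (wt ln b x * (|U t x| ^ p + |V t x| ^ q)) + C * δ * wt ln b x := by
    intro t x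
    have := mul_le_mul_of_nonneg_left (hB.le (U t x, V t x)) (wt_nonneg (ln := ln) (b := b) x)
    simp only at this
    linarith
  have hmem : ∀ x : Eu n, ¬ 2 * R ≤ ‖x‖ →
      (Metric.closedBall (0 : Eu n) (2 * R)).indicator (wt ln b) x = wt ln b x := fun x hx =>
    Set.indicator_of_mem (by rw [mem_closedBall_zero_iff]; exact (not_le.1 hx).le) _
  have hind0 : ∀ x : Eu n, 0 ≤ (Metric.closedBall (0 : Eu n) (2 * R)).indicator (wt ln b) x :=
    fun x => Set.indicator_nonneg (fun y _ => wt_nonneg y) x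
  have ha0 : ∀ t x, 0 ≤ wt ln b x * (|U t x| ^ p + |V t x| ^ q) := fun t x =>
    mul_nonneg (wt_nonneg x) (by positivity)
  have per : ∀ t ∈ Set.Ioo 0 T,
      2 * (∫ x, β x * (wt ln b x * (|pd (U t) j x| * |pd (V t) i x|))) +
        ∫ x, β x * (wt ln b x * fderiv ℝ B (U t x, V t x) (Ut t x, Vt t x)) ≤
      L * C * (∫ x, wt ln b x * (|U t x| ^ p + |V t x| ^ q)) + L * C * δ * vol := by
    intro t ht
    have ht' : t ∈ Set.Icc 0 T := ⟨ht.1.le, ht.2.le⟩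
    have hG2 : ContDiff ℝ 2 fun x => B (U t x, V t x) :=
      hB.smooth.comp ((hU.smooth t).prodMk (hV.smooth t))
    have hcomm := integral_mul_Lw_comm_of_hasCompactSupport (ln := ln) hb hβ hsupp hG2
    have i1 := (rβΛ.integrable ht').const_mul 2
    have i2 := rGt.integrable ht'
    have i3 : Integrable fun x => β x * Lw ln b (fun x => B (U t x, V t x)) x :=
      (hβ.continuous.mul (continuous_Lw hb hG2)).integrable_of_hasCompactSupport hsupp.mul_right
    rw [← integral_const_mul, ← integral_add i1 i2]
    calc _ ≤ ∫ x, β x * Lw ln b (fun x => B (U t x, V t x)) x := by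
          refine integral_mono (i1.add i2) i3 fun x => ?_
          have h1 := bellman_pointwise hb hκ hB hU hV ht.1 i j x
          have h2 := mul_le_mul_of_nonneg_left h1 (hβ0 x)
          linarith
      _ = ∫ x, B (U t x, V t x) * Lw ln b β x := hcomm
      _ ≤ ∫ x, (L * C * (wt ln b x * (|U t x| ^ p + |V t x| ^ q)) + L * C * δ *
            (Metric.closedBall (0 : Eu n) (2 * R)).indicator (wt ln b) x) := by
          refine integral_mono ?_ (((ra.integrable ht').const_mul _).add (ivol.const_mul _))
            fun x => ?_
          · refine (hG2.continuous.mul (continuous_Lw hb hβ)).integrable_of_hasCompactSupport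
              (HasCompactSupport.mul_left ?_)
            refine HasCompactSupport.of_support_subset_isCompact
              (isCompact_closedBall 0 (2 * R)) ?_
            intro x hx
            rw [mem_closedBall_zero_iff]
            by_contra h
            exact hx (hLβR x (not_le.1 h).le)
          · simp only
            by_cases hx : 2 * R ≤ ‖x‖
            · rw [hLβR x hx, mul_zero]
              have := ha0 t x
              have := hind0 x
              positivity
            · rw [hmem x hx]
              have h1 : B (U t x, V t x) * Lw ln b β x ≤ B (U t x, V t x) * (L * wt ln b x) :=
                mul_le_mul_of_nonneg_left ((le_abs_self _).trans (hLβ x)) (hB.nonneg _)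
              have h2 := mul_le_mul_of_nonneg_left (hGle t x) hL
              linarith
      _ = _ := by
          rw [integral_add ((ra.integrable ht').const_mul _) (ivol.const_mul _),
            integral_const_mul, integral_const_mul, evol]
  have uIcc : Set.uIcc 0 T = Set.Icc 0 T := Set.uIcc_of_le hT
  have c1 : IntervalIntegrable (fun t => ∫ x, β x * (wt ln b x * (|pd (U t) j x| * |pd (V t) i x|)))
      volume 0 T := (uIcc ▸ rβΛ.continuous_integral).intervalIntegrable
  have c2 : IntervalIntegrable (fun t => ∫ x,
      β x * (wt ln b x * fderiv ℝ B (U t x, V t x) (Ut t x, Vt t x))) volume 0 T :=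
    (uIcc ▸ rGt.continuous_integral).intervalIntegrable
  have c3 : IntervalIntegrable (fun t => ∫ x, wt ln b x * (|U t x| ^ p + |V t x| ^ q)) volume 0 T :=
    (uIcc ▸ ra.continuous_integral).intervalIntegrable
  have main := intervalIntegral.integral_mono_on_of_le_Ioo hT ((c1.const_mul 2).add c2)
    ((c3.const_mul (L * C)).add (intervalIntegrable_const (c := L * C * δ * vol))) per
  rw [intervalIntegral.integral_add (c1.const_mul 2) c2,
    intervalIntegral.integral_add (c3.const_mul (L * C)) intervalIntegrable_const,
    intervalIntegral.integral_const_mul, intervalIntegral.integral_const_mul,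
    intervalIntegral.integral_const, ← ftc, smul_eq_mul, sub_zero] at main
  have hend : 0 ≤ ∫ x, β x * (wt ln b x * B (U T x, V T x)) :=
    integral_nonneg fun x => mul_nonneg (hβ0 x) (mul_nonneg (wt_nonneg x) (hB.nonneg _))
  have h0 : (0 : ℝ) ∈ Set.Icc 0 T := ⟨le_rfl, hT⟩
  have hstart : ∫ x, β x * (wt ln b x * B (U 0 x, V 0 x)) ≤
      C * (∫ x, wt ln b x * (|U 0 x| ^ p + |V 0 x| ^ q)) + C * δ * vol := by
    rw [← evol, ← integral_const_mul, ← integral_const_mul,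
      ← integral_add ((ra.integrable h0).const_mul _) (ivol.const_mul _)]
    refine integral_mono (rG.integrable h0) (((ra.integrable h0).const_mul _).add
      (ivol.const_mul _)) fun x => ?_
    simp only
    by_cases hx : 2 * R ≤ ‖x‖
    · rw [hβR x hx, zero_mul]
      have := ha0 0 x
      have := hind0 x
      positivity
    · rw [hmem x hx]
      refine le_trans ?_ (hGle 0 x)
      exact mul_le_of_le_one_left (mul_nonneg (wt_nonneg x) (hB.nonneg _)) (hβ1 x)
  linarith

/-- The bilinear embedding. -/
theorem bilinear_embedding (hpq : p.HolderConjugate q) (hb : 1 < b) :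
    ∃ C : ℝ, 0 < C ∧ ∀ (κ : ℝ) (U Ut V Vt : ℝ → Eu n → ℝ), 0 ≤ κ → IsFlow ln b 0 U Ut →
      IsFlow ln b κ V Vt → ∀ T : ℝ, 0 ≤ T → ∀ i j : Fin n,
      ∫ t in (0 : ℝ)..T, ∫ x, wt ln b x * (|pd (U t) j x| * |pd (V t) i x|) ≤
        C * (∫ x, wt ln b x * (|U 0 x| ^ p + |V 0 x| ^ q)) := by
  obtain ⟨C, hC, hBell⟩ := exists_isBellman hpq
  refine ⟨C / 2, by positivity, fun κ U Ut V Vt hκ hU hV T hT i j => ?_⟩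
  obtain ⟨M, hM, hcut⟩ := exists_cutoff n ln b hb
  choose β hβ hβ0 hβ1 hβI hβR hLβ hLβR using fun k : ℕ => hcut (k + 1) (by positivity)
  set A := ∫ t in (0 : ℝ)..T, ∫ x, wt ln b x * (|U t x| ^ p + |V t x| ^ q) with hA
  set A0 := ∫ x, wt ln b x * (|U 0 x| ^ p + |V 0 x| ^ q) with hA0
  have hk : ∀ k : ℕ, 2 * ∫ t in (0 : ℝ)..T, ∫ x, β k x * (wt ln b x *
      (|pd (U t) j x| * |pd (V t) i x|)) ≤
      M / ((k : ℝ) + 1) ^ 2 * C * A + C * A0 + 1 / ((k : ℝ) + 1) := by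
    intro k
    have hL : 0 ≤ M / ((k : ℝ) + 1) ^ 2 := by positivity
    set D : ℝ := (M / ((k : ℝ) + 1) ^ 2 * C * T + C) *
      ∫ x in Metric.closedBall (0 : Eu n) (2 * ((k : ℝ) + 1)), wt ln b x with hD
    have hD0 : 0 ≤ D := mul_nonneg (by positivity) (integral_nonneg fun x => wt_nonneg x)
    have hδ : 0 < 1 / (((k : ℝ) + 1) * (1 + D)) := by positivity
    obtain ⟨B, hB⟩ := hBell _ hδ
    refine (integral_cutoff_gradients_le hb hpq.lt hpq.symm.lt hκ hC hδ hB hU hV hT i j hL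
      (hβ k) (hβ0 k)
      (hβ1 k) (hβR k) (hLβ k) (hLβR k)).trans ?_
    have : 1 / (((k : ℝ) + 1) * (1 + D)) * D ≤ 1 / ((k : ℝ) + 1) := by
      rw [div_mul_eq_mul_div, div_le_div_iff₀ (by positivity) (by positivity)]
      nlinarith [Nat.cast_nonneg (α := ℝ) k]
    rw [← hD]
    linarith
  have rΛ := hU.rapid_gradients hb hV T i j
  have hlim : Filter.Tendsto (fun k : ℕ => 2 * ∫ t in (0 : ℝ)..T, ∫ x, β k x * (wt ln b x *
      (|pd (U t) j x| * |pd (V t) i x|))) Filter.atTop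
      (nhds (2 * ∫ t in (0 : ℝ)..T, ∫ x, wt ln b x * (|pd (U t) j x| * |pd (V t) i x|))) := by
    refine Filter.Tendsto.const_mul 2 ?_
    have e1 := integral_prod _ rΛ.integrable_prod
    have rβΛ : ∀ k, RapidOn T fun t x =>
        β k x * (wt ln b x * (|pd (U t) j x| * |pd (V t) i x|)) := fun k => by
      have hsupp : HasCompactSupport (β k) := by
        refine HasCompactSupport.of_support_subset_isCompact
          (isCompact_closedBall 0 (2 * ((k : ℝ) + 1))) ?_
        intro x hx
        rw [mem_closedBall_zero_iff]
        by_contra h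
        exact hx (hβR k x (not_le.1 h).le)
      simpa only [mul_comm] using rΛ.mul_polyOn
        (RapidOn.of_hasCompactSupport (hβ k).continuous hsupp T).polyOn
    have e2 := fun k => integral_prod _ (rβΛ k).integrable_prod
    simp only [Function.uncurry_apply_pair] at e1 e2
    simp only [intervalIntegral.integral_of_le hT]
    simp only [← e1, ← e2]
    refine tendsto_integral_of_dominated_convergence _
      (fun k => (rβΛ k).cont.aestronglyMeasurable) rΛ.integrable_prod (fun k => ?_) ?_
    · refine Filter.Eventually.of_forall fun z => ?_
      have : 0 ≤ wt ln b z.2 * (|pd (U z.1) j z.2| * |pd (V z.1) i z.2|) :=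
        mul_nonneg (wt_nonneg _) (by positivity)
      rw [Function.uncurry, Function.uncurry, Real.norm_of_nonneg (mul_nonneg (hβ0 k _) this)]
      exact mul_le_of_le_one_left this (hβ1 k _)
    · refine Filter.Eventually.of_forall fun z => ?_
      refine tendsto_const_nhds.congr' ?_
      filter_upwards [Filter.eventually_ge_atTop ⌈‖z.2‖⌉₊] with k hk
      have : ‖z.2‖ ≤ (k : ℝ) + 1 := by
        have := Nat.le_ceil ‖z.2‖
        have : (⌈‖z.2‖⌉₊ : ℝ) ≤ k := by exact_mod_cast hk
        linarith
      simp only [Function.uncurry]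
      rw [hβI k z.2 this, one_mul]
  have hlim2 : Filter.Tendsto (fun k : ℕ => M / ((k : ℝ) + 1) ^ 2 * C * A + C * A0 +
      1 / ((k : ℝ) + 1)) Filter.atTop (nhds (0 * C * A + C * A0 + 0)) := by
    have h1 : Filter.Tendsto (fun k : ℕ => 1 / ((k : ℝ) + 1)) Filter.atTop (nhds 0) :=
      tendsto_one_div_add_atTop_nhds_zero_nat
    have h2 : Filter.Tendsto (fun k : ℕ => M / ((k : ℝ) + 1) ^ 2) Filter.atTop (nhds 0) := by
      have := (h1.pow 2).const_mul M
      simp only [zero_pow two_ne_zero, mul_zero, div_pow, one_pow, mul_one_div] at this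
      exact this
    exact (((h2.mul_const C).mul_const A).add_const _).add h1
  have := le_of_tendsto_of_tendsto' hlim hlim2 hk
  linarith

end Bilinear

section Average

open scoped ContDiff

variable {n : ℕ} {ln : Fin n} {ν : Measure (Eu n × ℝ)}
  {F : Type} [NormedAddCommGroup F]

/-- The point `(x + √t z, √t q)` reached from `(x, 0)` by the increment `w = (z, q)`. -/
def spread (t : ℝ) (x : Eu n) (w : Eu n × ℝ) : Eu n × ℝ :=
  (x + √t • w.1, √t * w.2)

/-- All polynomial moments are finite. -/
def HasMoments (ν : Measure (Eu n × ℝ)) : Prop :=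
  ∀ N : ℕ, Integrable (fun w : Eu n × ℝ => (1 + ‖w‖) ^ N) ν

lemma HasMoments.isFiniteMeasure (hν : HasMoments ν) : IsFiniteMeasure ν := by
  have h := hν 0
  simp only [pow_zero] at h
  rcases (integrable_const_iff (μ := ν) (c := (1 : ℝ))).1 h with h | h
  · norm_num at h
  · exact h

lemma continuous_spread :
    Continuous fun z : (ℝ × Eu n) × (Eu n × ℝ) => spread z.1.1 z.1.2 z.2 := by
  unfold spread
  fun_prop

lemma norm_spread_sub_le (t : ℝ) (x : Eu n) (w : Eu n × ℝ) :
    ‖x‖ ≤ ‖spread t x w‖ + √t * ‖w‖ := by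
  have h1 : ‖x + √t • w.1‖ ≤ ‖spread t x w‖ := norm_fst_le (spread t x w)
  have h2 : ‖w.1‖ ≤ ‖w‖ := norm_fst_le w
  have h3 : ‖√t • w.1‖ ≤ √t * ‖w‖ := by
    rw [norm_smul, Real.norm_of_nonneg (Real.sqrt_nonneg t)]
    gcongr
  have h4 : ‖x‖ ≤ ‖x + √t • w.1‖ + ‖√t • w.1‖ := by
    simpa using norm_sub_le (x + √t • w.1) (√t • w.1)
  linarith

lemma integrable_avg (hν : HasMoments ν) {H : Eu n × ℝ → F} (hH : Continuous H)
    (hs : HasCompactSupport H) (t : ℝ) (x : Eu n) :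
    Integrable (fun w => H (spread t x w)) ν := by
  have := hν.isFiniteMeasure
  obtain ⟨C, hC⟩ := hs.exists_bound_of_continuous hH
  refine Integrable.of_bound ?_ C (Filter.Eventually.of_forall fun w => hC _)
  exact (hH.comp (continuous_spread.comp
    (by fun_prop : Continuous fun w => ((t, x), w)))).aestronglyMeasurable

variable [NormedSpace ℝ F]

/-- The average of `H` over the increments `w`, scaled parabolically, with respect to `ν`. -/
def avg (ν : Measure (Eu n × ℝ)) (H : Eu n × ℝ → F) (t : ℝ) (x : Eu n) : F :=
  ∫ w, H (spread t x w) ∂ν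

lemma continuous_avg (hν : HasMoments ν) {H : Eu n × ℝ → F} (hH : Continuous H)
    (hs : HasCompactSupport H) : Continuous (Function.uncurry (avg ν H)) := by
  have := hν.isFiniteMeasure
  obtain ⟨C, hC⟩ := hs.exists_bound_of_continuous hH
  refine continuous_of_dominated (bound := fun _ => C) (fun z => ?_) (fun z => ?_)
    (integrable_const C) ?_
  · exact (hH.comp (continuous_spread.comp (by fun_prop : Continuous fun w => (z, w)))).aestronglyMeasurable
  · exact Filter.Eventually.of_forall fun w => hC _
  · exact Filter.Eventually.of_forall fun w =>
      hH.comp (continuous_spread.comp (by fun_prop : Continuous fun z => (z, w)))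

lemma rapidOn_avg (hν : HasMoments ν) {H : Eu n × ℝ → ℝ} (hH : Continuous H)
    (hs : HasCompactSupport H) (T : ℝ) : RapidOn T (avg ν H) := by
  refine ⟨continuous_avg hν hH hs, fun N => ?_⟩
  obtain ⟨C, hC⟩ := hs.exists_bound_of_continuous hH
  obtain ⟨R, hR⟩ := hs.isCompact.isBounded.exists_norm_le
  have hC0 : 0 ≤ C := (norm_nonneg _).trans (hC 0)
  have hb : ∀ t ∈ Set.Icc 0 T, ∀ x w, (1 + ‖x‖) ^ N * ‖H (spread t x w)‖ ≤
      C * (1 + |R| + √T) ^ N * (1 + ‖w‖) ^ N := by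
    intro t ht x w
    by_cases h : spread t x w ∈ tsupport H
    · have h1 := norm_spread_sub_le t x w
      have h2 := (hR _ h).trans (le_abs_self R)
      have h3 : √t ≤ √T := Real.sqrt_le_sqrt ht.2
      have h4 : 1 + ‖x‖ ≤ (1 + |R| + √T) * (1 + ‖w‖) := by
        have := mul_le_mul_of_nonneg_right h3 (norm_nonneg w)
        have h5 : 0 ≤ |R| * ‖w‖ := by positivity
        have h6 := Real.sqrt_nonneg T
        nlinarith [norm_nonneg w]
      calc (1 + ‖x‖) ^ N * ‖H (spread t x w)‖ ≤ ((1 + |R| + √T) * (1 + ‖w‖)) ^ N * C := by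
            gcongr
            exact hC _
        _ = _ := by rw [mul_pow]; ring
    · rw [image_eq_zero_of_notMem_tsupport h]
      simp only [norm_zero, mul_zero]
      positivity
  refine ⟨∫ w, C * (1 + |R| + √T) ^ N * (1 + ‖w‖) ^ N ∂ν, fun t ht x => ?_⟩
  calc (1 + ‖x‖) ^ N * |avg ν H t x| ≤ (1 + ‖x‖) ^ N * ∫ w, ‖H (spread t x w)‖ ∂ν := by
        gcongr
        exact norm_integral_le_integral_norm (fun w => H (spread t x w))
    _ = ∫ w, (1 + ‖x‖) ^ N * ‖H (spread t x w)‖ ∂ν := (integral_const_mul _ _).symm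
    _ ≤ _ := integral_mono (((integrable_avg hν hH hs t x).norm).const_mul _)
        ((hν N).const_mul _) (hb t ht x)

/-- The derivative of `H` along the first factor. -/
def fderivFst (H : Eu n × ℝ → F) (v : Eu n × ℝ) : Eu n →L[ℝ] F :=
  (fderiv ℝ H v).comp (ContinuousLinearMap.inl ℝ (Eu n) ℝ)

lemma contDiff_fderivFst {H : Eu n × ℝ → F} (hH : ContDiff ℝ ∞ H) :
    ContDiff ℝ ∞ (fderivFst H) := by
  unfold fderivFst
  exact (hH.fderiv_right (m := ∞) (by simp)).clm_comp contDiff_const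

lemma hasCompactSupport_fderivFst {H : Eu n × ℝ → F} (hs : HasCompactSupport H) :
    HasCompactSupport (fderivFst H) :=
  (hs.fderiv ℝ).comp_left (g := fun L : (Eu n × ℝ) →L[ℝ] F => L.comp (.inl ℝ (Eu n) ℝ))
    (ContinuousLinearMap.zero_comp _)

lemma hasFDerivAt_avg [CompleteSpace F] (hν : HasMoments ν) {H : Eu n × ℝ → F}
    (hH : ContDiff ℝ ∞ H) (hs : HasCompactSupport H) (t : ℝ) (x : Eu n) :
    HasFDerivAt (avg ν H t) (avg ν (fderivFst H) t x) x := by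
  have := hν.isFiniteMeasure
  have hc' := (contDiff_fderivFst hH).continuous
  have hs' := hasCompactSupport_fderivFst hs
  obtain ⟨C, hC⟩ := hs'.exists_bound_of_continuous hc'
  refine hasFDerivAt_integral_of_dominated_of_fderiv_le (bound := fun _ => C)
    (F' := fun x w => fderivFst H (spread t x w)) Filter.univ_mem
    (Filter.Eventually.of_forall fun y => (integrable_avg hν hH.continuous hs t y).1)
    (integrable_avg hν hH.continuous hs t x) (integrable_avg hν hc' hs' t x).1
    (Filter.Eventually.of_forall fun w y _ => hC _) (integrable_const C)
    (Filter.Eventually.of_forall fun w y _ => ?_)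
  have h1 : HasFDerivAt (fun y : Eu n => spread t y w) (ContinuousLinearMap.inl ℝ (Eu n) ℝ) y := by
    have := ((hasFDerivAt_id (𝕜 := ℝ) y).add_const (√t • w.1)).prodMk
      (hasFDerivAt_const (√t * w.2) y)
    exact this
  exact ((hH.differentiable (by simp)) _).hasFDerivAt.comp y h1

lemma contDiff_avg (hν : HasMoments ν) (k : ℕ) :
    ∀ (F : Type) [NormedAddCommGroup F] [NormedSpace ℝ F] [CompleteSpace F] (H : Eu n × ℝ → F),
      ContDiff ℝ ∞ H → HasCompactSupport H → ∀ t, ContDiff ℝ k (avg ν H t) := by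
  induction k with
  | zero =>
    intro F _ _ _ H hH hs t
    exact contDiff_zero.2 ((continuous_avg hν hH.continuous hs).comp
      (by fun_prop : Continuous fun x => (t, x)))
  | succ k ih =>
    intro F _ _ _ H hH hs t
    have h := ih _ _ (contDiff_fderivFst hH) (hasCompactSupport_fderivFst hs) t
    exact_mod_cast contDiff_succ_iff_hasFDerivAt.2 ⟨_, h, hasFDerivAt_avg hν hH hs t⟩

/-- The partial derivative of `H` in the `i`-th coordinate of the first factor. -/
def pdFst (H : Eu n × ℝ → ℝ) (i : Fin n) (v : Eu n × ℝ) : ℝ :=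
  fderiv ℝ H v (EuclideanSpace.single i 1, 0)

lemma contDiff_pdFst {H : Eu n × ℝ → ℝ} (hH : ContDiff ℝ ∞ H) (i : Fin n) :
    ContDiff ℝ ∞ (pdFst H i) :=
  (hH.fderiv_right (m := ∞) (by simp)).clm_apply contDiff_const

lemma hasCompactSupport_pdFst {H : Eu n × ℝ → ℝ} (hs : HasCompactSupport H) (i : Fin n) :
    HasCompactSupport (pdFst H i) :=
  (hs.fderiv ℝ).comp_left (g := fun L : (Eu n × ℝ) →L[ℝ] ℝ => L (EuclideanSpace.single i 1, 0)) rfl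

lemma pd_avg (hν : HasMoments ν) {H : Eu n × ℝ → ℝ} (hH : ContDiff ℝ ∞ H)
    (hs : HasCompactSupport H) (t : ℝ) (i : Fin n) :
    pd (avg ν H t) i = avg ν (pdFst H i) t := by
  funext x
  rw [pd, (hasFDerivAt_avg hν hH hs t x).fderiv, avg, ContinuousLinearMap.integral_apply
    (integrable_avg hν (contDiff_fderivFst hH).continuous (hasCompactSupport_fderivFst hs) t x)]
  rfl

lemma hasDerivAt_avg (hν : HasMoments ν) {H : Eu n × ℝ → ℝ} (hH : ContDiff ℝ ∞ H)
    (hs : HasCompactSupport H) {t : ℝ} (ht : 0 < t) (x : Eu n) :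
    HasDerivAt (fun s => avg ν H s x)
      (1 / (2 * √t) * ∫ w, fderiv ℝ H (spread t x w) w ∂ν) t := by
  have hc' : Continuous (fderiv ℝ H) := hH.continuous_fderiv (by simp)
  obtain ⟨C, hC⟩ := (hs.fderiv ℝ).exists_bound_of_continuous hc'
  have hC0 : 0 ≤ C := (norm_nonneg _).trans (hC 0)
  have hsp : ∀ s, Continuous fun w => spread s x w := fun s =>
    continuous_spread.comp (by fun_prop : Continuous fun w => ((s, x), w))
  rw [← integral_const_mul]
  refine (hasDerivAt_integral_of_dominated_loc_of_deriv_le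
    (bound := fun w => 1 / (2 * √(t / 2)) * (C * (1 + ‖w‖)))
    (F' := fun s w => 1 / (2 * √s) * fderiv ℝ H (spread s x w) w)
    (Ioi_mem_nhds (half_lt_self ht))
    (Filter.Eventually.of_forall fun s => (integrable_avg hν hH.continuous hs s x).1)
    (integrable_avg hν hH.continuous hs t x) ?_
    (Filter.Eventually.of_forall fun w s hs' => ?_) ?_
    (Filter.Eventually.of_forall fun w s hs' => ?_)).2
  · exact (continuous_const.mul ((hc'.comp (hsp t)).clm_apply continuous_id)).aestronglyMeasurable
  · have hs' : t / 2 < s := hs'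
    have h0 : 0 < √(t / 2) := Real.sqrt_pos.2 (by linarith)
    have h1 : √(t / 2) ≤ √s := Real.sqrt_le_sqrt hs'.le
    rw [norm_mul, Real.norm_of_nonneg (by positivity)]
    gcongr
    calc _ ≤ ‖fderiv ℝ H (spread s x w)‖ * ‖w‖ := ContinuousLinearMap.le_opNorm _ _
      _ ≤ C * (1 + ‖w‖) := by
        gcongr
        · exact hC _
        · linarith
  · have := (hν 1)
    simp only [pow_one] at this
    exact (this.const_mul C).const_mul _
  · have hs' : t / 2 < s := hs'
    have hs0 : s ≠ 0 := by linarith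
    have h1 : HasDerivAt (fun s => spread s x w) ((1 / (2 * √s)) • w) s := by
      have h2 := Real.hasDerivAt_sqrt hs0
      exact ((h2.smul_const w.1).const_add x).prodMk (h2.mul_const w.2)
    have h3 := ((hH.differentiable (by simp)) (spread s x w)).hasFDerivAt.comp_hasDerivAt s h1
    rw [map_smul, smul_eq_mul] at h3
    exact h3

end Average

section GaussWeight

open scoped ContDiff

variable {n : ℕ} {ln : Fin n} {b : ℝ}

/-- The weight `exp (-(|z|² + q²) / 4) q₊^(b-1)` on `ℝⁿ × ℝ`. -/
def gw (b : ℝ) (w : Eu n × ℝ) : ℝ :=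
  Real.exp (-(‖w.1‖ ^ 2 + w.2 ^ 2) / 4) * max w.2 0 ^ (b - 1)

/-- The measure with density `gw b`. -/
def gaussMeas (n : ℕ) (b : ℝ) : Measure (Eu n × ℝ) :=
  volume.withDensity fun w => ENNReal.ofReal (gw b w)

lemma gw_nonneg (w : Eu n × ℝ) : 0 ≤ gw b w := by
  unfold gw
  positivity

lemma continuous_gw (hb : 1 ≤ b) : Continuous (gw b : Eu n × ℝ → ℝ) := by
  unfold gw
  refine Continuous.mul (by fun_prop) ?_
  exact Continuous.rpow_const (by fun_prop) fun _ => Or.inr (by linarith)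

lemma gw_add_one (hb : 1 < b) (w : Eu n × ℝ) : gw (b + 1) w = w.2 * gw b w := by
  unfold gw
  rcases le_or_gt w.2 0 with h | h
  · rw [max_eq_right h, Real.zero_rpow (by linarith), Real.zero_rpow (by linarith)]
    simp
  · rw [max_eq_left h.le, show b + 1 - 1 = b - 1 + 1 by ring, Real.rpow_add_one h.ne']
    ring

lemma gw_add_two (hb : 1 < b) (w : Eu n × ℝ) : gw (b + 2) w = w.2 ^ 2 * gw b w := by
  rw [show b + 2 = b + 1 + 1 by ring, gw_add_one (by linarith), gw_add_one hb]
  ring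

lemma exp_neg_sq_mul_pow_le (N : ℕ) {r s : ℝ} (hr : 0 ≤ r) (hs : r ^ 2 ≤ s) :
    (1 + r) ^ N * Real.exp (-s / 4) ≤ Real.exp 2 * N.factorial := by
  have h1 := Real.pow_div_factorial_le_exp (x := 1 + r) (by linarith) N
  rw [div_le_iff₀ (by positivity)] at h1
  have h2 : Real.exp (1 + r) * Real.exp (-s / 4) ≤ Real.exp 2 := by
    rw [← Real.exp_add, Real.exp_le_exp]
    nlinarith [sq_nonneg (r - 2)]
  calc (1 + r) ^ N * Real.exp (-s / 4) ≤ Real.exp (1 + r) * N.factorial * Real.exp (-s / 4) := by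
        gcongr
    _ = Real.exp (1 + r) * Real.exp (-s / 4) * N.factorial := by ring
    _ ≤ _ := by gcongr

lemma sq_norm_le_add (w : Eu n × ℝ) : ‖w‖ ^ 2 ≤ ‖w.1‖ ^ 2 + w.2 ^ 2 := by
  rw [Prod.norm_def]
  rcases max_cases ‖w.1‖ ‖w.2‖ with h | h
  · rw [h.1]; nlinarith [sq_nonneg w.2]
  · rw [h.1, Real.norm_eq_abs, sq_abs]; nlinarith [sq_nonneg ‖w.1‖]

lemma gw_rapid (hb : 1 ≤ b) (N : ℕ) :
    ∃ C : ℝ, ∀ w : Eu n × ℝ, (1 + ‖w‖) ^ N * gw b w ≤ C := by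
  refine ⟨Real.exp 2 * (N + ⌈b⌉₊).factorial, fun w => ?_⟩
  have h1 : max w.2 0 ^ (b - 1) ≤ (1 + ‖w‖) ^ ⌈b⌉₊ := by
    have h2 : max w.2 0 ≤ 1 + ‖w‖ := max_le
      (by linarith [norm_snd_le w, le_abs_self w.2, Real.norm_eq_abs w.2]) (by positivity)
    calc max w.2 0 ^ (b - 1) ≤ (1 + ‖w‖) ^ (b - 1) :=
          Real.rpow_le_rpow (le_max_right _ _) h2 (by linarith)
      _ ≤ (1 + ‖w‖) ^ (⌈b⌉₊ : ℝ) :=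
          Real.rpow_le_rpow_of_exponent_le (by linarith [norm_nonneg w])
            (by linarith [Nat.le_ceil b])
      _ = _ := Real.rpow_natCast _ _
  calc (1 + ‖w‖) ^ N * gw b w
      ≤ (1 + ‖w‖) ^ N * (Real.exp (-(‖w.1‖ ^ 2 + w.2 ^ 2) / 4) * (1 + ‖w‖) ^ ⌈b⌉₊) := by
        unfold gw; gcongr
    _ = (1 + ‖w‖) ^ (N + ⌈b⌉₊) * Real.exp (-(‖w.1‖ ^ 2 + w.2 ^ 2) / 4) := by
        rw [pow_add]; ring
    _ ≤ _ := exp_neg_sq_mul_pow_le _ (norm_nonneg w) (sq_norm_le_add w)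

instance : (volume : Measure (Eu n × ℝ)).IsAddHaarMeasure :=
  inferInstanceAs (volume.prod volume : Measure (Eu n × ℝ)).IsAddHaarMeasure

lemma integrable_mul_gw (hb : 1 ≤ b) {G : Eu n × ℝ → ℝ} (hG : Continuous G) {C : ℝ} {N : ℕ}
    (hC : ∀ w, |G w| ≤ C * (1 + ‖w‖) ^ N) : Integrable fun w => G w * gw b w := by
  obtain ⟨D, hD⟩ := gw_rapid (n := n) hb (N + (n + 2))
  have h0 : Integrable (fun w : Eu n × ℝ => (1 + ‖w‖) ^ (-((n : ℝ) + 2))) :=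
    integrable_one_add_norm (by simp)
  refine (h0.const_mul (|C| * D)).mono' (hG.mul (continuous_gw hb)).aestronglyMeasurable
    (Filter.Eventually.of_forall fun w => ?_)
  have h1 : (1 + ‖w‖) ^ (-((n : ℝ) + 2)) = ((1 + ‖w‖) ^ (n + 2))⁻¹ := by
    rw [Real.rpow_neg (by positivity)]
    congr 1
    exact_mod_cast Real.rpow_natCast (1 + ‖w‖) (n + 2)
  rw [h1, ← div_eq_mul_inv, le_div_iff₀ (by positivity), norm_mul, Real.norm_of_nonneg (gw_nonneg w)]
  have h2 : C * (1 + ‖w‖) ^ N ≤ |C| * (1 + ‖w‖) ^ N := by gcongr; exact le_abs_self C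
  calc ‖G w‖ * gw b w * (1 + ‖w‖) ^ (n + 2)
      ≤ |C| * (1 + ‖w‖) ^ N * gw b w * (1 + ‖w‖) ^ (n + 2) := by
        have := gw_nonneg (b := b) w
        gcongr
        exact (hC w).trans h2
    _ = |C| * ((1 + ‖w‖) ^ (N + (n + 2)) * gw b w) := by rw [pow_add]; ring
    _ ≤ |C| * D := by gcongr; exact hD w

lemma integral_gaussMeas (hb : 1 ≤ b) (G : Eu n × ℝ → ℝ) :
    ∫ w, G w ∂(gaussMeas n b) = ∫ w, G w * gw b w := by
  rw [gaussMeas, integral_withDensity_eq_integral_toReal_smul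
    (continuous_gw hb).measurable.ennreal_ofReal (by simp)]
  refine integral_congr_ae (Filter.Eventually.of_forall fun w => ?_)
  simp only [ENNReal.toReal_ofReal (gw_nonneg w), smul_eq_mul, mul_comm]

lemma integrable_gaussMeas_iff (hb : 1 ≤ b) {G : Eu n × ℝ → ℝ} :
    Integrable G (gaussMeas n b) ↔ Integrable fun w => G w * gw b w := by
  rw [gaussMeas, integrable_withDensity_iff_integrable_smul'
    (continuous_gw hb).measurable.ennreal_ofReal (by simp)]
  refine integrable_congr (Filter.Eventually.of_forall fun w => ?_)
  simp only [ENNReal.toReal_ofReal (gw_nonneg w), smul_eq_mul, mul_comm]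

lemma hasMoments_gaussMeas (hb : 1 ≤ b) : HasMoments (gaussMeas n b) := fun N =>
  (integrable_gaussMeas_iff hb).2 <| integrable_mul_gw hb (by fun_prop) (C := 1) (N := N) fun w => by
    rw [abs_of_nonneg (by positivity), one_mul]

lemma hasLineDerivAt_gw_fst (w : Eu n × ℝ) (i : Fin n) :
    HasLineDerivAt ℝ (gw b) (-(w.1 i / 2) * gw b w) w (EuclideanSpace.single i 1, 0) := by
  have h1 : HasDerivAt (fun s : ℝ => w.1 + s • (EuclideanSpace.single i (1 : ℝ)))
      (EuclideanSpace.single i 1) 0 := by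
    simpa using ((hasDerivAt_id (0 : ℝ)).smul_const
      (EuclideanSpace.single i (1 : ℝ))).const_add w.1
  have h2 := h1.norm_sq
  have h3 := (((h2.add_const (w.2 ^ 2)).neg.div_const 4).exp).mul_const (max w.2 0 ^ (b - 1))
  have e : (fun s : ℝ => gw b (w + s • ((EuclideanSpace.single i 1, 0) : Eu n × ℝ))) =
      fun s : ℝ => Real.exp (-(‖w.1 + s • EuclideanSpace.single i (1 : ℝ)‖ ^ 2 + w.2 ^ 2) / 4) *
        max w.2 0 ^ (b - 1) := by
    funext s
    simp [gw]
  rw [HasLineDerivAt, e]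
  refine HasDerivAt.congr_deriv h3 ?_
  simp [gw, EuclideanSpace.inner_single_right]
  ring

lemma hasLineDerivAt_gw_snd (hb : 1 < b) (w : Eu n × ℝ) :
    HasLineDerivAt ℝ (gw (b + 1)) (b * gw b w - w.2 ^ 2 / 2 * gw b w) w (0, 1) := by
  have h1 : HasDerivAt (fun s : ℝ => w.2 + s) 1 0 := by
    simpa using (hasDerivAt_id (0 : ℝ)).const_add w.2
  have h2 : HasDerivAt (fun s : ℝ => max (w.2 + s) 0 ^ b) (b * max w.2 0 ^ (b - 1)) 0 := by
    have := (hasDerivAt_max_rpow hb (w.2 + 0)).comp (0 : ℝ) h1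
    simpa [Function.comp_def] using this
  have h3 := ((((h1.pow 2).const_add (‖w.1‖ ^ 2)).neg.div_const 4).exp).mul h2
  have e : (fun s : ℝ => gw (b + 1) (w + s • ((0, 1) : Eu n × ℝ))) =
      fun s : ℝ => Real.exp (-(‖w.1‖ ^ 2 + (w.2 + s) ^ 2) / 4) * max (w.2 + s) 0 ^ b := by
    funext s
    simp [gw]
  rw [HasLineDerivAt, e]
  refine HasDerivAt.congr_deriv h3 ?_
  have h4 := gw_add_one hb w
  simp only [gw, add_sub_cancel_right] at h4
  simp only [gw, Pi.pow_apply, Pi.neg_apply, add_zero, Nat.cast_ofNat]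
  linear_combination (-(w.2 / 2)) * h4

lemma integral_coord_mul_gw (hb : 1 ≤ b) {G : Eu n × ℝ → ℝ} (hG : ContDiff ℝ 1 G) {C : ℝ}
    (hC : ∀ w, |G w| ≤ C) (hC' : ∀ w, ‖fderiv ℝ G w‖ ≤ C) (i : Fin n) :
    ∫ w : Eu n × ℝ, w.1 i * G w * gw b w =
      2 * ∫ w, fderiv ℝ G w (EuclideanSpace.single i 1, 0) * gw b w := by
  have hC0 : 0 ≤ C := (norm_nonneg _).trans (hC' 0)
  have hd := hG.continuous_fderiv one_ne_zero
  have hi : ∀ w : Eu n × ℝ, |w.1 i| ≤ ‖w‖ := fun w =>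
    (PiLp.norm_apply_le w.1 i).trans (norm_fst_le w)
  have k1 : Integrable fun w : Eu n × ℝ => w.1 i * G w * gw b w :=
    integrable_mul_gw hb (by fun_prop) (C := C) (N := 1) fun w => by
      rw [abs_mul, pow_one, mul_comm]
      exact mul_le_mul (hC w) (by linarith [hi w]) (abs_nonneg _) hC0
  have k2 : Integrable fun w => fderiv ℝ G w (EuclideanSpace.single i 1, 0) * gw b w :=
    integrable_mul_gw hb (by fun_prop) (C := C * ‖((EuclideanSpace.single i 1, 0) : Eu n × ℝ)‖)
      (N := 0) fun w => by
        rw [pow_zero, mul_one]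
        exact ((fderiv ℝ G w).le_opNorm _).trans (by gcongr; exact hC' w)
  have k3 : Integrable fun w => G w * gw b w :=
    integrable_mul_gw hb hG.continuous (C := C) (N := 0) fun w => by simpa using hC w
  have k1' : Integrable fun w : Eu n × ℝ => G w * (-(w.1 i / 2) * gw b w) := by
    convert k1.const_mul (-(1 / 2)) using 2
    ring
  have key := integral_bilinear_hasLineDerivAt_right_eq_neg_left_of_integrable
    (μ := (volume : Measure (Eu n × ℝ))) (B := ContinuousLinearMap.mul ℝ ℝ)
    (f := G) (f' := fun w => fderiv ℝ G w (EuclideanSpace.single i 1, 0))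
    (g := gw b) (g' := fun w => -(w.1 i / 2) * gw b w) (v := (EuclideanSpace.single i 1, 0))
    k2 k1' k3
    (fun w _ => ((hG.differentiable one_ne_zero) w).hasFDerivAt.hasLineDerivAt _)
    (fun w _ => hasLineDerivAt_gw_fst w i)
  simp only [ContinuousLinearMap.mul_apply'] at key
  rw [← neg_eq_iff_eq_neg] at key
  rw [← key, ← integral_neg, ← integral_const_mul]
  refine integral_congr_ae (Filter.Eventually.of_forall fun w => ?_)
  simp only
  ring

lemma integral_snd_mul_gw (hb : 1 < b) {G : Eu n × ℝ → ℝ} (hG : ContDiff ℝ 1 G) {C : ℝ}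
    (hC : ∀ w, |G w| ≤ C) (hC' : ∀ w, ‖fderiv ℝ G w‖ ≤ C) :
    ∫ w : Eu n × ℝ, w.2 * fderiv ℝ G w (0, 1) * gw b w =
      1 / 2 * (∫ w, G w * gw (b + 2) w) - b * ∫ w, G w * gw b w := by
  have hb1 : 1 ≤ b + 1 := by linarith
  have hC0 : 0 ≤ C := (norm_nonneg _).trans (hC' 0)
  have hd := hG.continuous_fderiv one_ne_zero
  have k2 : Integrable fun w => fderiv ℝ G w (0, 1) * gw (b + 1) w :=
    integrable_mul_gw hb1 (by fun_prop) (C := C * ‖((0, 1) : Eu n × ℝ)‖)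
      (N := 0) fun w => by
        rw [pow_zero, mul_one]
        exact ((fderiv ℝ G w).le_opNorm _).trans (by gcongr; exact hC' w)
  have k3 : ∀ a : ℝ, 1 ≤ a → Integrable fun w => G w * gw a w := fun a ha =>
    integrable_mul_gw ha hG.continuous (C := C) (N := 0) fun w => by simpa using hC w
  have kb := k3 b hb.le
  have kb2 := k3 (b + 2) (by linarith)
  have e : ∀ w : Eu n × ℝ, G w * (b * gw b w - w.2 ^ 2 / 2 * gw b w) =
      b * (G w * gw b w) - 1 / 2 * (G w * gw (b + 2) w) := fun w => by
    rw [gw_add_two hb]; ring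
  have key := integral_bilinear_hasLineDerivAt_right_eq_neg_left_of_integrable
    (μ := (volume : Measure (Eu n × ℝ))) (B := ContinuousLinearMap.mul ℝ ℝ)
    (f := G) (f' := fun w => fderiv ℝ G w (0, 1))
    (g := gw (b + 1)) (g' := fun w => b * gw b w - w.2 ^ 2 / 2 * gw b w) (v := (0, 1))
    k2 (by
      simp only [ContinuousLinearMap.mul_apply', e]
      exact (kb.const_mul b).sub (kb2.const_mul _)) (k3 _ hb1)
    (fun w _ => ((hG.differentiable one_ne_zero) w).hasFDerivAt.hasLineDerivAt _)
    (fun w _ => hasLineDerivAt_gw_snd hb w)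
  simp only [ContinuousLinearMap.mul_apply', e] at key
  rw [integral_sub (kb.const_mul b) (kb2.const_mul _), integral_const_mul, integral_const_mul] at key
  have e2 : ∀ w : Eu n × ℝ, w.2 * fderiv ℝ G w (0, 1) * gw b w =
      fderiv ℝ G w (0, 1) * gw (b + 1) w := fun w => by rw [gw_add_one hb]; ring
  simp only [e2]
  linarith

end GaussWeight

section BesselFlow

open scoped ContDiff

variable {n : ℕ} {ln : Fin n} {b : ℝ} {H : Eu n × ℝ → ℝ} {φ : Eu n → ℝ}

lemma hasFDerivAt_spread (t : ℝ) (x : Eu n) (w : Eu n × ℝ) :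
    HasFDerivAt (spread t x) (√t • ContinuousLinearMap.id ℝ (Eu n × ℝ)) w := by
  have h := ((hasFDerivAt_id (𝕜 := ℝ) w).const_smul (√t)).const_add (x, (0 : ℝ))
  have e : spread t x = fun w => (x, (0 : ℝ)) + √t • w := by
    funext w
    simp [spread, Prod.ext_iff]
  rw [e]
  exact h

lemma fderiv_comp_spread (hH : ContDiff ℝ ∞ H) (t : ℝ) (x : Eu n) (w v : Eu n × ℝ) :
    fderiv ℝ (fun w => H (spread t x w)) w v = √t * fderiv ℝ H (spread t x w) v := by
  have h := ((hH.differentiable (by simp)) (spread t x w)).hasFDerivAt.comp w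
    (hasFDerivAt_spread t x w)
  have h' : fderiv ℝ (fun w => H (spread t x w)) w = _ := h.fderiv
  rw [h']
  simp

lemma exists_bound_comp_spread (hH : ContDiff ℝ ∞ H) (hs : HasCompactSupport H) (t : ℝ) (x : Eu n) :
    ContDiff ℝ 1 (fun w => H (spread t x w)) ∧ ∃ C, (∀ w, |H (spread t x w)| ≤ C) ∧
      ∀ w, ‖fderiv ℝ (fun w => H (spread t x w)) w‖ ≤ C := by
  constructor
  · have h : ContDiff ℝ 1 (spread t x) := by unfold spread; fun_prop
    exact (hH.of_le (by simp)).comp h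
  obtain ⟨C, hC⟩ := hs.exists_bound_of_continuous hH.continuous
  obtain ⟨D, hD⟩ := (hs.fderiv ℝ).exists_bound_of_continuous (hH.continuous_fderiv (by simp))
  refine ⟨max C (√t * D), fun w => (hC _).trans (le_max_left _ _), fun w => ?_⟩
  have h := ((hH.differentiable (by simp)) (spread t x w)).hasFDerivAt.comp w
    (hasFDerivAt_spread t x w)
  have h' : fderiv ℝ (fun w => H (spread t x w)) w = _ := h.fderiv
  refine le_trans ?_ (le_max_right _ _)
  rw [h', ContinuousLinearMap.comp_smul, norm_smul, Real.norm_of_nonneg (Real.sqrt_nonneg t),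
    ContinuousLinearMap.comp_id]
  gcongr
  exact hD _

lemma integral_coord_mul_spread (hb : 1 ≤ b) (hH : ContDiff ℝ ∞ H) (hs : HasCompactSupport H)
    (t : ℝ) (x : Eu n) (i : Fin n) :
    ∫ w, w.1 i * H (spread t x w) ∂(gaussMeas n b) =
      2 * (√t * avg (gaussMeas n b) (pdFst H i) t x) := by
  obtain ⟨h1, C, h2, h3⟩ := exists_bound_comp_spread hH hs t x
  unfold avg
  rw [integral_gaussMeas hb, integral_coord_mul_gw hb h1 h2 h3 i, integral_gaussMeas hb]
  rw [← integral_const_mul, ← integral_const_mul, ← integral_const_mul]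
  refine integral_congr_ae (Filter.Eventually.of_forall fun w => ?_)
  simp only [fderiv_comp_spread hH, pdFst]
  ring

lemma integral_snd_mul_spread (hb : 1 < b) (hH : ContDiff ℝ ∞ H) (hs : HasCompactSupport H)
    (t : ℝ) (x : Eu n) :
    √t * ∫ w, w.2 * fderiv ℝ H (spread t x w) (0, 1) ∂(gaussMeas n b) =
      1 / 2 * avg (gaussMeas n (b + 2)) H t x - b * avg (gaussMeas n b) H t x := by
  obtain ⟨h1, C, h2, h3⟩ := exists_bound_comp_spread hH hs t x
  unfold avg
  rw [integral_gaussMeas hb.le, integral_gaussMeas (by linarith),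
    integral_gaussMeas hb.le, ← integral_snd_mul_gw hb h1 h2 h3, ← integral_const_mul]
  refine integral_congr_ae (Filter.Eventually.of_forall fun w => ?_)
  simp only [fderiv_comp_spread hH]
  ring

lemma integral_sq_mul_gaussMeas (hb : 1 < b) (G : Eu n × ℝ → ℝ) :
    ∫ w, w.2 ^ 2 * G w ∂(gaussMeas n b) = ∫ w, G w ∂(gaussMeas n (b + 2)) := by
  rw [integral_gaussMeas hb.le, integral_gaussMeas (by linarith)]
  refine integral_congr_ae (Filter.Eventually.of_forall fun w => ?_)
  simp only [gw_add_two hb]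
  ring

/-- The map `(Y, q) ↦ (Y', Y_n² + q²)`. -/
def sqMap (ln : Fin n) (v : Eu n × ℝ) : Eu n :=
  v.1 + (v.1 ln ^ 2 + v.2 ^ 2 - v.1 ln) • EuclideanSpace.single ln (1 : ℝ)

lemma sqMap_ln (v : Eu n × ℝ) : sqMap ln v ln = v.1 ln ^ 2 + v.2 ^ 2 := by
  simp [sqMap]

lemma contDiff_sqMap : ContDiff ℝ ∞ (sqMap ln) := by
  unfold sqMap
  fun_prop

lemma contDiff_comp_sqMap (hφ : ContDiff ℝ ∞ φ) : ContDiff ℝ ∞ (φ ∘ sqMap ln) :=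
  hφ.comp contDiff_sqMap

lemma norm_le_of_norm_sqMap_le {R : ℝ} {v : Eu n × ℝ} (h : ‖sqMap ln v‖ ≤ R) :
    ‖v‖ ≤ 1 + 3 * R := by
  have hR : 0 ≤ R := (norm_nonneg _).trans h
  have h1 : v.1 ln ^ 2 + v.2 ^ 2 ≤ R := by
    rw [← sqMap_ln]
    exact (le_abs_self _).trans ((PiLp.norm_apply_le (sqMap ln v) ln).trans h)
  have h2 : |v.1 ln| ≤ 1 + R := abs_le_of_sq_le_sq (by nlinarith [sq_nonneg v.2]) (by linarith)
  have h3 : |v.2| ≤ 1 + R := abs_le_of_sq_le_sq (by nlinarith [sq_nonneg (v.1 ln)]) (by linarith)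
  have h4 : v.1 = sqMap ln v - (v.1 ln ^ 2 + v.2 ^ 2 - v.1 ln) • EuclideanSpace.single ln (1 : ℝ) := by
    rw [sqMap, add_sub_cancel_right]
  have h5 : |v.1 ln ^ 2 + v.2 ^ 2 - v.1 ln| ≤ 1 + 2 * R := by
    have := abs_le.1 h2
    rw [abs_le]
    constructor <;> nlinarith [sq_nonneg (v.1 ln), sq_nonneg v.2]
  have h6 : ‖v.1‖ ≤ 1 + 3 * R := by
    rw [h4]
    refine (norm_sub_le _ _).trans ?_
    rw [norm_smul, Real.norm_eq_abs, PiLp.norm_single, norm_one, mul_one]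
    linarith
  rw [Prod.norm_def]
  exact max_le h6 (h3.trans (by linarith))

lemma hasCompactSupport_comp_sqMap (hs : HasCompactSupport φ) :
    HasCompactSupport (φ ∘ sqMap ln) := by
  obtain ⟨R, hR⟩ := hs.isCompact.isBounded.exists_norm_le
  refine HasCompactSupport.of_support_subset_isCompact
    (isCompact_closedBall 0 (1 + 3 * R)) fun v hv => ?_
  rw [mem_closedBall_zero_iff]
  exact norm_le_of_norm_sqMap_le (hR _ (subset_tsupport _ hv))

lemma fderiv_comp_sqMap (hφ : ContDiff ℝ ∞ φ) (v h : Eu n × ℝ) :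
    fderiv ℝ (φ ∘ sqMap ln) v h = fderiv ℝ φ (sqMap ln v) h.1 +
      (2 * v.1 ln * h.1 ln + 2 * v.2 * h.2 - h.1 ln) * pd φ ln (sqMap ln v) := by
  have h1 : HasFDerivAt (fun v : Eu n × ℝ => v.1 ln)
      ((EuclideanSpace.proj ln).comp (.fst ℝ (Eu n) ℝ)) v :=
    ((EuclideanSpace.proj ln).comp (.fst ℝ (Eu n) ℝ)).hasFDerivAt
  have h2 : HasFDerivAt (fun v : Eu n × ℝ => v.2) (.snd ℝ (Eu n) ℝ) v := hasFDerivAt_snd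
  have h3 : HasFDerivAt (sqMap ln) _ v := (hasFDerivAt_fst (𝕜 := ℝ) (p := v)).add
    ((((h1.pow 2).add (h2.pow 2)).sub h1).smul_const (EuclideanSpace.single ln (1 : ℝ)))
  have h4 := ((hφ.differentiable (by simp)) (sqMap ln v)).hasFDerivAt.comp v h3
  rw [h4.fderiv]
  simp [pd]

/-- The flow with datum `φ(x', x_n²)`, up to a multiplicative constant. -/
def besselFlow (ln : Fin n) (b : ℝ) (φ : Eu n → ℝ) : ℝ → Eu n → ℝ :=
  avg (gaussMeas n b) (φ ∘ sqMap ln)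

lemma contDiff_top_pd (hφ : ContDiff ℝ ∞ φ) (i : Fin n) : ContDiff ℝ ∞ (pd φ i) :=
  (hφ.fderiv_right (m := ∞) (by simp)).clm_apply contDiff_const

lemma pdFst_comp_sqMap_ne (hφ : ContDiff ℝ ∞ φ) {i : Fin n} (hi : i ≠ ln) :
    pdFst (φ ∘ sqMap ln) i = pd φ i ∘ sqMap ln := by
  funext v
  rw [pdFst, fderiv_comp_sqMap hφ]
  simp [hi.symm, pd]

lemma pdFst_comp_sqMap_ln (hφ : ContDiff ℝ ∞ φ) :
    pdFst (φ ∘ sqMap ln) ln = fun v => 2 * v.1 ln * pd φ ln (sqMap ln v) := by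
  funext v
  rw [pdFst, fderiv_comp_sqMap hφ]
  simp [pd]
  ring

lemma pd_besselFlow_ne (hb : 1 < b) (hφ : ContDiff ℝ ∞ φ) (hs : HasCompactSupport φ) (t : ℝ)
    {i : Fin n} (hi : i ≠ ln) :
    pd (besselFlow ln b φ t) i = besselFlow ln b (pd φ i) t := by
  rw [besselFlow, pd_avg (hasMoments_gaussMeas hb.le) (contDiff_comp_sqMap hφ)
    (hasCompactSupport_comp_sqMap hs), pdFst_comp_sqMap_ne hφ hi]
  rfl

lemma avg_coord_mul (hb : 1 < b) (hφ : ContDiff ℝ ∞ φ) (hs : HasCompactSupport φ) (t : ℝ)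
    (x : Eu n) :
    b * avg (gaussMeas n b) (fun v => v.1 ln * φ (sqMap ln v)) t x =
      x ln / 2 * besselFlow ln (b + 2) φ t x := by
  have hb2 : 1 ≤ b + 2 := by linarith
  have hc : ContDiff ℝ ∞ (fun v : Eu n × ℝ => v.1 ln) := by fun_prop
  have hH : ContDiff ℝ ∞ (fun v : Eu n × ℝ => v.1 ln * φ (sqMap ln v)) :=
    hc.mul (contDiff_comp_sqMap hφ)
  have hHs : HasCompactSupport (fun v : Eu n × ℝ => v.1 ln * φ (sqMap ln v)) :=
    (hasCompactSupport_comp_sqMap hs).mul_left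
  have hψ := contDiff_top_pd hφ ln
  have hψs : HasCompactSupport (pd φ ln) := hs.pd ln
  have h1 := integral_snd_mul_spread hb hH hHs t x
  have h2 := integral_coord_mul_spread hb2 (contDiff_comp_sqMap (ln := ln) hφ)
    (hasCompactSupport_comp_sqMap hs) t x ln
  have e1 : ∀ w : Eu n × ℝ,
      fderiv ℝ (fun v : Eu n × ℝ => v.1 ln * φ (sqMap ln v)) (spread t x w) (0, 1) =
      √t * w.2 * pdFst (φ ∘ sqMap ln) ln (spread t x w) := by
    intro w
    have ha : HasFDerivAt (fun v : Eu n × ℝ => v.1 ln)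
        ((EuclideanSpace.proj ln).comp (.fst ℝ (Eu n) ℝ)) (spread t x w) :=
      ((EuclideanSpace.proj ln).comp (.fst ℝ (Eu n) ℝ)).hasFDerivAt
    have hm := ha.mul (((contDiff_comp_sqMap (ln := ln) hφ).differentiable (by simp))
      (spread t x w)).hasFDerivAt
    have hm' : fderiv ℝ (fun v : Eu n × ℝ => v.1 ln * φ (sqMap ln v)) (spread t x w) = _ :=
      hm.fderiv
    rw [hm', pdFst_comp_sqMap_ln hφ]
    simp only [add_apply, smul_apply, fderiv_comp_sqMap hφ, smul_eq_mul]
    simp [spread]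
    ring
  have e2 : ∀ w : Eu n × ℝ, w.2 * (√t * w.2 * pdFst (φ ∘ sqMap ln) ln (spread t x w)) =
      √t * (w.2 ^ 2 * pdFst (φ ∘ sqMap ln) ln (spread t x w)) := fun w => by ring
  simp only [e1, e2] at h1
  rw [integral_const_mul, integral_sq_mul_gaussMeas hb] at h1
  change √t * (√t * avg (gaussMeas n (b + 2)) (pdFst (φ ∘ sqMap ln) ln) t x) = _ at h1
  have h3 : avg (gaussMeas n (b + 2)) (fun v : Eu n × ℝ => v.1 ln * φ (sqMap ln v)) t x =
      x ln * besselFlow ln (b + 2) φ t x +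
      √t * ∫ w, w.1 ln * (φ ∘ sqMap ln) (spread t x w) ∂(gaussMeas n (b + 2)) := by
    have i1 := integrable_avg (hasMoments_gaussMeas (n := n) hb2) hH.continuous hHs t x
    have i2 := integrable_avg (hasMoments_gaussMeas (n := n) hb2)
      (contDiff_comp_sqMap (ln := ln) hφ).continuous (hasCompactSupport_comp_sqMap hs) t x
    have e3 : ∀ w : Eu n × ℝ, √t * (w.1 ln * (φ ∘ sqMap ln) (spread t x w)) =
        (spread t x w).1 ln * φ (sqMap ln (spread t x w)) -
          x ln * (φ ∘ sqMap ln) (spread t x w) := by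
      intro w
      simp [spread]
      ring
    rw [← integral_const_mul, integral_congr_ae (Filter.Eventually.of_forall e3),
      integral_sub i1 (i2.const_mul _), integral_const_mul]
    simp only [besselFlow, avg]
    ring
  rw [h2] at h3
  linarith

lemma pd_besselFlow_ln (hb : 1 < b) (hφ : ContDiff ℝ ∞ φ) (hs : HasCompactSupport φ) (t : ℝ)
    (x : Eu n) :
    pd (besselFlow ln b φ t) ln x = x ln / b * besselFlow ln (b + 2) (pd φ ln) t x := by
  rw [besselFlow, pd_avg (hasMoments_gaussMeas hb.le) (contDiff_comp_sqMap hφ)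
    (hasCompactSupport_comp_sqMap hs), pdFst_comp_sqMap_ln hφ]
  have h := avg_coord_mul (ln := ln) hb (contDiff_top_pd hφ ln) (hs.pd ln) t x
  simp only [avg, mul_assoc] at h ⊢
  rw [integral_const_mul]
  field_simp
  linarith

lemma rapidOn_besselFlow (hb : 1 < b) (hφ : ContDiff ℝ ∞ φ) (hs : HasCompactSupport φ) (T : ℝ) :
    RapidOn T (besselFlow ln b φ) :=
  rapidOn_avg (hasMoments_gaussMeas hb.le) (contDiff_comp_sqMap hφ).continuous
    (hasCompactSupport_comp_sqMap hs) T

lemma hasDerivAt_besselFlow (hb : 1 < b) (hφ : ContDiff ℝ ∞ φ) (hs : HasCompactSupport φ) {t : ℝ}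
    (ht : 0 < t) (x : Eu n) :
    HasDerivAt (fun s => besselFlow ln b φ s x)
      (∑ i, pd2 (besselFlow ln b φ t) i i x + besselFlow ln (b + 2) (pd φ ln) t x) t := by
  have hH := contDiff_comp_sqMap (ln := ln) hφ
  have hHs := hasCompactSupport_comp_sqMap (ln := ln) hs
  have hν := hasMoments_gaussMeas (n := n) hb.le
  have hν2 := hasMoments_gaussMeas (n := n) (b := b + 2) (by linarith)
  have hst : 0 < √t := Real.sqrt_pos.2 ht
  refine (hasDerivAt_avg hν hH hHs ht x).congr_deriv ?_
  have e1 : ∀ w : Eu n × ℝ, fderiv ℝ (φ ∘ sqMap ln) (spread t x w) w =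
      ∑ i, w.1 i * pdFst (φ ∘ sqMap ln) i (spread t x w) +
        2 * √t * (w.2 ^ 2 * (pd φ ln ∘ sqMap ln) (spread t x w)) := by
    intro w
    have hw : w = ∑ i, w.1 i • ((EuclideanSpace.single i 1, 0) : Eu n × ℝ) + w.2 • (0, 1) := by
      refine Prod.ext ?_ ?_
      · ext j
        simp [Prod.fst_sum, Finset.sum_apply, Pi.single_apply]
      · simp [Prod.snd_sum]
    conv_lhs => rw [hw]
    rw [map_add, map_sum, map_smul]
    simp only [map_smul, smul_eq_mul]
    rw [← hw, fderiv_comp_sqMap hφ (spread t x w) (0, 1)]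
    simp [spread, pdFst]
    ring
  have i1 : ∀ i, Integrable (fun w : Eu n × ℝ =>
      w.1 i * pdFst (φ ∘ sqMap ln) i (spread t x w)) (gaussMeas n b) := by
    intro i
    have hc := (contDiff_pdFst hH i).continuous
    obtain ⟨C, hC⟩ := (hasCompactSupport_pdFst hHs i).exists_bound_of_continuous hc
    have hsp : Continuous (spread t x) := by unfold spread; fun_prop
    refine (integrable_gaussMeas_iff hb.le).2 (integrable_mul_gw hb.le
      (by fun_prop) (C := C) (N := 1) fun w => ?_)
    have hi : |w.1 i| ≤ ‖w‖ := (PiLp.norm_apply_le w.1 i).trans (norm_fst_le w)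
    rw [abs_mul, pow_one, mul_comm]
    exact mul_le_mul (hC _) (by linarith) (abs_nonneg _) ((norm_nonneg _).trans (hC 0))
  have i2 : Integrable (fun w : Eu n × ℝ =>
      2 * √t * (w.2 ^ 2 * (pd φ ln ∘ sqMap ln) (spread t x w))) (gaussMeas n b) := by
    refine Integrable.const_mul ?_ _
    have := (integrable_gaussMeas_iff (by linarith)).1 (integrable_avg hν2
      (contDiff_comp_sqMap (ln := ln) (contDiff_top_pd hφ ln)).continuous
      (hasCompactSupport_comp_sqMap (hs.pd ln)) t x)
    refine (integrable_gaussMeas_iff hb.le).2 (this.congr (Filter.Eventually.of_forall fun w => ?_))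
    simp only [gw_add_two hb]
    ring
  rw [integral_congr_ae (Filter.Eventually.of_forall e1),
    integral_add (integrable_finsetSum _ fun i _ => i1 i) i2,
    integral_finsetSum _ fun i _ => i1 i, integral_const_mul, integral_sq_mul_gaussMeas hb]
  have e2 : ∀ i, ∫ w, w.1 i * pdFst (φ ∘ sqMap ln) i (spread t x w) ∂(gaussMeas n b) =
      2 * √t * pd2 (besselFlow ln b φ t) i i x := by
    intro i
    rw [integral_coord_mul_spread hb.le (contDiff_pdFst hH i) (hasCompactSupport_pdFst hHs i),
      pd2, besselFlow, pd_avg hν hH hHs, pd_avg hν (contDiff_pdFst hH i)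
        (hasCompactSupport_pdFst hHs i), mul_assoc]
  simp only [e2, ← Finset.mul_sum]
  simp only [besselFlow, avg]
  field_simp

lemma isFlow_besselFlow (hb : 1 < b) (hφ : ContDiff ℝ ∞ φ) (hs : HasCompactSupport φ) :
    IsFlow ln b 0 (besselFlow ln b φ) (fun t x =>
      ∑ i, pd2 (besselFlow ln b φ t) i i x + besselFlow ln (b + 2) (pd φ ln) t x) := by
  have hH := contDiff_comp_sqMap (ln := ln) hφ
  have hHs := hasCompactSupport_comp_sqMap (ln := ln) hs
  have hν := hasMoments_gaussMeas (n := n) hb.le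
  have h1 : ∀ T i, RapidOn T fun t => pd (besselFlow ln b φ t) i := by
    intro T i
    simp only [besselFlow, pd_avg hν hH hHs]
    exact rapidOn_avg hν (contDiff_pdFst hH i).continuous (hasCompactSupport_pdFst hHs i) T
  have h2 : ∀ T i j, RapidOn T fun t => pd2 (besselFlow ln b φ t) i j := by
    intro T i j
    unfold pd2
    simp only [besselFlow, pd_avg hν hH hHs, pd_avg hν (contDiff_pdFst hH j)
      (hasCompactSupport_pdFst hHs j)]
    exact rapidOn_avg hν (contDiff_pdFst (contDiff_pdFst hH j) i).continuous
      (hasCompactSupport_pdFst (hasCompactSupport_pdFst hHs j) i) T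
  refine ⟨fun t => contDiff_avg hν 2 ℝ _ hH hHs t, rapidOn_besselFlow hb hφ hs, h1, h2,
    fun T => (RapidOn.sum _ fun i _ => h2 T i i).add
      (rapidOn_besselFlow (by linarith) (contDiff_top_pd hφ ln) (hs.pd ln) T),
    fun t ht x => hasDerivAt_besselFlow hb hφ hs ht x, fun t ht x hx => ?_⟩
  rw [pd_besselFlow_ln hb hφ hs]
  have : x ln ≠ 0 := hx.ne'
  field_simp
  ring

end BesselFlow

section FlowMulCoord

variable {n : ℕ} {ln : Fin n} {b : ℝ}

lemma pd_coord_mul {g : Eu n → ℝ} (hg : Differentiable ℝ g) (i : Fin n) (x : Eu n) :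
    pd (fun x => x ln * g x) i x = (if i = ln then g x else 0) + x ln * pd g i x := by
  have h1 : HasFDerivAt (fun x : Eu n => x ln) (EuclideanSpace.proj ln : Eu n →L[ℝ] ℝ) x :=
    (EuclideanSpace.proj ln : Eu n →L[ℝ] ℝ).hasFDerivAt
  have h2 : fderiv ℝ (fun x => x ln * g x) x = _ := (h1.mul (hg x).hasFDerivAt).fderiv
  rw [pd, h2]
  by_cases hi : i = ln
  · subst hi
    simp [pd]
    ring
  · simp [pd, hi, Ne.symm hi]

lemma pd2_coord_mul {g : Eu n → ℝ} (hg : ContDiff ℝ 2 g) (i j : Fin n) (x : Eu n) :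
    pd2 (fun x => x ln * g x) i j x = (if j = ln then pd g i x else 0) +
      (if i = ln then pd g j x else 0) + x ln * pd2 g i j x := by
  have hd : Differentiable ℝ g := hg.differentiable (by norm_num)
  have hdj : Differentiable ℝ (pd g j) :=
    (hg.pd (m := 1) (by norm_num) j).differentiable one_ne_zero
  have e : pd (fun x => x ln * g x) j = fun x => (if j = ln then g x else 0) + x ln * pd g j x := by
    funext x
    exact pd_coord_mul hd j x
  rw [pd2, e]
  have h1 : Differentiable ℝ fun x => if j = ln then g x else 0 := by
    split_ifs
    · exact hd
    · exact differentiable_const 0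
  have h2 : Differentiable ℝ fun x : Eu n => x ln * pd g j x :=
    (EuclideanSpace.proj ln : Eu n →L[ℝ] ℝ).differentiable.mul hdj
  have h3 := ((h1 x).hasFDerivAt.add (h2 x).hasFDerivAt).fderiv
  have h3' : fderiv ℝ (fun x => (if j = ln then g x else 0) + x ln * pd g j x) x = _ := h3
  rw [pd, h3', add_apply, add_assoc]
  congr 1
  · split_ifs
    · rfl
    · simp
  · exact pd_coord_mul hdj i x

lemma isFlow_coord_mul {U Ut : ℝ → Eu n → ℝ} (h : IsFlow ln (b + 2) 0 U Ut) :
    IsFlow ln b b (fun t x => x ln * U t x) (fun t x => x ln * Ut t x) := by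
  have hp : ∀ {T : ℝ} {F : ℝ → Eu n → ℝ}, RapidOn T F → RapidOn T fun t x => x ln * F t x := by
    intro T F hF
    simpa only [mul_comm] using hF.mul_polyOn (PolyOn.coord ln)
  have hd : ∀ t, Differentiable ℝ (U t) := fun t => (h.smooth t).differentiable (by norm_num)
  have hite : ∀ {T : ℝ} {F : ℝ → Eu n → ℝ} (c : Prop) [Decidable c], RapidOn T F →
      RapidOn T fun t x => if c then F t x else 0 := by
    intro T F c _ hF
    split_ifs
    · exact hF
    · exact RapidOn.zero
  refine ⟨fun t => ?_, fun T => hp (h.self T), fun T i => ?_, fun T i j => ?_,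
    fun T => hp (h.dt T), fun t ht x => (h.hasDeriv t ht x).const_mul _, fun t ht x hx => ?_⟩
  · exact (EuclideanSpace.proj ln : Eu n →L[ℝ] ℝ).contDiff.mul (h.smooth t)
  · have e : (fun t => pd (fun x => x ln * U t x) i) =
        fun t x => (if i = ln then U t x else 0) + x ln * pd (U t) i x := by
      funext t x
      exact pd_coord_mul (hd t) i x
    rw [e]
    exact (hite _ (h.self T)).add (hp (h.pd T i))
  · have e : (fun t => pd2 (fun x => x ln * U t x) i j) =
        fun t x => (if j = ln then pd (U t) i x else 0) +
          (if i = ln then pd (U t) j x else 0) + x ln * pd2 (U t) i j x := by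
      funext t x
      exact pd2_coord_mul (h.smooth t) i j x
    rw [e]
    exact ((hite _ (h.pd T i)).add (hite _ (h.pd T j))).add (hp (h.pd2 T i j))
  · rw [h.eq t ht x hx]
    simp only [pd2_coord_mul (h.smooth t), pd_coord_mul (hd t), if_true, Finset.sum_add_distrib,
      ← Finset.mul_sum, Finset.sum_ite_eq', Finset.mem_univ]
    have : x ln ≠ 0 := hx.ne'
    field_simp
    ring

end FlowMulCoord

section Decay

variable {n : ℕ} {ln : Fin n} {b : ℝ}

lemma lintegral_comp_spread {G : Eu n × ℝ → ℝ≥0∞} (hG : Measurable G) {t : ℝ} (ht : 0 < t)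
    (x : Eu n) :
    ∫⁻ w, G (spread t x w) = ENNReal.ofReal (t ^ (-(((n : ℝ) + 1) / 2))) * ∫⁻ v, G v := by
  have hst : 0 < √t := Real.sqrt_pos.2 ht
  have e : ∀ w : Eu n × ℝ, spread t x w = (x, (0 : ℝ)) + √t • w := by
    intro w
    simp [spread, Prod.ext_iff]
  have hm : Measurable fun v : Eu n × ℝ => G ((x, (0 : ℝ)) + v) :=
    hG.comp (measurable_const_add _)
  simp only [e]
  rw [← lintegral_map (f := fun v : Eu n × ℝ => G ((x, (0 : ℝ)) + v)) hm
    (measurable_const_smul (√t)), Measure.map_addHaar_smul _ hst.ne', lintegral_smul_measure,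
    lintegral_add_left_eq_self]
  congr 2
  rw [abs_of_nonneg (by positivity), Real.sqrt_eq_rpow, ← Real.rpow_natCast, ← Real.rpow_mul ht.le,
    ← Real.rpow_neg ht.le]
  congr 1
  simp
  ring

lemma lintegral_spread_mul_rpow {G : Eu n × ℝ → ℝ≥0∞} (hG : Measurable G) {t : ℝ} (ht : 0 < t)
    (x : Eu n) :
    ∫⁻ w, G (spread t x w) * ENNReal.ofReal (max w.2 0 ^ (b - 1)) =
      ENNReal.ofReal (t ^ (-(((n : ℝ) + b) / 2))) *
        ∫⁻ v, G v * ENNReal.ofReal (max v.2 0 ^ (b - 1)) := by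
  have hst : 0 < √t := Real.sqrt_pos.2 ht
  have hm : Measurable fun v : Eu n × ℝ => G v * ENNReal.ofReal (max v.2 0 ^ (b - 1)) := by
    fun_prop
  have e : ∀ w : Eu n × ℝ, G (spread t x w) * ENNReal.ofReal (max w.2 0 ^ (b - 1)) =
      ENNReal.ofReal (t ^ (-((b - 1) / 2))) *
      (G (spread t x w) * ENNReal.ofReal (max (spread t x w).2 0 ^ (b - 1))) := by
    intro w
    have h1 : max (spread t x w).2 0 = √t * max w.2 0 := by
      rw [mul_max_of_nonneg _ _ hst.le, mul_zero]
      rfl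
    rw [h1, Real.mul_rpow hst.le (le_max_right _ _), Real.sqrt_eq_rpow, ← Real.rpow_mul ht.le,
      mul_left_comm, ← ENNReal.ofReal_mul (by positivity), ← mul_assoc, ← Real.rpow_add ht,
      show -((b - 1) / 2) + 1 / 2 * (b - 1) = 0 by ring, Real.rpow_zero, one_mul]
  simp only [e]
  rw [lintegral_const_mul _ (by unfold spread; fun_prop), lintegral_comp_spread hm ht x, ← mul_assoc,
    ← ENNReal.ofReal_mul (by positivity), ← Real.rpow_add ht]
  congr 4
  ring

lemma gw_le_rpow (w : Eu n × ℝ) : gw b w ≤ max w.2 0 ^ (b - 1) := by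
  unfold gw
  refine mul_le_of_le_one_left (by positivity) (Real.exp_le_one_iff.2 ?_)
  nlinarith [sq_nonneg ‖w.1‖, sq_nonneg w.2]

lemma exists_avg_le (hb : 1 ≤ b) {H : Eu n × ℝ → ℝ} (hH : Continuous H) (hs : HasCompactSupport H) :
    ∃ C : ℝ, 0 ≤ C ∧ ∀ t, 0 ≤ t → ∀ x,
      |avg (gaussMeas n b) H t x| ≤ C * (1 + t) ^ (-(((n : ℝ) + b) / 2)) := by
  set d : ℝ := ((n : ℝ) + b) / 2 with hd
  have hd0 : 0 < d := by positivity
  have hν := hasMoments_gaussMeas (n := n) hb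
  have := hν.isFiniteMeasure
  obtain ⟨M, hM⟩ := hs.exists_bound_of_continuous hH
  have hM0 : 0 ≤ M := (norm_nonneg _).trans (hM 0)
  set A : ℝ := M * (gaussMeas n b).real Set.univ with hA
  have hA0 : 0 ≤ A := by positivity
  have h1 : ∀ t x, |avg (gaussMeas n b) H t x| ≤ A := fun t x =>
    norm_integral_le_of_norm_le_const (Filter.Eventually.of_forall fun w => hM _)
  have hi : Integrable fun v : Eu n × ℝ => H v * max v.2 0 ^ (b - 1) := by
    refine Continuous.integrable_of_hasCompactSupport (hH.mul ?_) hs.mul_right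
    exact Continuous.rpow_const (by fun_prop) fun _ => Or.inr (by linarith)
  set I : ℝ := ∫ v : Eu n × ℝ, |H v| * max v.2 0 ^ (b - 1) with hI
  have hI0 : 0 ≤ I := integral_nonneg fun v => by positivity
  have h2 : ∀ t, 0 < t → ∀ x, |avg (gaussMeas n b) H t x| ≤ t ^ (-d) * I := by
    intro t ht x
    have h3 : ENNReal.ofReal |avg (gaussMeas n b) H t x| ≤ ENNReal.ofReal (t ^ (-d) * I) := by
      have hIe : ENNReal.ofReal I = ∫⁻ v : Eu n × ℝ,
          ENNReal.ofReal |H v| * ENNReal.ofReal (max v.2 0 ^ (b - 1)) := by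
        rw [hI, ofReal_integral_eq_lintegral_ofReal]
        · simp only [ENNReal.ofReal_mul (abs_nonneg _)]
        · refine hi.abs.congr (Filter.Eventually.of_forall fun v => ?_)
          simp only [abs_mul]
          rw [abs_of_nonneg (by positivity : 0 ≤ max v.2 0 ^ (b - 1))]
        · exact Filter.Eventually.of_forall fun v => by positivity
      rw [ENNReal.ofReal_mul (by positivity), hIe, ← lintegral_spread_mul_rpow (by fun_prop) ht x,
        avg, integral_gaussMeas hb, ← Real.norm_eq_abs, ofReal_norm]
      refine (enorm_integral_le_lintegral_enorm _).trans (lintegral_mono fun w => ?_)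
      rw [← ofReal_norm, norm_mul, Real.norm_of_nonneg (gw_nonneg w),
        ENNReal.ofReal_mul (norm_nonneg _), Real.norm_eq_abs]
      gcongr
      exact gw_le_rpow w
    exact (ENNReal.ofReal_le_ofReal_iff (by positivity)).1 h3
  refine ⟨2 ^ d * (A + I), by positivity, fun t ht x => ?_⟩
  rcases le_or_gt t 1 with ht1 | ht1
  · have h4 : (2 : ℝ) ^ (-d) ≤ (1 + t) ^ (-d) :=
      Real.rpow_le_rpow_of_nonpos (by linarith) (by linarith) (by linarith)
    have h5 : (2 : ℝ) ^ d * 2 ^ (-d) = 1 := by rw [← Real.rpow_add two_pos]; simp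
    calc |avg (gaussMeas n b) H t x| ≤ 2 ^ d * 2 ^ (-d) * (A + I) := by
          rw [h5]; linarith [h1 t x]
      _ = 2 ^ d * (A + I) * 2 ^ (-d) := by ring
      _ ≤ _ := by gcongr
  · have h4 : (2 * t) ^ (-d) ≤ (1 + t) ^ (-d) :=
      Real.rpow_le_rpow_of_nonpos (by linarith) (by linarith) (by linarith)
    have h5 : (2 : ℝ) ^ d * (2 * t) ^ (-d) = t ^ (-d) := by
      rw [Real.mul_rpow two_pos.le ht, ← mul_assoc, ← Real.rpow_add two_pos]; simp
    calc |avg (gaussMeas n b) H t x| ≤ 2 ^ d * (2 * t) ^ (-d) * (A + I) := by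
          rw [h5]
          refine (h2 t (by linarith) x).trans ?_
          gcongr
          linarith
      _ = 2 ^ d * (A + I) * (2 * t) ^ (-d) := by ring
      _ ≤ _ := by gcongr

end Decay

section Potential

open scoped ContDiff

variable {n : ℕ} {ln : Fin n} {b : ℝ}

section

variable {F : Type} [NormedAddCommGroup F] [NormedSpace ℝ F]

/-- The time integral of the averages of `H`. -/
def pot (b : ℝ) (H : Eu n × ℝ → F) (x : Eu n) : F :=
  ∫ t in Set.Ioi (0 : ℝ), avg (gaussMeas n b) H t x

lemma exists_norm_avg_le (hb : 1 ≤ b) {H : Eu n × ℝ → F} (hH : Continuous H)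
    (hs : HasCompactSupport H) :
    ∃ C : ℝ, 0 ≤ C ∧ ∀ t, 0 ≤ t → ∀ x,
      ‖avg (gaussMeas n b) H t x‖ ≤ C * (1 + t) ^ (-(((n : ℝ) + b) / 2)) := by
  obtain ⟨C, hC0, hC⟩ := exists_avg_le hb hH.norm hs.norm
  exact ⟨C, hC0, fun t ht x => (norm_integral_le_integral_norm _).trans
    ((le_abs_self _).trans (hC t ht x))⟩

lemma integrableOn_decay (hn : 1 ≤ n) (hb : 1 < b) (C : ℝ) :
    IntegrableOn (fun t : ℝ => C * (1 + t) ^ (-(((n : ℝ) + b) / 2))) (Set.Ioi 0) := by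
  have hn' : (1 : ℝ) ≤ n := by exact_mod_cast hn
  have := integrableOn_add_rpow_Ioi_of_lt (a := -(((n : ℝ) + b) / 2)) (c := 0) (m := 1)
    (by linarith) (by norm_num)
  refine (Integrable.const_mul this C).congr (Filter.Eventually.of_forall fun t => ?_)
  simp only [add_comm]

lemma continuous_avg_time (hb : 1 ≤ b) {H : Eu n × ℝ → F} (hH : Continuous H)
    (hs : HasCompactSupport H) (x : Eu n) : Continuous fun t => avg (gaussMeas n b) H t x :=
  (continuous_avg (hasMoments_gaussMeas hb) hH hs).comp (by fun_prop : Continuous fun t => (t, x))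

lemma integrableOn_avg (hn : 1 ≤ n) (hb : 1 < b) {H : Eu n × ℝ → F} (hH : Continuous H)
    (hs : HasCompactSupport H) (x : Eu n) :
    IntegrableOn (fun t => avg (gaussMeas n b) H t x) (Set.Ioi 0) := by
  obtain ⟨C, hC0, hC⟩ := exists_norm_avg_le hb.le hH hs
  refine (integrableOn_decay hn hb C).mono' (continuous_avg_time hb.le hH hs x).aestronglyMeasurable
    ?_
  filter_upwards [ae_restrict_mem measurableSet_Ioi] with t ht
  exact hC t (le_of_lt ht) x

lemma continuous_pot (hn : 1 ≤ n) (hb : 1 < b) {H : Eu n × ℝ → F} (hH : Continuous H)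
    (hs : HasCompactSupport H) : Continuous (pot b H) := by
  obtain ⟨C, hC0, hC⟩ := exists_norm_avg_le hb.le hH hs
  refine continuous_of_dominated
    (fun x => (continuous_avg_time hb.le hH hs x).aestronglyMeasurable) (fun x => ?_)
    (integrableOn_decay hn hb C) (Filter.Eventually.of_forall fun t => ?_)
  · filter_upwards [ae_restrict_mem measurableSet_Ioi] with t ht
    exact hC t (le_of_lt ht) x
  · exact (continuous_avg (hasMoments_gaussMeas hb.le) hH hs).comp
      (by fun_prop : Continuous fun x => (t, x))

lemma hasFDerivAt_pot [CompleteSpace F] (hn : 1 ≤ n) (hb : 1 < b) {H : Eu n × ℝ → F}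
    (hH : ContDiff ℝ ∞ H) (hs : HasCompactSupport H) (x : Eu n) :
    HasFDerivAt (pot b H) (pot b (fderivFst H) x) x := by
  have hH' := (contDiff_fderivFst hH).continuous
  have hs' := hasCompactSupport_fderivFst hs
  obtain ⟨C, hC0, hC⟩ := exists_norm_avg_le hb.le hH' hs'
  refine hasFDerivAt_integral_of_dominated_of_fderiv_le Filter.univ_mem
    (F' := fun x t => avg (gaussMeas n b) (fderivFst H) t x)
    (Filter.Eventually.of_forall fun y =>
      (continuous_avg_time hb.le hH.continuous hs y).aestronglyMeasurable)
    (integrableOn_avg hn hb hH.continuous hs x)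
    (continuous_avg_time hb.le hH' hs' x).aestronglyMeasurable ?_ (integrableOn_decay hn hb C)
    (Filter.Eventually.of_forall fun t y _ => hasFDerivAt_avg (hasMoments_gaussMeas hb.le) hH hs t y)
  filter_upwards [ae_restrict_mem measurableSet_Ioi] with t ht y _
  exact hC t (le_of_lt ht) y

end

lemma contDiff_pot (hn : 1 ≤ n) (hb : 1 < b) (k : ℕ) :
    ∀ (F : Type) [NormedAddCommGroup F] [NormedSpace ℝ F] [CompleteSpace F] (H : Eu n × ℝ → F),
      ContDiff ℝ ∞ H → HasCompactSupport H → ContDiff ℝ k (pot b H) := by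
  induction k with
  | zero =>
    intro F _ _ _ H hH hs
    exact contDiff_zero.2 (continuous_pot hn hb hH.continuous hs)
  | succ k ih =>
    intro F _ _ _ H hH hs
    have h := ih _ _ (contDiff_fderivFst hH) (hasCompactSupport_fderivFst hs)
    exact_mod_cast contDiff_succ_iff_hasFDerivAt.2 ⟨_, h, hasFDerivAt_pot hn hb hH hs⟩

variable {H : Eu n × ℝ → ℝ} {φ : Eu n → ℝ}

lemma pd_pot (hn : 1 ≤ n) (hb : 1 < b) (hH : ContDiff ℝ ∞ H) (hs : HasCompactSupport H)
    (i : Fin n) : pd (pot b H) i = pot b (pdFst H i) := by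
  funext x
  have hH' := contDiff_fderivFst hH
  have hs' := hasCompactSupport_fderivFst hs
  rw [pd, (hasFDerivAt_pot hn hb hH hs x).fderiv, pot, ContinuousLinearMap.integral_apply
    (integrableOn_avg hn hb hH'.continuous hs' x)]
  refine integral_congr_ae (Filter.Eventually.of_forall fun t => ?_)
  simp only [avg]
  rw [ContinuousLinearMap.integral_apply
    (integrable_avg (hasMoments_gaussMeas hb.le) hH'.continuous hs' t x)]
  rfl

lemma pd2_pot (hn : 1 ≤ n) (hb : 1 < b) (hH : ContDiff ℝ ∞ H) (hs : HasCompactSupport H)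
    (i j : Fin n) : pd2 (pot b H) i j = pot b (pdFst (pdFst H j) i) := by
  funext x
  rw [pd2, pd_pot hn hb hH hs, pd_pot hn hb (contDiff_pdFst hH j) (hasCompactSupport_pdFst hs j)]

lemma pd2_avg (hb : 1 ≤ b) (hH : ContDiff ℝ ∞ H) (hs : HasCompactSupport H) (t : ℝ)
    (i j : Fin n) :
    pd2 (avg (gaussMeas n b) H t) i j = avg (gaussMeas n b) (pdFst (pdFst H j) i) t := by
  have hν := hasMoments_gaussMeas (n := n) hb
  funext x
  rw [pd2, pd_avg hν hH hs, pd_avg hν (contDiff_pdFst hH j) (hasCompactSupport_pdFst hs j)]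

end Potential

section RootLift

open scoped ContDiff

variable {n : ℕ} {ln : Fin n} {b κ : ℝ} {f : Eu n → ℝ}

/-- Smooth functions with compact support inside the open half space. -/
structure IsTest (ln : Fin n) (f : Eu n → ℝ) : Prop where
  smooth : ContDiff ℝ ∞ f
  compact : HasCompactSupport f
  pos : tsupport f ⊆ {x | 0 < x ln}

/-- The function `y ↦ f (y', √y_n)`. -/
def rootLift (ln : Fin n) (f : Eu n → ℝ) (y : Eu n) : ℝ :=
  f (y + (√(y ln) - y ln) • EuclideanSpace.single ln (1 : ℝ))

lemma IsTest.contDiff_rootLift (hf : IsTest ln f) : ContDiff ℝ ∞ (rootLift ln f) := by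
  rw [contDiff_iff_contDiffAt]
  intro y
  have hc : Continuous fun y : Eu n => y + (√(y ln) - y ln) • EuclideanSpace.single ln (1 : ℝ) := by
    fun_prop
  rcases le_or_gt (y ln) 0 with hy | hy
  · have h1 : y + (√(y ln) - y ln) • EuclideanSpace.single ln (1 : ℝ) ∉ tsupport f := by
      intro h
      have := hf.pos h
      simp [Real.sqrt_eq_zero_of_nonpos hy] at this
    have h2 : ∀ᶠ z in nhds y, rootLift ln f z = 0 := by
      filter_upwards [hc.continuousAt.eventually_mem
        ((isClosed_tsupport f).isOpen_compl.mem_nhds h1)] with z hz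
      exact image_eq_zero_of_notMem_tsupport (f := f) hz
    exact contDiffAt_const.congr_of_eventuallyEq h2
  · have hp : ContDiffAt ℝ ∞ (fun y : Eu n => y ln) y :=
      (EuclideanSpace.proj ln : Eu n →L[ℝ] ℝ).contDiff.contDiffAt
    have h1 : ContDiffAt ℝ ∞
        (fun y : Eu n => y + (√(y ln) - y ln) • EuclideanSpace.single ln (1 : ℝ)) y :=
      contDiffAt_id.add (((hp.sqrt hy.ne').sub hp).smul contDiffAt_const)
    exact hf.smooth.contDiffAt.comp y h1

lemma IsTest.hasCompactSupport_rootLift (hf : IsTest ln f) :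
    HasCompactSupport (rootLift ln f) := by
  obtain ⟨R, hR⟩ := hf.compact.isCompact.isBounded.exists_norm_le
  refine HasCompactSupport.of_support_subset_isCompact
    (isCompact_closedBall 0 (2 * R + R ^ 2)) fun y hy => ?_
  rw [mem_closedBall_zero_iff]
  set z := y + (√(y ln) - y ln) • EuclideanSpace.single ln (1 : ℝ) with hz
  have hzs : z ∈ tsupport f := subset_tsupport _ hy
  have h1 : ‖z‖ ≤ R := hR _ hzs
  have h2 : z ln = √(y ln) := by simp [hz]
  have h3 : 0 < √(y ln) := h2 ▸ hf.pos hzs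
  have h4 : √(y ln) ≤ R := by
    rw [← h2]
    exact (le_abs_self _).trans ((PiLp.norm_apply_le z ln).trans h1)
  have h5 : 0 < y ln := Real.sqrt_pos.1 h3
  have h6 : y ln ≤ R ^ 2 := by
    rw [← Real.sq_sqrt h5.le]
    gcongr
  have h7 : y = z - (√(y ln) - y ln) • EuclideanSpace.single ln (1 : ℝ) := by
    rw [hz, add_sub_cancel_right]
  rw [h7]
  refine (norm_sub_le _ _).trans ?_
  rw [norm_smul, Real.norm_eq_abs, PiLp.norm_single, norm_one, mul_one]
  have : |√(y ln) - y ln| ≤ R + R ^ 2 := by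
    rw [abs_le]
    constructor <;> nlinarith [sq_nonneg R]
  linarith

lemma rootLift_sqMap (v : Eu n × ℝ) : rootLift ln f (sqMap ln v) =
    f (v.1 + (√(v.1 ln ^ 2 + v.2 ^ 2) - v.1 ln) • EuclideanSpace.single ln (1 : ℝ)) := by
  rw [rootLift, sqMap_ln, sqMap, add_assoc, ← add_smul]
  congr 3
  ring

lemma rootLift_sqMap_zero {x : Eu n} (hx : 0 < x ln) : rootLift ln f (sqMap ln (x, 0)) = f x := by
  rw [rootLift_sqMap]
  simp [Real.sqrt_sq hx.le]

/-- The total mass of `gaussMeas`. -/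
def gaussMass (n : ℕ) (b : ℝ) : ℝ := (gaussMeas n b).real Set.univ

lemma gaussMass_pos (hb : 1 ≤ b) : 0 < gaussMass n b := by
  have h1 : gaussMass n b = ∫ w : Eu n × ℝ, gw b w := by
    have := integral_gaussMeas (n := n) hb fun _ => (1 : ℝ)
    simpa [gaussMass] using this
  have h2 : Integrable (gw b : Eu n × ℝ → ℝ) := by
    have := integrable_mul_gw (n := n) hb (G := fun _ => (1 : ℝ)) continuous_const (C := 1) (N := 0)
      (by simp)
    simpa using this
  rw [h1]
  refine integral_pos_of_integrable_nonneg_nonzero (x := (0, 1)) (continuous_gw hb) h2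
    (fun w => gw_nonneg w) ?_
  simp [gw, Real.exp_ne_zero]

end RootLift

section TestFlow

open scoped ContDiff

variable {n : ℕ} {ln : Fin n} {b : ℝ} {f g : Eu n → ℝ} {φ : Eu n → ℝ}

/-- The initial profile for which `besselFlow` starts at `f`. -/
def profile (ln : Fin n) (b : ℝ) (f : Eu n → ℝ) (y : Eu n) : ℝ :=
  (gaussMass n b)⁻¹ * rootLift ln f y

lemma IsTest.contDiff_profile (hf : IsTest ln f) : ContDiff ℝ ∞ (profile ln b f) :=
  contDiff_const.mul hf.contDiff_rootLift

lemma IsTest.hasCompactSupport_profile (hf : IsTest ln f) :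
    HasCompactSupport (profile ln b f) :=
  hf.hasCompactSupport_rootLift.mul_left

lemma avg_zero (H : Eu n × ℝ → ℝ) (x : Eu n) :
    avg (gaussMeas n b) H 0 x = gaussMass n b * H (x, 0) := by
  simp [avg, spread, gaussMass]

lemma besselFlow_profile_zero (hb : 1 ≤ b) {x : Eu n} (hx : 0 < x ln) :
    besselFlow ln b (profile ln b f) 0 x = f x := by
  rw [besselFlow, avg_zero, Function.comp_apply, profile, rootLift_sqMap_zero hx,
    mul_inv_cancel_left₀ (gaussMass_pos hb).ne']

lemma IsTest.of_mul_left {h : Eu n → ℝ} (hf : IsTest ln f)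
    (hh : ∀ x, 0 < x ln → ContDiffAt ℝ ∞ h x) : IsTest ln fun x => f x * h x := by
  have ht : tsupport (fun x => f x * h x) ⊆ tsupport f := tsupport_mul_subset_left
  refine ⟨contDiff_iff_contDiffAt.2 fun x => ?_, hf.compact.mul_right, ht.trans hf.pos⟩
  by_cases hx : 0 < x ln
  · exact hf.smooth.contDiffAt.mul (hh x hx)
  · have hx' : x ∉ tsupport fun x => f x * h x := fun h' => hx (hf.pos (ht h'))
    refine (contDiffAt_const (c := (0 : ℝ))).congr_of_eventuallyEq ?_
    exact notMem_tsupport_iff_eventuallyEq.1 hx'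

lemma IsTest.exists_isFlow (hg : IsTest ln g) (hb : 1 < b) {κ : ℝ} (hκ : κ = 0 ∨ κ = b) :
    ∃ V Vt, IsFlow ln b κ V Vt ∧ ∀ x, 0 < x ln → V 0 x = g x := by
  rcases hκ with rfl | rfl
  · exact ⟨_, _, isFlow_besselFlow hb hg.contDiff_profile hg.hasCompactSupport_profile,
      fun x hx => besselFlow_profile_zero hb.le hx⟩
  · have hg' : IsTest ln fun x => g x * (x ln)⁻¹ :=
      hg.of_mul_left fun x hx => ContDiffAt.inv
        (EuclideanSpace.proj ln : Eu n →L[ℝ] ℝ).contDiff.contDiffAt hx.ne'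
    refine ⟨_, _, isFlow_coord_mul (isFlow_besselFlow (b := κ + 2) (by linarith)
      (hg'.contDiff_profile (b := κ + 2)) hg'.hasCompactSupport_profile), fun x hx => ?_⟩
    rw [besselFlow_profile_zero (by linarith) hx]
    field_simp

lemma exists_isFlow_pd2 (hb : 1 < b) (hφ : ContDiff ℝ ∞ φ) (hs : HasCompactSupport φ) {i : Fin n}
    (hi : i ≠ ln) (j : Fin n) :
    ∃ κ, (κ = 0 ∨ κ = b) ∧ ∃ Wt, IsFlow ln b κ (fun t => pd2 (besselFlow ln b φ t) i j) Wt := by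
  by_cases hj : j = ln
  · subst hj
    refine ⟨b, Or.inr rfl, ?_⟩
    have hφ' : ContDiff ℝ ∞ fun x => b⁻¹ * pd (pd φ j) i x :=
      contDiff_const.mul (contDiff_top_pd (contDiff_top_pd hφ j) i)
    have hs' : HasCompactSupport fun x => b⁻¹ * pd (pd φ j) i x := ((hs.pd j).pd i).mul_left
    have hb2 : 1 < b + 2 := by linarith
    have hF := isFlow_coord_mul (isFlow_besselFlow (ln := j) hb2 hφ' hs')
    refine ⟨_, Eq.subst (motive := fun W => IsFlow j b b W _) ?_ hF⟩
    symm
    funext t x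
    have e1 : pd (besselFlow j b φ t) j =
        fun x => x j * (b⁻¹ * besselFlow j (b + 2) (pd φ j) t x) := by
      funext x
      rw [pd_besselFlow_ln hb hφ hs]
      ring
    have hd : Differentiable ℝ (besselFlow j (b + 2) (pd φ j) t) :=
      ((isFlow_besselFlow hb2 (contDiff_top_pd hφ j) (hs.pd j)).smooth t).differentiable
        (by norm_num)
    rw [pd2, e1, pd_coord_mul (hd.const_mul _), if_neg hi, zero_add]
    have e2 : pd (fun x => b⁻¹ * besselFlow j (b + 2) (pd φ j) t x) i x =
        b⁻¹ * pd (besselFlow j (b + 2) (pd φ j) t) i x := by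
      have : fderiv ℝ (fun x => b⁻¹ * besselFlow j (b + 2) (pd φ j) t x) x = _ :=
        ((hd x).hasFDerivAt.const_mul b⁻¹).fderiv
      rw [pd, this]
      rfl
    rw [e2, pd_besselFlow_ne hb2 (contDiff_top_pd hφ j) (hs.pd j) t hi]
    simp only [besselFlow, avg, Function.comp_apply, integral_const_mul]
  · refine ⟨0, Or.inl rfl, ?_⟩
    have hF := isFlow_besselFlow hb (contDiff_top_pd (contDiff_top_pd hφ j) i) ((hs.pd j).pd i)
      (ln := ln)
    refine ⟨_, Eq.subst (motive := fun W => IsFlow ln b 0 W _) ?_ hF⟩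
    symm
    funext t
    rw [← pd_besselFlow_ne hb (contDiff_top_pd hφ j) (hs.pd j) t hi,
      ← pd_besselFlow_ne hb hφ hs t hj]
    rfl

/-- The normalised solution of `-Δu - (b / x_n) ∂_n u = f`. -/
def testPot (ln : Fin n) (b : ℝ) (f : Eu n → ℝ) : Eu n → ℝ :=
  pot b (profile ln b f ∘ sqMap ln)

lemma IsTest.contDiff_testPot (hf : IsTest ln f) (hn : 1 ≤ n) (hb : 1 < b) (k : ℕ) :
    ContDiff ℝ k (testPot ln b f) :=
  contDiff_pot hn hb k ℝ _ (contDiff_comp_sqMap hf.contDiff_profile)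
    (hasCompactSupport_comp_sqMap hf.hasCompactSupport_profile)

lemma abs_integral_Ioi_le {a B : ℝ → ℝ} (ha : IntegrableOn a (Set.Ioi 0)) {K : ℝ}
    (hB : ∀ T, 0 ≤ T → ContinuousOn B (Set.Icc 0 T)) (hab : ∀ t, 0 ≤ t → |a (2 * t)| ≤ B t)
    (hK : ∀ T, 0 ≤ T → ∫ t in (0 : ℝ)..T, B t ≤ K) : |∫ t in Set.Ioi (0 : ℝ), a t| ≤ 2 * K := by
  have hlim := (intervalIntegral_tendsto_integral_Ioi 0 ha
    ((Filter.tendsto_id).const_mul_atTop (by norm_num : (0 : ℝ) < 2))).abs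
  refine le_of_tendsto hlim ?_
  filter_upwards [Filter.eventually_ge_atTop 0] with T hT
  have e : ∫ t in (0 : ℝ)..2 * T, a t = 2 * ∫ t in (0 : ℝ)..T, a (2 * t) := by
    have := intervalIntegral.mul_integral_comp_mul_left (f := a) (c := 2) (a := 0) (b := T)
    rw [mul_zero] at this
    exact this.symm
  simp only [id]
  rw [e, abs_mul, abs_two]
  have h1 : ‖∫ t in (0 : ℝ)..T, a (2 * t)‖ ≤ ∫ t in (0 : ℝ)..T, B t := by
    refine intervalIntegral.norm_integral_le_of_norm_le hT
      (Filter.Eventually.of_forall fun t ht => hab t ht.1.le) ?_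
    exact (Set.uIcc_of_le hT ▸ hB T hT).intervalIntegrable
  rw [Real.norm_eq_abs] at h1
  linarith [hK T hT]

lemma abs_wt (x : Eu n) : |wt ln b x| = wt ln b x := abs_of_nonneg (wt_nonneg x)

lemma integral_wt_pd_mul (hb : 1 < b) {u v : Eu n → ℝ} {i : Fin n} (hi : i ≠ ln)
    (hu : Differentiable ℝ u) (hur : RapidOn 0 fun _ => u) (hui : RapidOn 0 fun _ => pd u i)
    (hv : Rapid2 v) :
    ∫ x, wt ln b x * (pd u i x * v x) = -∫ x, wt ln b x * (u x * pd v i x) := by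
  have h0 : (0 : ℝ) ∈ Set.Icc (0 : ℝ) 0 := by simp
  have hb0 : 0 ≤ b := by linarith
  have hw := (hasFDerivAt_wt (n := n) (ln := ln) hb)
  have hv' := hv.smooth.differentiable (by norm_num)
  have hwd : Differentiable ℝ fun x => wt ln b x * v x := fun x =>
    (hw x).differentiableAt.mul (hv' x)
  have hwp : ∀ x, fderiv ℝ (fun x => wt ln b x * v x) x (EuclideanSpace.single i 1) =
      wt ln b x * pd v i x := by
    intro x
    have h1 : fderiv ℝ (fun x => wt ln b x * v x) x = _ := ((hw x).mul (hv' x).hasFDerivAt).fderiv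
    rw [h1]
    simp [pd, hi.symm]
  have key := integral_mul_fderiv_eq_neg_fderiv_mul_of_integrable (μ := volume)
    (f := u) (g := fun x => wt ln b x * v x) (v := EuclideanSpace.single i (1 : ℝ)) ?_ ?_ ?_
    (fun x _ => hu x) (fun x _ => hwd x)
  · simp only [hwp] at key
    have e1 : ∀ x, wt ln b x * (pd u i x * v x) =
        fderiv ℝ u x (EuclideanSpace.single i 1) * (wt ln b x * v x) := fun x => by
      rw [pd]; ring
    have e2 : ∀ x, wt ln b x * (u x * pd v i x) = u x * (wt ln b x * pd v i x) := fun x => by ring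
    simp only [e1, e2]
    rw [key, neg_neg]
  · exact (hui.mul (hv.self.wt_mul hb0)).integrable h0
  · simp only [hwp]
    exact (hur.mul ((hv.pd i).wt_mul hb0)).integrable h0
  · exact (hur.mul (hv.self.wt_mul hb0)).integrable h0

end TestFlow

section Pairing

open scoped ContDiff

variable {n : ℕ} {ln : Fin n} {b : ℝ} {f g : Eu n → ℝ} {p q : ℝ}

lemma integrable_decay_mul (hn : 1 ≤ n) (hb : 1 < b) {G : Eu n × ℝ → ℝ} (hG : Continuous G)
    (hs : HasCompactSupport G) {h : Eu n → ℝ} (hh : Continuous h) (hhi : Integrable h) :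
    Integrable (fun z : ℝ × Eu n => avg (gaussMeas n b) G z.1 z.2 * h z.2)
      ((volume.restrict (Set.Ioi 0)).prod volume) := by
  obtain ⟨C, hC0, hC⟩ := exists_avg_le hb.le hG hs
  refine Integrable.mono' ((integrableOn_decay hn hb C).mul_prod hhi.norm)
    (((continuous_avg (hasMoments_gaussMeas hb.le) hG hs).mul
      (hh.comp continuous_snd)).aestronglyMeasurable) ?_
  have hae : ∀ᵐ z : ℝ × Eu n ∂(volume.restrict (Set.Ioi 0)).prod volume, z.1 ∈ Set.Ioi (0 : ℝ) :=
    Measure.quasiMeasurePreserving_fst.ae (ae_restrict_mem measurableSet_Ioi)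
  filter_upwards [hae] with z hz
  rw [norm_mul]
  exact mul_le_mul_of_nonneg_right (hC _ (le_of_lt hz) _) (norm_nonneg _)

lemma wt_mul_congr (hb : 0 < b) {F G : Eu n → ℝ} (h : ∀ x, 0 < x ln → F x = G x) (x : Eu n) :
    wt ln b x * F x = wt ln b x * G x := by
  rcases le_or_gt (x ln) 0 with hx | hx
  · rw [wt_of_nonpos hb hx, zero_mul, zero_mul]
  · rw [h x hx]

theorem exists_abs_integral_pd2_testPot_le (hpq : p.HolderConjugate q) (hn : 1 ≤ n) (hb : 1 < b) :
    ∃ C : ℝ, 0 < C ∧ ∀ f g : Eu n → ℝ, IsTest ln f → IsTest ln g → ∀ i j : Fin n, i ≠ ln →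
      |∫ x, wt ln b x * (pd2 (testPot ln b f) i j x * g x)| ≤
        C * ∫ x, wt ln b x * (|f x| ^ p + |g x| ^ q) := by
  obtain ⟨C, hC, hbil⟩ := bilinear_embedding (n := n) (ln := ln) hpq hb
  refine ⟨2 * C, by positivity, fun f g hf hg i j hi => ?_⟩
  have hb0 : 0 < b := by linarith
  have hφ := hf.contDiff_profile (b := b)
  have hs := hf.hasCompactSupport_profile (b := b)
  have hH := contDiff_comp_sqMap (ln := ln) hφ
  have hHs := hasCompactSupport_comp_sqMap (ln := ln) hs
  set φ := profile ln b f with hφd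
  set G := pdFst (pdFst (φ ∘ sqMap ln) j) i with hG
  have hGc : Continuous G := (contDiff_pdFst (contDiff_pdFst hH j) i).continuous
  have hGs : HasCompactSupport G := hasCompactSupport_pdFst (hasCompactSupport_pdFst hHs j) i
  have hWG : ∀ t, pd2 (besselFlow ln b φ t) i j = avg (gaussMeas n b) G t := fun t =>
    pd2_avg hb.le hH hHs t i j
  obtain ⟨κ, hκ, Wt, hW⟩ := exists_isFlow_pd2 (ln := ln) hb hφ hs hi j
  obtain ⟨V, Vt, hV, hV0⟩ := hg.exists_isFlow hb hκ
  have hκ0 : 0 ≤ κ := by rcases hκ with rfl | rfl <;> linarith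
  have hU := isFlow_besselFlow (ln := ln) hb hφ hs
  have hgc : Continuous fun x => wt ln b x * g x :=
    (continuous_wt hb0.le).mul hg.smooth.continuous
  have hgi : Integrable fun x => wt ln b x * g x :=
    hgc.integrable_of_hasCompactSupport hg.compact.mul_left
  have hInt := integrable_decay_mul hn hb hGc hGs hgc hgi
  have e1 : ∫ x, wt ln b x * (pd2 (testPot ln b f) i j x * g x) =
      ∫ t in Set.Ioi (0 : ℝ), ∫ x, avg (gaussMeas n b) G t x * (wt ln b x * g x) := by
    rw [integral_integral_swap hInt]
    refine integral_congr_ae (Filter.Eventually.of_forall fun x => ?_)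
    simp only
    rw [testPot, pd2_pot hn hb hH hHs, integral_mul_const, pot]
    ring
  have hE : ∫ x, wt ln b x * (|f x| ^ p + |g x| ^ q) =
      ∫ x, wt ln b x * (|besselFlow ln b φ 0 x| ^ p + |V 0 x| ^ q) := by
    refine integral_congr_ae (Filter.Eventually.of_forall
      (wt_mul_congr hb0 fun x hx => ?_))
    rw [hV0 x hx, besselFlow_profile_zero hb.le hx]
  rw [e1, hE, mul_assoc]
  refine abs_integral_Ioi_le hInt.integral_prod_left
    (fun T _ => (hU.rapid_gradients hb hV T i j).continuous_integral) (fun t ht => ?_)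
    (fun T hT => hbil κ _ _ _ _ hκ0 hU hV T hT i j)
  have e2 : ∫ x, avg (gaussMeas n b) G (2 * t) x * (wt ln b x * g x) =
      ∫ x, wt ln b x * (pd2 (besselFlow ln b φ (2 * t)) i j x * V 0 x) := by
    refine integral_congr_ae (Filter.Eventually.of_forall fun x => ?_)
    simp only
    have := wt_mul_congr (ln := ln) hb0 (F := fun x => pd2 (besselFlow ln b φ (2 * t)) i j x * V 0 x)
      (G := fun x => pd2 (besselFlow ln b φ (2 * t)) i j x * g x)
      (fun x hx => by simp only [hV0 x hx]) x
    rw [this, hWG]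
    ring
  have hr := hU.rapid2 ht
  rw [e2, hW.pairing hb hV ht]
  have e3 := integral_wt_pd_mul (ln := ln) hb hi (u := pd (besselFlow ln b φ t) j)
    ((hr.smooth.pd (m := 1) (by norm_num) j).differentiable one_ne_zero) (hr.pd j) (hr.pd2 i j)
    (hV.rapid2 ht)
  have e4 : ∫ x, wt ln b x * (pd2 (besselFlow ln b φ t) i j x * V t x) = _ := e3
  rw [e4, abs_neg]
  refine (abs_integral_le_integral_abs).trans_eq ?_
  refine integral_congr_ae (Filter.Eventually.of_forall fun x => ?_)
  simp only [abs_mul, abs_wt]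

end Pairing

section Duality

open scoped ContDiff

variable {n : ℕ} {ln : Fin n} {b : ℝ} {f g h : Eu n → ℝ} {p q : ℝ}

/-- Cutoff functions exhausting the open half space. -/
def testCut (ln : Fin n) (k : ℕ) (x : Eu n) : ℝ :=
  Real.smoothTransition (2 - ‖x‖ ^ 2 / ((k : ℝ) + 1) ^ 2) *
    Real.smoothTransition (((k : ℝ) + 1) * x ln - 1)

lemma testCut_nonneg (k : ℕ) (x : Eu n) : 0 ≤ testCut ln k x :=
  mul_nonneg (Real.smoothTransition.nonneg _) (Real.smoothTransition.nonneg _)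

lemma testCut_le_one (k : ℕ) (x : Eu n) : testCut ln k x ≤ 1 :=
  mul_le_one₀ (Real.smoothTransition.le_one _) (Real.smoothTransition.nonneg _)
    (Real.smoothTransition.le_one _)

lemma isTest_testCut (k : ℕ) : IsTest ln (testCut ln k) := by
  have hk : (0 : ℝ) < (k : ℝ) + 1 := by positivity
  refine ⟨?_, ?_, ?_⟩
  · refine (Real.smoothTransition.contDiff.comp
      (contDiff_const.sub ((contDiff_norm_sq ℝ).div_const _))).mul
      (Real.smoothTransition.contDiff.comp ((contDiff_const.mul
        (EuclideanSpace.proj ln : Eu n →L[ℝ] ℝ).contDiff).sub contDiff_const))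
  · refine HasCompactSupport.of_support_subset_isCompact
      (isCompact_closedBall 0 (2 * ((k : ℝ) + 1))) fun x hx => ?_
    rw [mem_closedBall_zero_iff]
    by_contra hlt
    refine hx (?_ : testCut ln k x = 0)
    have : 2 - ‖x‖ ^ 2 / ((k : ℝ) + 1) ^ 2 ≤ 0 := by
      rw [sub_nonpos, le_div_iff₀ (by positivity)]
      nlinarith [not_le.1 hlt]
    rw [testCut, Real.smoothTransition.zero_of_nonpos this, zero_mul]
  · have h1 : tsupport (testCut ln k) ⊆ {x : Eu n | 1 / ((k : ℝ) + 1) ≤ x ln} := by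
      refine closure_minimal (fun x hx => ?_)
        (isClosed_le continuous_const (EuclideanSpace.proj ln : Eu n →L[ℝ] ℝ).continuous)
      by_contra hlt
      refine hx (?_ : testCut ln k x = 0)
      have hlt' : x ln < 1 / ((k : ℝ) + 1) := not_le.1 hlt
      rw [lt_div_iff₀ hk] at hlt'
      rw [testCut, Real.smoothTransition.zero_of_nonpos
        (by linarith : ((k : ℝ) + 1) * x ln - 1 ≤ 0), mul_zero]
    exact h1.trans fun x hx => (one_div_pos.2 hk).trans_le hx

lemma eventually_testCut_eq_one {x : Eu n} (hx : 0 < x ln) :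
    ∀ᶠ k : ℕ in Filter.atTop, testCut ln k x = 1 := by
  filter_upwards [Filter.eventually_ge_atTop ⌈‖x‖⌉₊, Filter.eventually_ge_atTop ⌈2 / x ln⌉₊]
    with k h1 h2
  have h1' : ‖x‖ ≤ k := Nat.ceil_le.1 h1
  have h2' : 2 / x ln ≤ k := Nat.ceil_le.1 h2
  rw [div_le_iff₀ hx] at h2'
  have h3 : ‖x‖ ^ 2 / ((k : ℝ) + 1) ^ 2 ≤ 1 := by
    rw [div_le_one (by positivity)]
    gcongr
    linarith
  rw [testCut, Real.smoothTransition.one_of_one_le (by linarith),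
    Real.smoothTransition.one_of_one_le (by linarith), one_mul]

lemma mul_rpow_sub_one_le {p ε X : ℝ} (hp : 0 < p) (hε : 0 < ε) (hX : ε ≤ X) :
    ε * X ^ (p / 2 - 1) ≤ X ^ (p / 2) / 2 + (2 * ε) ^ (p / 2) := by
  have hX0 : 0 < X := hε.trans_le hX
  have h0 : 0 ≤ X ^ (p / 2) := by positivity
  have h1 : 0 ≤ (2 * ε) ^ (p / 2) := by positivity
  rw [Real.rpow_sub_one hX0.ne', mul_div_assoc', div_le_iff₀ hX0]
  rcases le_or_gt (2 * ε) X with h | h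
  · nlinarith [mul_nonneg h1 hX0.le]
  · have h2 : X ^ (p / 2) ≤ (2 * ε) ^ (p / 2) := by gcongr
    nlinarith [mul_nonneg h0 hX0.le, mul_nonneg h0 hε.le, mul_le_mul h2 hX hε.le h1]

lemma sq_rpow_half (s : ℝ) (p : ℝ) : (s ^ 2) ^ (p / 2) = |s| ^ p := by
  rw [← sq_abs, ← Real.rpow_natCast, ← Real.rpow_mul (abs_nonneg s)]
  congr 1
  push_cast
  ring

lemma dual_profile_rpow_le (hpq : p.HolderConjugate q) {ε s c : ℝ} (hε : 0 < ε) (hc0 : 0 ≤ c)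
    (hc1 : c ≤ 1) : |c * ((s ^ 2 + ε) ^ (p / 2 - 1) * s)| ^ q ≤ c * (s ^ 2 + ε) ^ (p / 2) := by
  have hX : 0 < s ^ 2 + ε := by positivity
  have hq := hpq.symm.lt
  have h1 : |s| ≤ (s ^ 2 + ε) ^ (1 / 2 : ℝ) := by
    rw [← Real.sqrt_eq_rpow]
    exact Real.abs_le_sqrt (by linarith)
  have hp0 := hpq.pos
  rw [abs_mul, abs_mul, abs_of_nonneg hc0, abs_of_pos (by positivity : 0 < (s ^ 2 + ε) ^ (p / 2 - 1)),
    Real.mul_rpow hc0 (by positivity)]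
  have h2 : c ^ q ≤ c := by
    have := Real.rpow_le_rpow_of_exponent_ge' hc0 hc1 zero_le_one hq.le
    rwa [Real.rpow_one] at this
  refine mul_le_mul h2 ?_ (by positivity) hc0
  calc ((s ^ 2 + ε) ^ (p / 2 - 1) * |s|) ^ q
      ≤ ((s ^ 2 + ε) ^ (p / 2 - 1) * (s ^ 2 + ε) ^ (1 / 2 : ℝ)) ^ q := by gcongr
    _ = (s ^ 2 + ε) ^ (p / 2) := by
        rw [← Real.rpow_add hX, ← Real.rpow_mul hX.le]
        congr 1
        have := hpq.sub_one_mul_conj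
        linear_combination this / 2

lemma exists_scale (hq : 1 < q) {K : ℝ} (hK : 0 < K) : ∃ σ : ℝ, 0 < σ ∧ K * σ ^ q = σ / 4 := by
  refine ⟨(4 * K) ^ (-(q - 1)⁻¹), by positivity, ?_⟩
  have hq' : q - 1 ≠ 0 := by linarith
  set σ := (4 * K) ^ (-(q - 1)⁻¹) with hσ
  have hσ0 : 0 < σ := by positivity
  have h1 : σ ^ (q - 1) = (4 * K)⁻¹ := by
    rw [hσ, ← Real.rpow_mul (by positivity), neg_mul, inv_mul_cancel₀ hq', Real.rpow_neg_one]
  have h2 : σ ^ q = σ ^ (q - 1) * σ := by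
    rw [Real.rpow_sub_one hσ0.ne', div_mul_cancel₀ _ hσ0.ne']
  rw [h2, h1]
  field_simp

lemma integral_cut_le (hpq : p.HolderConjugate q) (hb : 0 < b) {K σ A : ℝ} (hσ : 0 < σ)
    (hKσ : K * σ ^ q = σ / 4) (hK : 0 < K) (hh : ContDiff ℝ ∞ h)
    (hA : ∀ g, IsTest ln g → |∫ x, wt ln b x * (h x * g x)| ≤
      K * (A + ∫ x, wt ln b x * |g x| ^ q)) {χ : Eu n → ℝ} (hχ : IsTest ln χ) (h0 : ∀ x, 0 ≤ χ x)
    (h1 : ∀ x, χ x ≤ 1) : ∫ x, wt ln b x * (χ x * |h x| ^ p) ≤ 4 * K / σ * A := by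
  have hp0 := hpq.pos
  have hq0 := hpq.symm.pos
  have hwc := continuous_wt (n := n) (ln := ln) hb.le
  have hhc := hh.continuous
  have hχc := hχ.smooth.continuous
  have key : ∀ ε : ℝ, 0 < ε → ∫ x, wt ln b x * (χ x * |h x| ^ p) ≤
      4 * K / σ * A + 4 * (2 * ε) ^ (p / 2) * ∫ x, wt ln b x * χ x := by
    intro ε hε
    have hX : ∀ x, 0 < h x ^ 2 + ε := fun x => by positivity
    have hXc : ∀ r : ℝ, Continuous fun x => (h x ^ 2 + ε) ^ r := fun r =>
      ((hhc.pow 2).add_const ε).rpow_const fun x => Or.inl (hX x).ne'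
    have hInt : ∀ {G : Eu n → ℝ}, Continuous G →
        Integrable fun x => wt ln b x * (χ x * G x) := fun hG =>
      (hwc.mul (hχc.mul hG)).integrable_of_hasCompactSupport hχ.compact.mul_right.mul_left
    set g : Eu n → ℝ := fun x => χ x * (σ * ((h x ^ 2 + ε) ^ (p / 2 - 1) * h x)) with hg
    have hgT : IsTest ln g := by
      refine hχ.of_mul_left fun x _ => ?_
      exact contDiffAt_const.mul ((((hh.contDiffAt.pow 2).add contDiffAt_const).rpow_const_of_ne
        (hX x).ne').mul hh.contDiffAt)
    have hgA := (le_abs_self _).trans (hA g hgT)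
    set I := ∫ x, wt ln b x * (χ x * (h x ^ 2 + ε) ^ (p / 2)) with hI
    have i1 : ∫ x, wt ln b x * |g x| ^ q ≤ σ ^ q * I := by
      rw [hI, ← integral_const_mul]
      refine integral_mono ?_ ((hInt (hXc _)).const_mul _) fun x => ?_
      · refine (hwc.mul (hgT.smooth.continuous.abs.rpow_const
          fun x => Or.inr hq0.le)).integrable_of_hasCompactSupport ?_
        refine (HasCompactSupport.comp_left (g := fun s : ℝ => |s| ^ q) hgT.compact ?_).mul_left
        simp [hq0.ne']
      · have := dual_profile_rpow_le hpq (s := h x) hε (h0 x) (h1 x)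
        have e : |g x| ^ q = σ ^ q * |χ x * ((h x ^ 2 + ε) ^ (p / 2 - 1) * h x)| ^ q := by
          rw [← Real.mul_rpow hσ.le (abs_nonneg _), ← abs_of_pos hσ, ← abs_mul, hg]
          congr 2
          simp only
          ring
        simp only
        rw [e]
        have h3 := mul_le_mul_of_nonneg_left this (mul_nonneg (wt_nonneg (ln := ln) (b := b) x)
          (by positivity : 0 ≤ σ ^ q))
        linarith
    have i2 : σ * (I / 2 - (2 * ε) ^ (p / 2) * ∫ x, wt ln b x * χ x) ≤
        ∫ x, wt ln b x * (h x * g x) := by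
      have hχi : Integrable fun x => wt ln b x * χ x := by
        simpa using hInt (G := fun _ => 1) continuous_const
      rw [hI, ← integral_div, ← integral_const_mul, ← integral_sub ((hInt (hXc _)).div_const 2)
        (hχi.const_mul _), ← integral_const_mul]
      refine integral_mono ((((hInt (hXc _)).div_const 2).sub (hχi.const_mul _)).const_mul _) ?_
        fun x => ?_
      · have := hInt (G := fun x => σ * ((h x ^ 2 + ε) ^ (p / 2 - 1) * h x) * h x)
          ((continuous_const.mul ((hXc _).mul hhc)).mul hhc)
        refine this.congr (Filter.Eventually.of_forall fun x => ?_)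
        simp only [hg]
        ring
      · have h3 := mul_rpow_sub_one_le (X := h x ^ 2 + ε) hp0 hε (by nlinarith [sq_nonneg (h x)])
        have h4 : h x ^ 2 * (h x ^ 2 + ε) ^ (p / 2 - 1) =
            (h x ^ 2 + ε) ^ (p / 2) - ε * (h x ^ 2 + ε) ^ (p / 2 - 1) := by
          rw [eq_sub_iff_add_eq, ← add_mul, Real.rpow_sub_one (hX x).ne',
            mul_div_cancel₀ _ (hX x).ne']
        have h5 := mul_le_mul_of_nonneg_left h3 (mul_nonneg hσ.le (mul_nonneg
          (wt_nonneg (ln := ln) (b := b) x) (h0 x)))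
        simp only [hg]
        linear_combination h5 - σ * wt ln b x * χ x * h4
    have i3 : ∫ x, wt ln b x * (χ x * |h x| ^ p) ≤ I := by
      refine integral_mono (hInt (hhc.abs.rpow_const fun x => Or.inr hp0.le)) (hInt (hXc _))
        fun x => ?_
      refine mul_le_mul_of_nonneg_left (mul_le_mul_of_nonneg_left ?_ (h0 x)) (wt_nonneg x)
      rw [← sq_rpow_half]
      gcongr
      linarith
    have i4 := mul_le_mul_of_nonneg_left i1 hK.le
    have i5 : σ / 4 * I ≤ K * A + σ * ((2 * ε) ^ (p / 2) * ∫ x, wt ln b x * χ x) := by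
      rw [← mul_assoc, hKσ] at i4
      linarith
    refine i3.trans ?_
    have : I = 4 / σ * (σ / 4 * I) := by field_simp
    rw [this]
    calc _ ≤ 4 / σ * (K * A + σ * ((2 * ε) ^ (p / 2) * ∫ x, wt ln b x * χ x)) := by gcongr
      _ = _ := by field_simp
  have hlim : Filter.Tendsto (fun ε : ℝ => 4 * K / σ * A +
      4 * (2 * ε) ^ (p / 2) * ∫ x, wt ln b x * χ x) (nhdsWithin 0 (Set.Ioi 0))
      (nhds (4 * K / σ * A + 4 * (2 * 0) ^ (p / 2) * ∫ x, wt ln b x * χ x)) := by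
    refine Filter.Tendsto.mono_left ?_ nhdsWithin_le_nhds
    have : Continuous fun ε : ℝ => 4 * K / σ * A +
        4 * (2 * ε) ^ (p / 2) * ∫ x, wt ln b x * χ x :=
      continuous_const.add ((continuous_const.mul ((continuous_const.mul continuous_id).rpow_const
        fun _ => Or.inr (by positivity))).mul continuous_const)
    exact this.tendsto 0
  rw [mul_zero, Real.zero_rpow (by positivity), mul_zero, zero_mul, add_zero] at hlim
  exact ge_of_tendsto hlim (Filter.mem_of_superset self_mem_nhdsWithin key)

lemma lintegral_rpow_le_of_dual (hpq : p.HolderConjugate q) (hb : 0 < b) {K σ A : ℝ} (hσ : 0 < σ)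
    (hKσ : K * σ ^ q = σ / 4) (hK : 0 < K) (hh : ContDiff ℝ ∞ h)
    (hA : ∀ g, IsTest ln g → |∫ x, wt ln b x * (h x * g x)| ≤
      K * (A + ∫ x, wt ln b x * |g x| ^ q)) :
    ∫⁻ x, ENNReal.ofReal (wt ln b x * |h x| ^ p) ≤ ENNReal.ofReal (4 * K / σ * A) := by
  have hp0 := hpq.pos
  have hwc := continuous_wt (n := n) (ln := ln) hb.le
  have hc : ∀ k, Continuous fun x => wt ln b x * (testCut ln k x * |h x| ^ p) := fun k =>
    hwc.mul ((isTest_testCut k).smooth.continuous.mul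
      (hh.continuous.abs.rpow_const fun _ => Or.inr hp0.le))
  have e : ∀ x, ENNReal.ofReal (wt ln b x * |h x| ^ p) = Filter.liminf (fun k : ℕ =>
      ENNReal.ofReal (wt ln b x * (testCut ln k x * |h x| ^ p))) Filter.atTop := by
    intro x
    rcases le_or_gt (x ln) 0 with hx | hx
    · simp [wt_of_nonpos hb hx]
    · refine (Filter.Tendsto.liminf_eq (tendsto_const_nhds.congr' ?_)).symm
      filter_upwards [eventually_testCut_eq_one hx] with k hk
      rw [hk, one_mul]
  simp only [e]
  refine (lintegral_liminf_le fun k => (hc k).measurable.ennreal_ofReal).trans ?_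
  refine Filter.liminf_le_of_le (by isBoundedDefault) fun c hc' => ?_
  obtain ⟨k, hk⟩ := hc'.exists
  refine hk.trans ?_
  rw [← ofReal_integral_eq_lintegral_ofReal]
  · exact ENNReal.ofReal_le_ofReal (integral_cut_le hpq hb hσ hKσ hK hh hA (isTest_testCut k)
      (testCut_nonneg k) (testCut_le_one k))
  · exact (hc k).integrable_of_hasCompactSupport (isTest_testCut k).compact.mul_right.mul_left
  · exact Filter.Eventually.of_forall fun x => mul_nonneg (wt_nonneg x)
      (mul_nonneg (testCut_nonneg k x) (by positivity))

lemma IsTest.integrable_wt_rpow (hf : IsTest ln f) (hb : 0 < b) (hp : 0 < p) :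
    Integrable fun x => wt ln b x * |f x| ^ p := by
  refine ((continuous_wt hb.le).mul (hf.smooth.continuous.abs.rpow_const
    fun x => Or.inr hp.le)).integrable_of_hasCompactSupport ?_
  refine (HasCompactSupport.comp_left (g := fun s : ℝ => |s| ^ p) hf.compact ?_).mul_left
  simp [hp.ne']

lemma IsTest.contDiff_testPot_infty (hf : IsTest ln f) (hn : 1 ≤ n) (hb : 1 < b) :
    ContDiff ℝ ∞ (testPot ln b f) :=
  contDiff_infty.2 fun k => hf.contDiff_testPot hn hb k

theorem exists_lintegral_pd2_testPot_le (hp : 1 < p) (hn : 1 ≤ n) (hb : 1 < b) :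
    ∃ C : ℝ, 0 < C ∧ ∀ f : Eu n → ℝ, IsTest ln f → ∀ i j : Fin n, i ≠ ln →
      ∫⁻ x, ENNReal.ofReal (wt ln b x * |pd2 (testPot ln b f) i j x| ^ p) ≤
        ENNReal.ofReal (C * ∫ x, wt ln b x * |f x| ^ p) := by
  have hpq := Real.HolderConjugate.conjExponent hp
  have hb0 : 0 < b := by linarith
  obtain ⟨K, hK, hbd⟩ := exists_abs_integral_pd2_testPot_le (ln := ln) hpq hn hb
  obtain ⟨σ, hσ, hKσ⟩ := exists_scale hpq.symm.lt hK
  refine ⟨4 * K / σ, by positivity, fun f hf i j hi => ?_⟩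
  refine lintegral_rpow_le_of_dual hpq hb0 hσ hKσ hK
    (contDiff_top_pd (contDiff_top_pd (hf.contDiff_testPot_infty hn hb) j) i) fun g hg => ?_
  refine (hbd f g hf hg i j hi).trans_eq ?_
  simp only [mul_add]
  rw [integral_add (hf.integrable_wt_rpow hb0 hpq.pos) (hg.integrable_wt_rpow hb0 hpq.symm.pos),
    mul_add]

end Duality

section Hardy

open scoped ContDiff

variable {n : ℕ} {ln : Fin n} {b : ℝ} {f g h : Eu n → ℝ} {p q : ℝ}

/-- Scaling of the normal coordinate. -/
def dil (ln : Fin n) (θ : ℝ) (x : Eu n) : Eu n := x + ((θ - 1) * x ln) • EuclideanSpace.single ln 1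

lemma dil_ln (θ : ℝ) (x : Eu n) : dil ln θ x ln = θ * x ln := by
  simp [dil]
  ring

lemma dil_one (x : Eu n) : dil ln 1 x = x := by simp [dil]

lemma continuous_dil : Continuous fun z : ℝ × Eu n => dil ln z.1 z.2 := by
  have : Continuous fun z : ℝ × Eu n => z.2 ln :=
    (EuclideanSpace.proj ln : Eu n →L[ℝ] ℝ).continuous.comp continuous_snd
  unfold dil
  fun_prop

lemma lintegral_comp_dil {θ : ℝ} (hθ : 0 < θ) {F : Eu n → ℝ≥0∞} (hF : Measurable F) :
    ∫⁻ x, F (dil ln θ x) = ENNReal.ofReal θ⁻¹ * ∫⁻ x, F x := by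
  set L : Eu n →ₗ[ℝ] Eu n := LinearMap.transvection
    ((θ - 1) • (EuclideanSpace.proj ln : Eu n →L[ℝ] ℝ).toLinearMap) (EuclideanSpace.single ln 1)
    with hL
  have hLd : ∀ x, L x = dil ln θ x := fun x => by
    simp [hL, LinearMap.transvection.apply, dil]
  have hdet : LinearMap.det L = θ := by
    rw [hL, LinearMap.transvection.det]
    simp
  have hm : Measure.map (dil ln θ) volume = ENNReal.ofReal θ⁻¹ • (volume : Measure (Eu n)) := by
    have := Measure.map_linearMap_addHaar_eq_smul_addHaar (volume : Measure (Eu n))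
      (f := L) (by rw [hdet]; exact hθ.ne')
    rw [hdet, abs_of_pos (inv_pos.2 hθ)] at this
    rw [← this, funext hLd]
  have hmeas : Measurable (dil ln θ : Eu n → Eu n) :=
    (continuous_dil.comp (by fun_prop : Continuous fun x : Eu n => (θ, x))).measurable
  rw [← lintegral_map hF hmeas, hm, lintegral_smul_measure, smul_eq_mul]

lemma wt_dil {θ : ℝ} (hθ : 0 < θ) (x : Eu n) : wt ln b (dil ln θ x) = θ ^ b * wt ln b x := by
  rw [wt, wt, dil_ln, ← Real.mul_rpow hθ.le (le_max_right _ _), mul_max_of_nonneg _ _ hθ.le,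
    mul_zero]

lemma lintegral_wt_comp_dil {θ : ℝ} (hθ : 0 < θ) {F : Eu n → ℝ≥0∞} (hF : Measurable F)
    (hb : 0 ≤ b) :
    ∫⁻ x, ENNReal.ofReal (wt ln b x) * F (dil ln θ x) =
      ENNReal.ofReal (θ ^ (-b - 1)) * ∫⁻ x, ENNReal.ofReal (wt ln b x) * F x := by
  have e : ∀ x, ENNReal.ofReal (wt ln b x) * F (dil ln θ x) =
      ENNReal.ofReal (θ ^ (-b)) * (ENNReal.ofReal (wt ln b (dil ln θ x)) * F (dil ln θ x)) := by
    intro x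
    rw [wt_dil hθ, ← mul_assoc, ← ENNReal.ofReal_mul (by positivity), ← mul_assoc,
      ← Real.rpow_add hθ, neg_add_cancel, Real.rpow_zero, one_mul]
  have hm : Measurable fun x : Eu n => ENNReal.ofReal (wt ln b x) * F x :=
    (continuous_wt hb).measurable.ennreal_ofReal.mul hF
  simp only [e]
  rw [lintegral_const_mul' _ _ ENNReal.ofReal_ne_top, lintegral_comp_dil hθ hm, ← mul_assoc,
    ← ENNReal.ofReal_mul (by positivity), Real.rpow_sub hθ, Real.rpow_one, div_eq_mul_inv]

lemma enorm_intervalIntegral_rpow_le (hp : 1 ≤ p) (F : ℝ → ℝ) (hF : Continuous F) :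
    ‖∫ θ in (0 : ℝ)..1, F θ‖ₑ ^ p ≤ ∫⁻ θ in Set.Ioc (0 : ℝ) 1, ‖F θ‖ₑ ^ p := by
  have hp0 : 0 < p := by linarith
  have : IsProbabilityMeasure (volume.restrict (Set.Ioc (0 : ℝ) 1)) := ⟨by simp⟩
  have h1 := eLpNorm_le_eLpNorm_of_exponent_le (p := 1) (q := ENNReal.ofReal p)
    (μ := volume.restrict (Set.Ioc (0 : ℝ) 1)) (by simpa using hp)
    hF.aestronglyMeasurable
  rw [eLpNorm_one_eq_lintegral_enorm, eLpNorm_eq_lintegral_rpow_enorm_toReal (by simpa using hp0)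
    ENNReal.ofReal_ne_top, ENNReal.toReal_ofReal hp0.le] at h1
  have h2 : ‖∫ θ in (0 : ℝ)..1, F θ‖ₑ ≤ ∫⁻ θ in Set.Ioc (0 : ℝ) 1, ‖F θ‖ₑ := by
    rw [intervalIntegral.integral_of_le zero_le_one]
    exact enorm_integral_le_lintegral_enorm _
  calc _ ≤ _ := ENNReal.rpow_le_rpow (h2.trans h1) hp0.le
    _ = _ := by rw [← ENNReal.rpow_mul, one_div_mul_cancel hp0.ne', ENNReal.rpow_one]

lemma lintegral_hardy (hp : 1 < p) (hb : 0 < b) (hh : Continuous h)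
    (hg : ∀ x, 0 < x ln → g x = ∫ θ in (0 : ℝ)..1, θ ^ b * h (dil ln θ x)) :
    ∫⁻ x, ENNReal.ofReal (wt ln b x) * ‖g x‖ₑ ^ p ≤
      ENNReal.ofReal (b * (p - 1))⁻¹ * ∫⁻ x, ENNReal.ofReal (wt ln b x) * ‖h x‖ₑ ^ p := by
  have hp0 : 0 < p := by linarith
  have hpb : 0 < b * (p - 1) := mul_pos hb (by linarith)
  have hcθ : Continuous fun θ : ℝ => θ ^ b := Real.continuous_rpow_const hb.le
  have hc : Continuous fun z : Eu n × ℝ => z.2 ^ b * h (dil ln z.2 z.1) :=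
    (hcθ.comp continuous_snd).mul (hh.comp (continuous_dil.comp continuous_swap))
  have hwm : Measurable fun x : Eu n => ENNReal.ofReal (wt ln b x) :=
    (continuous_wt hb.le).measurable.ennreal_ofReal
  calc ∫⁻ x, ENNReal.ofReal (wt ln b x) * ‖g x‖ₑ ^ p
      ≤ ∫⁻ x, ∫⁻ θ in Set.Ioc (0 : ℝ) 1,
          ENNReal.ofReal (wt ln b x) * ‖θ ^ b * h (dil ln θ x)‖ₑ ^ p := by
        refine lintegral_mono fun x => ?_
        rcases le_or_gt (x ln) 0 with hx | hx
        · simp [wt_of_nonpos hb hx]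
        · rw [hg x hx, lintegral_const_mul' _ _ ENNReal.ofReal_ne_top]
          exact mul_le_mul_right (enorm_intervalIntegral_rpow_le hp.le _
            (hc.comp (by fun_prop : Continuous fun θ : ℝ => (x, θ)))) _
    _ = ∫⁻ θ in Set.Ioc (0 : ℝ) 1, ∫⁻ x,
          ENNReal.ofReal (wt ln b x) * ‖θ ^ b * h (dil ln θ x)‖ₑ ^ p := by
        refine lintegral_lintegral_swap (Measurable.aemeasurable ?_)
        exact (hwm.comp measurable_fst).mul (hc.measurable.enorm.pow_const p)
    _ = ∫⁻ θ in Set.Ioc (0 : ℝ) 1, ENNReal.ofReal (θ ^ (b * (p - 1) - 1)) *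
          ∫⁻ x, ENNReal.ofReal (wt ln b x) * ‖h x‖ₑ ^ p := by
        refine setLIntegral_congr_fun measurableSet_Ioc fun θ hθ => ?_
        have hθ0 : 0 < θ := hθ.1
        have e : ∀ x : Eu n, ENNReal.ofReal (wt ln b x) * ‖θ ^ b * h (dil ln θ x)‖ₑ ^ p =
            ENNReal.ofReal (θ ^ (b * p)) *
              (ENNReal.ofReal (wt ln b x) * ‖h (dil ln θ x)‖ₑ ^ p) := by
          intro x
          rw [enorm_mul, ENNReal.mul_rpow_of_nonneg _ _ hp0.le,
            Real.enorm_eq_ofReal (by positivity : (0 : ℝ) ≤ θ ^ b),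
            ENNReal.ofReal_rpow_of_nonneg (by positivity) hp0.le, ← Real.rpow_mul hθ0.le]
          ring
        simp only [e]
        rw [lintegral_const_mul' _ _ ENNReal.ofReal_ne_top,
          lintegral_wt_comp_dil hθ0 (F := fun y => ‖h y‖ₑ ^ p)
            (hh.measurable.enorm.pow_const p) hb.le, ← mul_assoc,
          ← ENNReal.ofReal_mul (by positivity), ← Real.rpow_add hθ0]
        congr 3
        ring
    _ = _ := by
        rw [lintegral_mul_const _ (by fun_prop), ← ofReal_integral_eq_lintegral_ofReal,
          ← intervalIntegral.integral_of_le zero_le_one, integral_rpow (Or.inl (by linarith))]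
        · congr 2
          simp [hpb.ne', Real.zero_rpow]
        · rw [← IntegrableOn, ← intervalIntegrable_iff_integrableOn_Ioc_of_le zero_le_one]
          exact intervalIntegral.intervalIntegrable_rpow' (by linarith)
        · filter_upwards [ae_restrict_mem measurableSet_Ioc] with θ hθ
          exact Real.rpow_nonneg hθ.1.le _

lemma IsTest.testPot_eq (hf : IsTest ln f) (hn : 1 ≤ n) (hb : 1 < b) {x : Eu n} (hx : 0 < x ln) :
    ∑ i, pd2 (testPot ln b f) i i x + b * pd (testPot ln b f) ln x / x ln = -f x := by
  have hφ := hf.contDiff_profile (b := b)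
  have hs := hf.hasCompactSupport_profile (b := b)
  have hH := contDiff_comp_sqMap (ln := ln) hφ
  have hHs := hasCompactSupport_comp_sqMap (ln := ln) hs
  have hν := hasMoments_gaussMeas (n := n) hb.le
  have hU := isFlow_besselFlow (ln := ln) hb hφ hs
  have hn' : (1 : ℝ) ≤ n := by exact_mod_cast hn
  have I1 : ∀ i, IntegrableOn (fun t =>
      avg (gaussMeas n b) (pdFst (pdFst (profile ln b f ∘ sqMap ln) i) i) t x) (Set.Ioi 0) :=
    fun i => integrableOn_avg hn hb (contDiff_pdFst (contDiff_pdFst hH i) i).continuous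
      (hasCompactSupport_pdFst (hasCompactSupport_pdFst hHs i) i) x
  have I2 : IntegrableOn (fun t =>
      avg (gaussMeas n b) (pdFst (profile ln b f ∘ sqMap ln) ln) t x) (Set.Ioi 0) :=
    integrableOn_avg hn hb (contDiff_pdFst hH ln).continuous (hasCompactSupport_pdFst hHs ln) x
  have hd : ∀ t ∈ Set.Ioi (0 : ℝ), HasDerivAt (fun s => besselFlow ln b (profile ln b f) s x)
      (∑ i, avg (gaussMeas n b) (pdFst (pdFst (profile ln b f ∘ sqMap ln) i) i) t x +
        avg (gaussMeas n b) (pdFst (profile ln b f ∘ sqMap ln) ln) t x * (b / x ln)) t := by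
    intro t ht
    refine (hU.hasDeriv t ht x).congr_deriv ?_
    rw [hU.eq t ht x hx]
    simp only [besselFlow, pd2_avg hb.le hH hHs, pd_avg hν hH hHs]
    ring
  obtain ⟨C, hC0, hC⟩ := exists_avg_le (n := n) hb.le hH.continuous hHs
  have hlim : Filter.Tendsto (fun s => besselFlow ln b (profile ln b f) s x) Filter.atTop
      (nhds 0) := by
    have h1 : Filter.Tendsto (fun s : ℝ => C * (1 + s) ^ (-(((n : ℝ) + b) / 2))) Filter.atTop
        (nhds (C * 0)) :=
      ((tendsto_rpow_neg_atTop (by linarith)).comp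
        (Filter.tendsto_atTop_add_const_left _ 1 Filter.tendsto_id)).const_mul C
    rw [mul_zero] at h1
    refine squeeze_zero_norm' ?_ h1
    filter_upwards [Filter.eventually_ge_atTop 0] with s hs'
    exact hC s hs' x
  have key := integral_Ioi_of_hasDerivAt_of_tendsto
    ((continuous_avg_time hb.le hH.continuous hHs x).continuousWithinAt) hd
    ((integrable_finsetSum _ fun i _ => I1 i).add (I2.mul_const _)) hlim
  rw [integral_add (integrable_finsetSum _ fun i _ => I1 i) (I2.mul_const _),
    integral_finsetSum _ fun i _ => I1 i, integral_mul_const] at key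
  have e0 := besselFlow_profile_zero (f := f) hb.le hx
  rw [besselFlow] at e0
  rw [e0, zero_sub] at key
  rw [← key, testPot]
  simp only [pd2_pot hn hb hH hHs, pd_pot hn hb hH hHs, pot]
  ring

lemma IsTest.pd_testPot_div (hf : IsTest ln f) (hn : 1 ≤ n) (hb : 1 < b) {x : Eu n}
    (hx : 0 < x ln) :
    pd (testPot ln b f) ln x / x ln = ∫ θ in (0 : ℝ)..1, θ ^ b *
      (-f (dil ln θ x) - ∑ i ∈ Finset.univ.erase ln, pd2 (testPot ln b f) i i (dil ln θ x)) := by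
  have hb0 : 0 < b := by linarith
  have hu := hf.contDiff_testPot_infty hn hb
  set u := testPot ln b f with hud
  have hc1 := contDiff_top_pd hu ln
  have hcd : Continuous fun θ : ℝ => dil ln θ x :=
    continuous_dil.comp (by fun_prop : Continuous fun θ : ℝ => (θ, x))
  have hcb : Continuous fun θ : ℝ => θ ^ b := Real.continuous_rpow_const hb0.le
  have hH : Continuous fun y => -f y - ∑ i ∈ Finset.univ.erase ln, pd2 u i i y :=
    hf.smooth.continuous.neg.sub (continuous_finsetSum _ fun i _ =>
      (contDiff_top_pd (contDiff_top_pd hu i) i).continuous)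
  have hd : ∀ θ ∈ Set.Ioo (0 : ℝ) 1, HasDerivAt (fun θ => θ ^ b * (pd u ln (dil ln θ x) / x ln))
      (θ ^ b * (-f (dil ln θ x) - ∑ i ∈ Finset.univ.erase ln, pd2 u i i (dil ln θ x))) θ := by
    intro θ hθ
    have hθ0 : 0 < θ := hθ.1
    have hy : 0 < dil ln θ x ln := by rw [dil_ln]; positivity
    have h1 : HasDerivAt (fun θ : ℝ => dil ln θ x) ((x ln) • EuclideanSpace.single ln (1 : ℝ)) θ := by
      have : HasDerivAt (fun θ : ℝ => (θ - 1) * x ln) (x ln) θ := by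
        simpa using ((hasDerivAt_id θ).sub_const 1).mul_const (x ln)
      exact (this.smul_const _).const_add x
    have h2 := (((hc1.differentiable (by simp)) (dil ln θ x)).hasFDerivAt).comp_hasDerivAt θ h1
    have h3 : HasDerivAt (fun θ => pd u ln (dil ln θ x)) (x ln * pd2 u ln ln (dil ln θ x)) θ := by
      refine h2.congr_deriv ?_
      rw [map_smul, smul_eq_mul]
      rfl
    refine ((Real.hasDerivAt_rpow_const (p := b) (Or.inl hθ0.ne')).mul
      (h3.div_const (x ln))).congr_deriv ?_
    have heq := hf.testPot_eq hn hb hy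
    rw [← Finset.add_sum_erase _ _ (Finset.mem_univ ln), ← hud, dil_ln] at heq
    rw [Real.rpow_sub_one hθ0.ne']
    have : -f (dil ln θ x) - ∑ i ∈ Finset.univ.erase ln, pd2 u i i (dil ln θ x) =
        pd2 u ln ln (dil ln θ x) + b * pd u ln (dil ln θ x) / (θ * x ln) := by
      rw [← heq]; ring
    rw [this]
    field_simp
    ring
  have key := intervalIntegral.integral_eq_sub_of_hasDerivAt_of_le zero_le_one
    ((hcb.mul ((hc1.continuous.comp hcd).div_const _)).continuousOn) hd
    ((hcb.mul (hH.comp hcd)).intervalIntegrable 0 1)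
  rw [key]
  simp [dil_one, Real.zero_rpow hb0.ne']

lemma eLpNorm_mub (hb : 0 < b) (hp : 0 < p) (hh : Measurable h) :
    eLpNorm h (ENNReal.ofReal p) (mub n ln b) =
      (∫⁻ x, ENNReal.ofReal (wt ln b x) * ‖h x‖ₑ ^ p) ^ (1 / p) := by
  rw [eLpNorm_eq_lintegral_rpow_enorm_toReal (by simpa using hp) ENNReal.ofReal_ne_top,
    ENNReal.toReal_ofReal hp.le, mub_eq hb,
    lintegral_withDensity_eq_lintegral_mul _
      (continuous_wt hb.le).measurable.ennreal_ofReal (hh.enorm.pow_const p)]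
  rfl

lemma ae_mub_pos : ∀ᵐ x ∂mub n ln b, 0 < x ln := by
  refine (withDensity_absolutelyContinuous _ _).ae_le ?_
  exact ae_restrict_mem
    (measurableSet_lt measurable_const (EuclideanSpace.proj ln : Eu n →L[ℝ] ℝ).measurable)

lemma pd2_comm (hh : ContDiff ℝ 2 h) (i j : Fin n) (x : Eu n) : pd2 h i j x = pd2 h j i x := by
  have hd : ∀ k, fderiv ℝ (pd h k) x =
      (ContinuousLinearMap.apply ℝ ℝ (EuclideanSpace.single k (1 : ℝ) : Eu n)).comp
        (fderiv ℝ (fderiv ℝ h) x) := fun k =>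
    ((ContinuousLinearMap.apply ℝ ℝ (EuclideanSpace.single k (1 : ℝ) : Eu n)).hasFDerivAt.comp x
      ((hh.fderiv_right (m := 1) (by norm_num)).differentiable
        (by norm_num) x).hasFDerivAt).fderiv
  have hsym := hh.contDiffAt.isSymmSndFDerivAt (x := x) (by simp)
  rw [pd2, pd2, pd, pd, hd, hd]
  exact hsym _ _

theorem exists_eLpNorm_testPot_le (hp : 1 < p) (hn : 1 ≤ n) (hb : 1 < b) :
    ∃ C : ℝ, 0 < C ∧ ∀ f : Eu n → ℝ, IsTest ln f →
      (∀ i j : Fin n, eLpNorm (pd2 (testPot ln b f) i j) (ENNReal.ofReal p) (mub n ln b) ≤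
        ENNReal.ofReal C * eLpNorm f (ENNReal.ofReal p) (mub n ln b)) ∧
      eLpNorm (fun x => pd (testPot ln b f) ln x / x ln) (ENNReal.ofReal p) (mub n ln b) ≤
        ENNReal.ofReal C * eLpNorm f (ENNReal.ofReal p) (mub n ln b) := by
  have hb0 : 0 < b := by linarith
  have hp0 : 0 < p := by linarith
  have hp1 : 1 ≤ ENNReal.ofReal p := by simpa using hp.le
  obtain ⟨K, hK, hKb⟩ := exists_lintegral_pd2_testPot_le (ln := ln) hp hn hb
  set A : ℝ≥0∞ := ENNReal.ofReal K ^ (1 / p) with hA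
  set B : ℝ≥0∞ := 1 + n * A with hB
  set D : ℝ≥0∞ := ENNReal.ofReal (b * (p - 1))⁻¹ ^ (1 / p) * B with hD
  set E : ℝ≥0∞ := A + (B + (ENNReal.ofReal b * D)) + D with hE
  have hAt : A ≠ ⊤ := ENNReal.rpow_ne_top_of_nonneg (by positivity) ENNReal.ofReal_ne_top
  have hBt : B ≠ ⊤ := ENNReal.add_ne_top.2 ⟨ENNReal.one_ne_top,
    ENNReal.mul_ne_top (ENNReal.natCast_ne_top n) hAt⟩
  have hDt : D ≠ ⊤ := ENNReal.mul_ne_top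
    (ENNReal.rpow_ne_top_of_nonneg (by positivity) ENNReal.ofReal_ne_top) hBt
  have hEt : E ≠ ⊤ := ENNReal.add_ne_top.2 ⟨ENNReal.add_ne_top.2 ⟨hAt, ENNReal.add_ne_top.2
    ⟨hBt, ENNReal.mul_ne_top ENNReal.ofReal_ne_top hDt⟩⟩, hDt⟩
  have hEC : E ≤ ENNReal.ofReal (E.toReal + 1) := by
    conv_lhs => rw [← ENNReal.ofReal_toReal hEt]
    exact ENNReal.ofReal_le_ofReal (by linarith)
  refine ⟨E.toReal + 1, by positivity, fun f hf => ?_⟩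
  have hu := hf.contDiff_testPot_infty (b := b) hn hb
  set u := testPot ln b f with hud
  set N := eLpNorm f (ENNReal.ofReal p) (mub n ln b) with hN
  have hc : ∀ i j, Continuous (pd2 u i j) := fun i j =>
    (contDiff_top_pd (contDiff_top_pd hu j) i).continuous
  have h1 : ∀ i j, i ≠ ln → eLpNorm (pd2 u i j) (ENNReal.ofReal p) (mub n ln b) ≤ A * N := by
    intro i j hi
    have e : ∀ F : Eu n → ℝ, ∀ x, ENNReal.ofReal (wt ln b x * |F x| ^ p) =
        ENNReal.ofReal (wt ln b x) * ‖F x‖ₑ ^ p := fun F x => by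
      rw [ENNReal.ofReal_mul (wt_nonneg x), ← ENNReal.ofReal_rpow_of_nonneg (abs_nonneg _) hp0.le,
        Real.enorm_eq_ofReal_abs]
    have h2 := hKb f hf i j hi
    rw [ENNReal.ofReal_mul hK.le, ofReal_integral_eq_lintegral_ofReal
      (hf.integrable_wt_rpow hb0 hp0) (Filter.Eventually.of_forall fun x =>
        mul_nonneg (wt_nonneg x) (by positivity))] at h2
    simp only [e] at h2
    rw [hN, eLpNorm_mub hb0 hp0 (hc i j).measurable,
      eLpNorm_mub hb0 hp0 hf.smooth.continuous.measurable, hA,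
      ← ENNReal.mul_rpow_of_nonneg _ _ (by positivity)]
    exact ENNReal.rpow_le_rpow h2 (by positivity)
  set w : Eu n → ℝ := fun x => -f x - ∑ i ∈ Finset.univ.erase ln, pd2 u i i x with hw
  have hwc : Continuous w :=
    hf.smooth.continuous.neg.sub (continuous_finsetSum _ fun i _ => hc i i)
  have h2 : eLpNorm w (ENNReal.ofReal p) (mub n ln b) ≤ B * N := by
    have hS : eLpNorm (∑ i ∈ Finset.univ.erase ln, pd2 u i i) (ENNReal.ofReal p) (mub n ln b) ≤
        n * A * N := by
      refine (eLpNorm_sum_le (fun i _ => (hc i i).aestronglyMeasurable) hp1).trans ?_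
      refine (Finset.sum_le_sum (g := fun _ => A * N) fun i hi =>
        h1 i i (Finset.ne_of_mem_erase hi)).trans ?_
      rw [Finset.sum_const, nsmul_eq_mul, mul_assoc]
      refine mul_le_mul_left (Nat.cast_le.2 ?_) _
      exact (Finset.card_le_univ _).trans_eq (Fintype.card_fin n)
    have : w = (-f) - ∑ i ∈ Finset.univ.erase ln, pd2 u i i := by
      funext x
      simp [hw]
    rw [this, hB, add_mul, one_mul]
    refine (eLpNorm_sub_le hf.smooth.continuous.neg.aestronglyMeasurable
      (Finset.aestronglyMeasurable_sum _ fun i _ => (hc i i).aestronglyMeasurable) hp1).trans ?_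
    rw [eLpNorm_neg]
    exact add_le_add le_rfl hS
  have hxm : Measurable fun x : Eu n => x ln :=
    (EuclideanSpace.proj ln : Eu n →L[ℝ] ℝ).measurable
  have hgm : Measurable fun x => pd u ln x / x ln :=
    (contDiff_top_pd hu ln).continuous.measurable.div hxm
  have h3 : eLpNorm (fun x => pd u ln x / x ln) (ENNReal.ofReal p) (mub n ln b) ≤ D * N := by
    refine le_trans ?_ (mul_le_mul_right h2 (ENNReal.ofReal (b * (p - 1))⁻¹ ^ (1 / p))
      |>.trans_eq (mul_assoc _ _ _).symm)
    rw [eLpNorm_mub hb0 hp0 hgm, eLpNorm_mub hb0 hp0 hwc.measurable,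
      ← ENNReal.mul_rpow_of_nonneg _ _ (by positivity)]
    exact ENNReal.rpow_le_rpow
      (lintegral_hardy hp hb0 hwc fun x hx => hf.pd_testPot_div hn hb hx) (by positivity)
  have h4 : eLpNorm (pd2 u ln ln) (ENNReal.ofReal p) (mub n ln b) ≤
      (B + ENNReal.ofReal b * D) * N := by
    have hae : pd2 u ln ln =ᵐ[mub n ln b] w - b • fun x => pd u ln x / x ln := by
      filter_upwards [ae_mub_pos] with x hx
      have heq := hf.testPot_eq hn hb hx
      rw [← Finset.add_sum_erase _ _ (Finset.mem_univ ln), ← hud] at heq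
      simp only [Pi.sub_apply, Pi.smul_apply, smul_eq_mul, hw, ← heq]
      ring
    rw [eLpNorm_congr_ae hae, add_mul]
    refine (eLpNorm_sub_le hwc.aestronglyMeasurable
      (hgm.const_smul b).aestronglyMeasurable hp1).trans (add_le_add h2 ?_)
    rw [eLpNorm_const_smul, Real.enorm_eq_ofReal hb0.le, mul_assoc]
    exact mul_le_mul_right h3 _
  have hAE : A ≤ E := by rw [hE, add_assoc]; exact le_self_add
  have hDE : D ≤ E := by rw [hE]; exact le_add_self
  have hBE : B + ENNReal.ofReal b * D ≤ E := by
    rw [hE]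
    exact le_add_self.trans le_self_add
  refine ⟨fun i j => ?_, h3.trans (mul_le_mul_left (hDE.trans hEC) _)⟩
  by_cases hi : i = ln
  · by_cases hj : j = ln
    · subst hi hj
      exact h4.trans (mul_le_mul_left (hBE.trans hEC) _)
    · have : pd2 u i j = pd2 u j i := funext fun x => pd2_comm (contDiff_infty.1 hu 2) i j x
      rw [this]
      exact (h1 j i hj).trans (mul_le_mul_left (hAE.trans hEC) _)
  · exact (h1 i j hi).trans (mul_le_mul_left (hAE.trans hEC) _)

end Hardy

section Polar

variable {n : ℕ} {ln : Fin n} {b : ℝ}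

lemma exists_fiber (ln : Fin n) : ∃ m : ℕ, ∃ J : (Fin m → ℝ) × ℝ → Eu n, Measurable J ∧
    (∀ y s, J (y, s) ln = s) ∧
    (∀ y s s', J (y, s) = J (y, s') + (s - s') • EuclideanSpace.single ln (1 : ℝ)) ∧
    ∀ F : Eu n → ℝ≥0∞, Measurable F → ∫⁻ x, F x = ∫⁻ y, ∫⁻ s, F (J (y, s)) := by
  obtain ⟨m, rfl⟩ : ∃ m, n = m + 1 := ⟨n - 1, by have := ln.pos; omega⟩
  have h1 := (volume_preserving_piFinSuccAbove (fun _ : Fin (m + 1) => ℝ) ln).symm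
  have h2 := PiLp.volume_preserving_toLp (Fin (m + 1))
  have h3 := (h2.comp h1).comp
    (Measure.measurePreserving_swap (μ := (volume : Measure (Fin m → ℝ))) (ν := (volume : Measure ℝ)))
  have hap : ∀ y s i, (WithLp.toLp 2 ((MeasurableEquiv.piFinSuccAbove (fun _ : Fin (m + 1) => ℝ)
      ln).symm (Prod.swap (y, s))) : Eu (m + 1)) i =
      Fin.insertNth (α := fun _ => ℝ) ln s y i := fun y s i => rfl
  refine ⟨m, _, h3.measurable, fun y s => ?_, fun y s s' => ?_, fun F hF => ?_⟩
  · exact (hap y s ln).trans (Fin.insertNth_apply_same _ _ _)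
  · ext i
    rw [PiLp.add_apply, PiLp.smul_apply]
    refine (hap y s i).trans ?_
    refine Eq.trans ?_ (congrArg (· + _) (hap y s' i).symm)
    refine Fin.succAboveCases ln ?_ (fun j => ?_) i
    · simp
    · simp
  · rw [← h3.lintegral_comp hF]
    exact lintegral_prod _ (hF.comp h3.measurable).aemeasurable

lemma lintegral_polar_max (hb : 1 < b) {Ψ : ℝ × ℝ → ℝ≥0∞} (hΨ : Measurable Ψ) :
    ∫⁻ s, ∫⁻ q, Ψ (s, q) * ENNReal.ofReal (max q 0 ^ (b - 1)) =
      ∫⁻ r, ENNReal.ofReal (max r 0 ^ b) * ∫⁻ θ in Set.Ioo 0 Real.pi,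
        ENNReal.ofReal (Real.sin θ ^ (b - 1)) * Ψ (r * Real.cos θ, r * Real.sin θ) := by
  have hb0 : 0 < b := by linarith
  have hm : Measurable fun z : ℝ × ℝ => Ψ z * ENNReal.ofReal (max z.2 0 ^ (b - 1)) :=
    hΨ.mul (by fun_prop)
  have hm' : Measurable fun z : ℝ × ℝ => ENNReal.ofReal z.1 *
      (Ψ (z.1 * Real.cos z.2, z.1 * Real.sin z.2) *
        ENNReal.ofReal (max (z.1 * Real.sin z.2) 0 ^ (b - 1))) :=
    Measurable.mul (by fun_prop) (hm.comp (by fun_prop :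
      Measurable fun z : ℝ × ℝ => (z.1 * Real.cos z.2, z.1 * Real.sin z.2)))
  have e1 := lintegral_prod (μ := (volume : Measure ℝ)) (ν := (volume : Measure ℝ))
    (fun z : ℝ × ℝ => Ψ z * ENNReal.ofReal (max z.2 0 ^ (b - 1))) hm.aemeasurable
  rw [← Measure.volume_eq_prod, ← lintegral_comp_polarCoord_symm, polarCoord_target,
    Measure.volume_eq_prod, ← Measure.prod_restrict] at e1
  simp only [polarCoord_symm_apply, smul_eq_mul] at e1
  rw [lintegral_prod _ hm'.aemeasurable] at e1
  rw [← e1, ← lintegral_indicator measurableSet_Ioi]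
  refine lintegral_congr fun r => ?_
  by_cases hr : 0 < r
  · rw [Set.indicator_of_mem (Set.mem_Ioi.2 hr), max_eq_left hr.le]
    have e2 : Set.Ioo 0 Real.pi = Set.Ioi 0 ∩ Set.Ioo (-Real.pi) Real.pi := by
      ext θ
      have := Real.pi_pos
      simp only [Set.mem_Ioo, Set.mem_inter_iff, Set.mem_Ioi]
      constructor
      · rintro ⟨h1, h2⟩; exact ⟨h1, by linarith, h2⟩
      · rintro ⟨h1, h2, h3⟩; exact ⟨h1, h3⟩
    rw [e2, ← Measure.restrict_restrict measurableSet_Ioi, ← lintegral_indicator measurableSet_Ioi,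
      ← lintegral_const_mul' _ _ ENNReal.ofReal_ne_top]
    refine setLIntegral_congr_fun measurableSet_Ioo fun θ hθ => ?_
    by_cases hθ0 : 0 < θ
    · have hs : 0 < Real.sin θ := Real.sin_pos_of_pos_of_lt_pi hθ0 hθ.2
      simp only [Set.indicator_of_mem (Set.mem_Ioi.2 hθ0)]
      rw [max_eq_left (by positivity), Real.mul_rpow hr.le hs.le,
        ENNReal.ofReal_mul (by positivity)]
      have : ENNReal.ofReal (r ^ b) = ENNReal.ofReal r * ENNReal.ofReal (r ^ (b - 1)) := by
        rw [← ENNReal.ofReal_mul hr.le, ← Real.rpow_one_add' hr.le (by linarith)]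
        congr 2
        ring
      rw [this]
      ring
    · have hs : Real.sin θ ≤ 0 := Real.sin_nonpos_of_nonpos_of_neg_pi_le (not_lt.1 hθ0) hθ.1.le
      simp only [Set.indicator_of_notMem (fun h : θ ∈ Set.Ioi 0 => hθ0 h)]
      rw [max_eq_right (mul_nonpos_of_nonneg_of_nonpos hr.le hs), Real.zero_rpow (by linarith)]
      simp
  · rw [Set.indicator_of_notMem (fun h : r ∈ Set.Ioi 0 => hr h), max_eq_right (not_lt.1 hr),
      Real.zero_rpow hb0.ne']
    simp

/-- Polar coordinates in the plane spanned by the normal direction and the extra variable. -/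
lemma lintegral_prod_polar (hb : 1 < b) {Ψ : Eu n × ℝ → ℝ≥0∞} (hΨ : Measurable Ψ) :
    ∫⁻ v, Ψ v * ENNReal.ofReal (max v.2 0 ^ (b - 1)) =
      ∫⁻ x, ENNReal.ofReal (wt ln b x) * ∫⁻ θ in Set.Ioo 0 Real.pi,
        ENNReal.ofReal (Real.sin θ ^ (b - 1)) *
          Ψ (x + (x ln * Real.cos θ - x ln) • EuclideanSpace.single ln 1, x ln * Real.sin θ) := by
  have hb0 : 0 < b := by linarith
  obtain ⟨m, J, hJm, hJ1, hJ2, hJ3⟩ := exists_fiber ln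
  have hxm : Measurable fun x : Eu n => x ln :=
    (EuclideanSpace.proj ln : Eu n →L[ℝ] ℝ).measurable
  have hm1 : Measurable fun v : Eu n × ℝ => Ψ v * ENNReal.ofReal (max v.2 0 ^ (b - 1)) :=
    hΨ.mul (by fun_prop)
  have hm2 : Measurable fun z : Eu n × ℝ => ENNReal.ofReal (Real.sin z.2 ^ (b - 1)) *
      Ψ (z.1 + (z.1 ln * Real.cos z.2 - z.1 ln) • EuclideanSpace.single ln 1,
        z.1 ln * Real.sin z.2) := by
    have : Measurable fun z : Eu n × ℝ => z.1 ln := hxm.comp measurable_fst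
    refine Measurable.mul (by fun_prop) (hΨ.comp ?_)
    fun_prop
  rw [Measure.volume_eq_prod, lintegral_prod _ hm1.aemeasurable, hJ3 _ hm1.lintegral_prod_right']
  refine Eq.trans ?_ (hJ3 _ ((continuous_wt (ln := ln) hb0.le).measurable.ennreal_ofReal.mul
    (hm2.lintegral_prod_right' (ν := volume.restrict (Set.Ioo 0 Real.pi))))).symm
  refine lintegral_congr fun y => ?_
  rw [lintegral_polar_max hb (Ψ := fun z => Ψ (J (y, z.1), z.2))
    (hΨ.comp ((hJm.comp (by fun_prop)).prodMk measurable_snd))]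
  refine lintegral_congr fun r => ?_
  rw [Pi.mul_apply, wt, hJ1]
  congr 1
  refine lintegral_congr fun θ => ?_
  simp only [hJ1]
  rw [← hJ2 y (r * Real.cos θ) r]

end Polar

section Fold

variable {n : ℕ} {ln : Fin n} {b : ℝ}

/-- Replace the normal coordinate `x_n` of `(x, q)` by `√(x_n² + q²)`. -/
def foldMap (ln : Fin n) (v : Eu n × ℝ) : Eu n :=
  v.1 + (√(v.1 ln ^ 2 + v.2 ^ 2) - v.1 ln) • EuclideanSpace.single ln (1 : ℝ)

lemma continuous_foldMap : Continuous (foldMap ln) := by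
  have : Continuous fun v : Eu n × ℝ => v.1 ln :=
    (EuclideanSpace.proj ln : Eu n →L[ℝ] ℝ).continuous.comp continuous_fst
  unfold foldMap
  fun_prop

lemma foldMap_polar {x : Eu n} (hx : 0 < x ln) (θ : ℝ) :
    foldMap ln (x + (x ln * Real.cos θ - x ln) • EuclideanSpace.single ln 1, x ln * Real.sin θ) =
      x := by
  have e : (x + (x ln * Real.cos θ - x ln) • EuclideanSpace.single ln (1 : ℝ)) ln =
      x ln * Real.cos θ := by simp
  have e2 : (x ln * Real.cos θ) ^ 2 + (x ln * Real.sin θ) ^ 2 = x ln ^ 2 := by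
    linear_combination x ln ^ 2 * Real.sin_sq_add_cos_sq θ
  simp only [foldMap, e, e2, Real.sqrt_sq hx.le]
  rw [add_assoc, ← add_smul, sub_add_sub_cancel, sub_self, zero_smul, add_zero]

lemma norm_sq_add_smul_single (z : Eu n) (c : ℝ) :
    ‖z + c • EuclideanSpace.single ln (1 : ℝ)‖ ^ 2 = ‖z‖ ^ 2 + 2 * c * z ln + c ^ 2 := by
  rw [norm_add_sq_real, inner_smul_right, EuclideanSpace.inner_single_right, norm_smul,
    PiLp.norm_single]
  simp
  ring

lemma norm_sq_polar (x y : Eu n) (θ : ℝ) :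
    ‖(y + (y ln * Real.cos θ - y ln) • EuclideanSpace.single ln (1 : ℝ)) - x‖ ^ 2 +
      (y ln * Real.sin θ) ^ 2 = ‖x - y‖ ^ 2 + 2 * (x ln * y ln) * (1 - Real.cos θ) := by
  rw [add_sub_right_comm, norm_sq_add_smul_single, norm_sub_rev x y, PiLp.sub_apply]
  linear_combination y ln ^ 2 * Real.sin_sq_add_cos_sq θ

lemma lintegral_fold_kernel (hb : 1 < b) {G : Eu n → ℝ≥0∞} (hG : Measurable G) {R : ℝ → ℝ≥0∞}
    (hR : Measurable R) (x : Eu n) :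
    ∫⁻ v : Eu n × ℝ, G (foldMap ln v) * R (‖v.1 - x‖ ^ 2 + v.2 ^ 2) *
        ENNReal.ofReal (max v.2 0 ^ (b - 1)) =
      ∫⁻ y, ENNReal.ofReal (wt ln b y) * (G y * ∫⁻ θ in Set.Ioo 0 Real.pi,
        ENNReal.ofReal (Real.sin θ ^ (b - 1)) *
          R (‖x - y‖ ^ 2 + 2 * (x ln * y ln) * (1 - Real.cos θ))) := by
  have hm : Measurable fun v : Eu n × ℝ => G (foldMap ln v) * R (‖v.1 - x‖ ^ 2 + v.2 ^ 2) :=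
    (hG.comp continuous_foldMap.measurable).mul (hR.comp (by fun_prop))
  rw [lintegral_prod_polar (ln := ln) hb hm]
  refine lintegral_congr fun y => ?_
  rcases le_or_gt (y ln) 0 with hy | hy
  · simp [wt_of_nonpos (by linarith : 0 < b) hy]
  · congr 1
    rw [← lintegral_const_mul]
    · refine lintegral_congr fun θ => ?_
      rw [foldMap_polar hy, norm_sq_polar]
      ring
    · exact Measurable.mul (by fun_prop) (hR.comp (by fun_prop))

lemma lintegral_fold (hb : 1 < b) {G : Eu n → ℝ≥0∞} (hG : Measurable G) :
    ∫⁻ v : Eu n × ℝ, G (foldMap ln v) * ENNReal.ofReal (max v.2 0 ^ (b - 1)) ≤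
      ENNReal.ofReal Real.pi * ∫⁻ y, ENNReal.ofReal (wt ln b y) * G y := by
  have := lintegral_fold_kernel (ln := ln) hb hG (R := fun _ => 1) measurable_const 0
  simp only [mul_one] at this
  rw [this, ← lintegral_const_mul' _ _ ENNReal.ofReal_ne_top]
  refine lintegral_mono fun y => ?_
  have h1 : ∫⁻ θ in Set.Ioo 0 Real.pi, ENNReal.ofReal (Real.sin θ ^ (b - 1)) ≤
      ENNReal.ofReal Real.pi := by
    calc _ ≤ ∫⁻ θ in Set.Ioo 0 Real.pi, 1 := by
          refine setLIntegral_mono measurable_const fun θ hθ => ?_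
          rw [← ENNReal.ofReal_one]
          exact ENNReal.ofReal_le_ofReal (Real.rpow_le_one
            (Real.sin_pos_of_pos_of_lt_pi hθ.1 hθ.2).le (Real.sin_le_one _) (by linarith))
      _ = _ := by simp
  calc _ ≤ ENNReal.ofReal (wt ln b y) * (G y * ENNReal.ofReal Real.pi) := by gcongr
    _ = _ := by ring

lemma lintegral_sin_eq (hb : 1 < b) (R : ℝ → ℝ≥0∞) :
    ∫⁻ θ in Set.Ioo 0 Real.pi, ENNReal.ofReal (Real.sin θ ^ (b - 1)) * R ((1 - Real.cos θ) / 2) =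
      ENNReal.ofReal (2 ^ (b - 1)) *
        ∫⁻ τ in Set.Ioo (0 : ℝ) 1, ENNReal.ofReal ((τ * (1 - τ)) ^ (b / 2 - 1)) * R τ := by
  have him : (fun θ : ℝ => (1 - Real.cos θ) / 2) '' Set.Ioo 0 Real.pi = Set.Ioo (0 : ℝ) 1 := by
    ext τ
    constructor
    · rintro ⟨θ, hθ, rfl⟩
      have h1 : Real.cos θ < 1 := by
        rw [← Real.cos_zero]
        exact Real.cos_lt_cos_of_nonneg_of_le_pi le_rfl hθ.2.le hθ.1
      have h2 : -1 < Real.cos θ := by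
        rw [← Real.cos_pi]
        exact Real.cos_lt_cos_of_nonneg_of_le_pi hθ.1.le le_rfl hθ.2
      exact ⟨by simp only; linarith, by simp only; linarith⟩
    · rintro ⟨h1, h2⟩
      refine ⟨Real.arccos (1 - 2 * τ), ⟨Real.arccos_pos.2 (by linarith), ?_⟩, ?_⟩
      · exact lt_of_le_of_ne (Real.arccos_le_pi _) fun h => by
          rw [Real.arccos_eq_pi] at h; linarith
      · simp only
        rw [Real.cos_arccos (by linarith) (by linarith)]
        ring
  have hinj : Set.InjOn (fun θ : ℝ => (1 - Real.cos θ) / 2) (Set.Ioo 0 Real.pi) := by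
    intro x hx y hy hxy
    simp only at hxy
    exact Real.injOn_cos ⟨hx.1.le, hx.2.le⟩ ⟨hy.1.le, hy.2.le⟩ (by linarith)
  have hd : ∀ θ ∈ Set.Ioo 0 Real.pi, HasDerivWithinAt (fun θ : ℝ => (1 - Real.cos θ) / 2)
      (Real.sin θ / 2) (Set.Ioo 0 Real.pi) θ := fun θ _ => by
    simpa using (((Real.hasDerivAt_cos θ).const_sub 1).div_const 2).hasDerivWithinAt
  rw [← him, lintegral_image_eq_lintegral_abs_deriv_mul measurableSet_Ioo hd hinj,
    ← lintegral_const_mul' _ _ ENNReal.ofReal_ne_top]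
  refine setLIntegral_congr_fun measurableSet_Ioo fun θ hθ => ?_
  have hs : 0 < Real.sin θ := Real.sin_pos_of_pos_of_lt_pi hθ.1 hθ.2
  rw [abs_of_pos (by positivity), ← mul_assoc, ← mul_assoc, ← ENNReal.ofReal_mul (by positivity),
    ← ENNReal.ofReal_mul (by positivity)]
  congr 2
  have e1 : (1 - Real.cos θ) / 2 * (1 - (1 - Real.cos θ) / 2) = (Real.sin θ / 2) ^ (2 : ℝ) := by
    rw [Real.rpow_two]
    linear_combination -(Real.sin_sq_add_cos_sq θ) / 4
  rw [e1, ← Real.rpow_mul (by positivity), mul_assoc, ← Real.rpow_one_add' (by positivity)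
    (by linarith), show 1 + 2 * (b / 2 - 1) = b - 1 by ring,
    ← Real.mul_rpow (by norm_num) (by positivity)]
  congr 1
  ring

lemma lintegral_heat {A d : ℝ} (hA : 0 < A) (hd : 1 < d) :
    ∫⁻ t in Set.Ioi (0 : ℝ), ENNReal.ofReal (t ^ (-d) * Real.exp (-A / (4 * t))) =
      ENNReal.ofReal (4 ^ (d - 1) * Real.Gamma (d - 1) * A ^ (-(d - 1))) := by
  have hpos : 0 < (4 : ℝ) ^ (d - 1) * Real.Gamma (d - 1) * A ^ (-(d - 1)) := by
    have := Real.Gamma_pos_of_pos (by linarith : 0 < d - 1)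
    positivity
  have h1 := Real.integral_rpow_mul_exp_neg_mul_Ioi (a := d - 1) (r := A / 4) (by linarith)
    (by linarith)
  have h2 := integral_comp_rpow_Ioi (fun s : ℝ => s ^ (d - 1 - 1) * Real.exp (-(A / 4 * s)))
    (p := -1) (by norm_num)
  have e : ∫ t in Set.Ioi (0 : ℝ), t ^ (-d) * Real.exp (-A / (4 * t)) =
      4 ^ (d - 1) * Real.Gamma (d - 1) * A ^ (-(d - 1)) := by
    rw [h1] at h2
    rw [show (4 : ℝ) ^ (d - 1) * Real.Gamma (d - 1) * A ^ (-(d - 1)) =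
      (1 / (A / 4)) ^ (d - 1) * Real.Gamma (d - 1) from ?_, ← h2]
    · refine setIntegral_congr_fun measurableSet_Ioi fun t ht => ?_
      have ht0 : (0 : ℝ) < t := ht
      simp only [smul_eq_mul, abs_neg, abs_one, one_mul]
      rw [← mul_assoc, ← Real.rpow_mul ht0.le, ← Real.rpow_add ht0, Real.rpow_neg_one]
      congr 2
      · ring
      · field_simp
    · rw [one_div_div, Real.div_rpow (by norm_num) hA.le, Real.rpow_neg hA.le]
      ring
  rw [← e, ofReal_integral_eq_lintegral_ofReal]
  · by_contra hni
    rw [integral_undef hni] at e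
    exact hpos.ne e
  · filter_upwards [ae_restrict_mem measurableSet_Ioi] with t ht
    have ht0 : (0 : ℝ) < t := ht
    positivity

/-- The integral in the Green function. -/
def kern (ln : Fin n) (b : ℝ) (x y : Eu n) : ℝ≥0∞ :=
  ∫⁻ τ in Set.Ioo (0 : ℝ) 1, ENNReal.ofReal ((‖x - y‖ ^ 2 + 4 * (x ln * y ln) * τ) ^
    (-(((n : ℝ) + b) / 2 - 1)) * (τ * (1 - τ)) ^ (b / 2 - 1))

/-- The constant relating `kern` to the time integral of the heat kernel. -/
def kernConst (n : ℕ) (b : ℝ) : ℝ :=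
  2 ^ (b - 1) * (4 ^ (((n : ℝ) + b) / 2 - 1) * Real.Gamma (((n : ℝ) + b) / 2 - 1))

lemma kernConst_pos (hn : 1 ≤ n) (hb : 1 < b) : 0 < kernConst n b := by
  have hn' : (1 : ℝ) ≤ n := by exact_mod_cast hn
  have := Real.Gamma_pos_of_pos (by linarith : 0 < ((n : ℝ) + b) / 2 - 1)
  unfold kernConst
  positivity

lemma lintegral_avg_fold (hn : 1 ≤ n) (hb : 1 < b) {G : Eu n → ℝ≥0∞} (hG : Measurable G)
    {x : Eu n} (hx : 0 < x ln) :
    ∫⁻ t in Set.Ioi (0 : ℝ), ∫⁻ w, G (foldMap ln (spread t x w)) * ENNReal.ofReal (gw b w) =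
      ENNReal.ofReal (kernConst n b) *
        ∫⁻ y, ENNReal.ofReal (wt ln b y) * (G y * kern ln b x y) := by
  have hn' : (1 : ℝ) ≤ n := by exact_mod_cast hn
  set d : ℝ := ((n : ℝ) + b) / 2 with hd
  have hd1 : 1 < d := by linarith
  set R : ℝ → ℝ≥0∞ := fun A => ∫⁻ t in Set.Ioi (0 : ℝ),
    ENNReal.ofReal (t ^ (-d) * Real.exp (-A / (4 * t))) with hRd
  have hRm : Measurable fun z : ℝ × ℝ =>
      ENNReal.ofReal (z.2 ^ (-d) * Real.exp (-z.1 / (4 * z.2))) := by fun_prop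
  have hR : Measurable R := hRm.lintegral_prod_right' (ν := volume.restrict (Set.Ioi 0))
  have e1 : ∫⁻ t in Set.Ioi (0 : ℝ), ∫⁻ w, G (foldMap ln (spread t x w)) * ENNReal.ofReal (gw b w) =
      ∫⁻ t in Set.Ioi (0 : ℝ), ∫⁻ v : Eu n × ℝ, G (foldMap ln v) *
        ENNReal.ofReal (t ^ (-d) * Real.exp (-(‖v.1 - x‖ ^ 2 + v.2 ^ 2) / (4 * t))) *
          ENNReal.ofReal (max v.2 0 ^ (b - 1)) := by
    refine setLIntegral_congr_fun measurableSet_Ioi fun t ht => ?_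
    have ht0 : (0 : ℝ) < t := ht
    have hm : Measurable fun v : Eu n × ℝ => G (foldMap ln v) *
        ENNReal.ofReal (Real.exp (-(‖v.1 - x‖ ^ 2 + v.2 ^ 2) / (4 * t))) :=
      (hG.comp continuous_foldMap.measurable).mul (by fun_prop)
    have h1 := lintegral_spread_mul_rpow (b := b) hm ht0 x
    rw [← lintegral_const_mul' _ _ ENNReal.ofReal_ne_top] at h1
    refine Eq.trans (lintegral_congr fun w => ?_) (h1.trans (lintegral_congr fun v => ?_))
    · rw [gw, ENNReal.ofReal_mul (Real.exp_nonneg _), mul_assoc]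
      congr 4
      have hst := Real.sq_sqrt ht0.le
      rw [spread, add_sub_cancel_left, norm_smul, mul_pow, mul_pow, Real.norm_eq_abs, sq_abs, hst]
      field_simp
    · rw [ENNReal.ofReal_mul (by positivity)]
      ring
  rw [e1, lintegral_lintegral_swap]
  · have e2 : ∀ v : Eu n × ℝ, ∫⁻ t in Set.Ioi (0 : ℝ), G (foldMap ln v) *
        ENNReal.ofReal (t ^ (-d) * Real.exp (-(‖v.1 - x‖ ^ 2 + v.2 ^ 2) / (4 * t))) *
          ENNReal.ofReal (max v.2 0 ^ (b - 1)) =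
        G (foldMap ln v) * R (‖v.1 - x‖ ^ 2 + v.2 ^ 2) * ENNReal.ofReal (max v.2 0 ^ (b - 1)) := by
      intro v
      rw [lintegral_mul_const _ (by fun_prop), lintegral_const_mul _ (by fun_prop)]
    simp only [e2]
    rw [lintegral_fold_kernel hb hG hR, ← lintegral_const_mul' _ _ ENNReal.ofReal_ne_top]
    refine lintegral_congr fun y => ?_
    rcases le_or_gt (y ln) 0 with hy | hy
    · simp [wt_of_nonpos (by linarith : 0 < b) hy]
    · have h3 := lintegral_sin_eq hb fun τ => R (‖x - y‖ ^ 2 + 4 * (x ln * y ln) * τ)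
      have h4 : ∀ θ, ‖x - y‖ ^ 2 + 4 * (x ln * y ln) * ((1 - Real.cos θ) / 2) =
          ‖x - y‖ ^ 2 + 2 * (x ln * y ln) * (1 - Real.cos θ) := fun θ => by ring
      simp only [h4] at h3
      have h5 : ∫⁻ τ in Set.Ioo (0 : ℝ) 1, ENNReal.ofReal ((τ * (1 - τ)) ^ (b / 2 - 1)) *
          R (‖x - y‖ ^ 2 + 4 * (x ln * y ln) * τ) =
          ENNReal.ofReal (4 ^ (d - 1) * Real.Gamma (d - 1)) * kern ln b x y := by
        rw [kern, ← lintegral_const_mul' _ _ ENNReal.ofReal_ne_top]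
        refine setLIntegral_congr_fun measurableSet_Ioo fun τ hτ => ?_
        have hτ0 : 0 < τ := hτ.1
        have hτ1 : 0 < 1 - τ := by linarith [hτ.2]
        have hG0 := Real.Gamma_pos_of_pos (by linarith : 0 < d - 1)
        simp only [hRd]
        rw [lintegral_heat (by positivity) hd1, ← ENNReal.ofReal_mul (by positivity),
          ← ENNReal.ofReal_mul (by positivity)]
        congr 1
        ring
      rw [h3, h5, show kernConst n b = 2 ^ (b - 1) * (4 ^ (d - 1) * Real.Gamma (d - 1)) from rfl,
        ENNReal.ofReal_mul (p := 2 ^ (b - 1)) (by positivity)]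
      ring
  · refine Measurable.aemeasurable ?_
    have h6 : Measurable fun z : ℝ × (Eu n × ℝ) => G (foldMap ln z.2) :=
      hG.comp (continuous_foldMap.measurable.comp measurable_snd)
    simp only [Function.uncurry_def]
    exact (h6.mul (by fun_prop)).mul (by fun_prop)

end Fold

section HeatMeasure

open Filter Topology

variable {n : ℕ} {ln : Fin n} {b a : ℝ}

/-- Time-space measure `dt ⊗ gaussMeas` on `(0, ∞) × (ℝⁿ × ℝ)`. -/
def heatMeas (n : ℕ) (b : ℝ) : Measure (ℝ × (Eu n × ℝ)) :=
  (volume.restrict (Set.Ioi 0)).prod (gaussMeas n b)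

/-- The space-time average of `f ∘ foldMap` with weight `t ^ (-a) * ℓ w`. -/
def foldInt (ln : Fin n) (b a : ℝ) (ℓ : Eu n × ℝ → ℝ) (f : Eu n → ℝ) (x : Eu n) : ℝ :=
  ∫ z, z.1 ^ (-a) * ℓ z.2 * f (foldMap ln (spread z.1 x z.2)) ∂heatMeas n b

/-- Majorant of the space-time averages with weight at most `t ^ (-a) * (1 + ‖w.1‖)`. -/
def foldBound (ln : Fin n) (b a : ℝ) (G : Eu n → ℝ≥0∞) (x : Eu n) : ℝ≥0∞ :=
  ∫⁻ t in Set.Ioi (0 : ℝ), ENNReal.ofReal (t ^ (-a)) *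
    ∫⁻ w, G (foldMap ln (spread t x w)) * ENNReal.ofReal ((1 + ‖w.1‖) * gw b w)

lemma continuous_foldMap_spread (x : Eu n) :
    Continuous fun z : ℝ × (Eu n × ℝ) => foldMap ln (spread z.1 x z.2) :=
  continuous_foldMap.comp (continuous_spread.comp
    (by fun_prop : Continuous fun z : ℝ × (Eu n × ℝ) => ((z.1, x), z.2)))

lemma one_add_mul_gw_le (w : Eu n × ℝ) : (1 + ‖w.1‖) * gw b w ≤ 3 * max w.2 0 ^ (b - 1) := by
  have h1 : (1 + ‖w.1‖) * Real.exp (-(‖w.1‖ ^ 2 + w.2 ^ 2) / 4) ≤ 3 := by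
    calc _ ≤ Real.exp ‖w.1‖ * Real.exp (-(‖w.1‖ ^ 2 + w.2 ^ 2) / 4) := by
          gcongr
          linarith [Real.add_one_le_exp ‖w.1‖]
      _ ≤ Real.exp 1 := by
          rw [← Real.exp_add]
          gcongr
          nlinarith [sq_nonneg (‖w.1‖ - 2), sq_nonneg w.2]
      _ ≤ 3 := by linarith [Real.exp_one_lt_d9]
  rw [gw, ← mul_assoc]
  gcongr

lemma lintegral_one_add_mul_gw_ne_top (hb : 1 ≤ b) :
    ∫⁻ w : Eu n × ℝ, ENNReal.ofReal ((1 + ‖w.1‖) * gw b w) ≠ ∞ := by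
  have h := integrable_mul_gw (n := n) hb (G := fun w => 1 + ‖w.1‖) (by fun_prop) (C := 1) (N := 1)
    fun w => by
      rw [abs_of_nonneg (by positivity), one_mul, pow_one]
      gcongr
      exact norm_fst_le w
  exact h.lintegral_lt_top.ne

lemma lintegral_spread_fold_le (hb : 1 < b) {G : Eu n → ℝ≥0∞} (hG : Measurable G) {t : ℝ}
    (ht : 0 < t) (x : Eu n) :
    ∫⁻ w, G (foldMap ln (spread t x w)) * ENNReal.ofReal ((1 + ‖w.1‖) * gw b w) ≤
      ENNReal.ofReal (3 * Real.pi * t ^ (-(((n : ℝ) + b) / 2))) *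
        ∫⁻ y, ENNReal.ofReal (wt ln b y) * G y := by
  have hm : Measurable fun v => G (foldMap ln v) := hG.comp continuous_foldMap.measurable
  calc _ ≤ ∫⁻ w : Eu n × ℝ, ENNReal.ofReal 3 *
        (G (foldMap ln (spread t x w)) * ENNReal.ofReal (max w.2 0 ^ (b - 1))) := by
        refine lintegral_mono fun w => ?_
        calc _ ≤ G (foldMap ln (spread t x w)) * ENNReal.ofReal (3 * max w.2 0 ^ (b - 1)) := by
              exact mul_le_mul_right (ENNReal.ofReal_le_ofReal (one_add_mul_gw_le w)) _
          _ = _ := by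
              rw [ENNReal.ofReal_mul (by norm_num)]
              ring
    _ = ENNReal.ofReal 3 * (ENNReal.ofReal (t ^ (-(((n : ℝ) + b) / 2))) *
        ∫⁻ v, G (foldMap ln v) * ENNReal.ofReal (max v.2 0 ^ (b - 1))) := by
        rw [lintegral_const_mul' _ _ ENNReal.ofReal_ne_top, lintegral_spread_mul_rpow hm ht x]
    _ ≤ ENNReal.ofReal 3 * (ENNReal.ofReal (t ^ (-(((n : ℝ) + b) / 2))) *
        (ENNReal.ofReal Real.pi * ∫⁻ y, ENNReal.ofReal (wt ln b y) * G y)) := by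
        gcongr
        exact lintegral_fold hb hG
    _ = _ := by
        rw [ENNReal.ofReal_mul (by positivity), ENNReal.ofReal_mul (by positivity)]
        ring

lemma foldBound_le (hb : 1 < b) (ha : a < 1) {G : Eu n → ℝ≥0∞}
    (hG : Measurable G) {M : ℝ≥0∞} (hM : ∀ y, G y ≤ M) {δ : ℝ} (hδ : 0 < δ) (x : Eu n) :
    foldBound ln b a G x ≤
      ENNReal.ofReal (δ ^ (1 - a) / (1 - a)) *
          (M * ∫⁻ w : Eu n × ℝ, ENNReal.ofReal ((1 + ‖w.1‖) * gw b w)) +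
        (ENNReal.ofReal (3 * Real.pi) * ∫⁻ t in Set.Ioi δ,
          ENNReal.ofReal (t ^ (-a - ((n : ℝ) + b) / 2))) *
            ∫⁻ y, ENNReal.ofReal (wt ln b y) * G y := by
  rw [foldBound, ← Set.Ioc_union_Ioi_eq_Ioi hδ.le]
  refine (lintegral_union_le _ _ _).trans (add_le_add ?_ ?_)
  · have e : ∫⁻ t in Set.Ioc 0 δ, ENNReal.ofReal (t ^ (-a)) =
        ENNReal.ofReal (δ ^ (1 - a) / (1 - a)) := by
      have h1 : IntervalIntegrable (fun t : ℝ => t ^ (-a)) volume 0 δ :=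
        intervalIntegral.intervalIntegrable_rpow' (by linarith)
      rw [← ofReal_integral_eq_lintegral_ofReal
        ((intervalIntegrable_iff_integrableOn_Ioc_of_le hδ.le).1 h1),
        ← intervalIntegral.integral_of_le hδ.le, integral_rpow (Or.inl (by linarith)),
        Real.zero_rpow (by linarith)]
      · congr 1
        ring_nf
      · filter_upwards [ae_restrict_mem measurableSet_Ioc] with t ht
        exact Real.rpow_nonneg ht.1.le _
    rw [← e, ← lintegral_mul_const _ (by fun_prop)]
    refine lintegral_mono fun t => ?_
    gcongr
    rw [← lintegral_const_mul _ (by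
      exact (Continuous.mul (by fun_prop) (continuous_gw hb.le)).measurable.ennreal_ofReal)]
    gcongr
    exact hM _
  · rw [← lintegral_const_mul' _ _ ENNReal.ofReal_ne_top, ← lintegral_mul_const _ (by fun_prop)]
    refine setLIntegral_mono' measurableSet_Ioi fun t ht => ?_
    have ht0 : 0 < t := hδ.trans ht
    calc _ ≤ ENNReal.ofReal (t ^ (-a)) *
          (ENNReal.ofReal (3 * Real.pi * t ^ (-(((n : ℝ) + b) / 2))) *
            ∫⁻ y, ENNReal.ofReal (wt ln b y) * G y) := by
          gcongr
          exact lintegral_spread_fold_le hb hG ht0 x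
      _ = _ := by
          rw [← mul_assoc, ← ENNReal.ofReal_mul (by positivity),
            ← ENNReal.ofReal_mul (by positivity), sub_eq_add_neg, Real.rpow_add ht0]
          congr 2
          ring

lemma lintegral_rpow_Ioi_ne_top (hn : 1 ≤ n) (hb : 1 < b) (ha0 : 0 ≤ a) {δ : ℝ} (hδ : 0 < δ) :
    ENNReal.ofReal (3 * Real.pi) *
      ∫⁻ t in Set.Ioi δ, ENNReal.ofReal (t ^ (-a - ((n : ℝ) + b) / 2)) ≠ ∞ := by
  have hn' : (1 : ℝ) ≤ n := by exact_mod_cast hn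
  exact ENNReal.mul_ne_top ENNReal.ofReal_ne_top
    (integrableOn_Ioi_rpow_of_lt (by linarith) hδ).lintegral_lt_top.ne

lemma foldBound_ne_top (hn : 1 ≤ n) (hb : 1 < b) (ha0 : 0 ≤ a) (ha : a < 1) {G : Eu n → ℝ≥0∞}
    (hG : Measurable G) {M : ℝ≥0∞} (hM : ∀ y, G y ≤ M) (hM' : M ≠ ∞)
    (hI : ∫⁻ y, ENNReal.ofReal (wt ln b y) * G y ≠ ∞) (x : Eu n) :
    foldBound ln b a G x ≠ ∞ := by
  refine ne_top_of_le_ne_top ?_ (foldBound_le hb ha hG hM one_pos x)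
  refine ENNReal.add_ne_top.2 ⟨?_, ?_⟩
  · exact ENNReal.mul_ne_top ENNReal.ofReal_ne_top
      (ENNReal.mul_ne_top hM' (lintegral_one_add_mul_gw_ne_top hb.le))
  · exact ENNReal.mul_ne_top (lintegral_rpow_Ioi_ne_top hn hb ha0 one_pos) hI

lemma exists_foldBound_le (hn : 1 ≤ n) (hb : 1 < b) (ha0 : 0 ≤ a) (ha : a < 1) {M : ℝ≥0∞}
    (hM' : M ≠ ∞) {ε : ℝ≥0∞} (hε : ε ≠ 0) :
    ∃ η : ℝ≥0∞, 0 < η ∧ ∀ G : Eu n → ℝ≥0∞, Measurable G → (∀ y, G y ≤ M) →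
      ∫⁻ y, ENNReal.ofReal (wt ln b y) * G y ≤ η → ∀ x, foldBound ln b a G x ≤ ε := by
  have hA := ENNReal.mul_ne_top hM' (lintegral_one_add_mul_gw_ne_top (n := n) hb.le)
  set A := M * ∫⁻ w : Eu n × ℝ, ENNReal.ofReal ((1 + ‖w.1‖) * gw b w) with hAd
  have hlim : Tendsto (fun δ : ℝ => ENNReal.ofReal (δ ^ (1 - a) / (1 - a)) * A) (𝓝[>] 0)
      (𝓝 0) := by
    have h1 : Tendsto (fun δ : ℝ => δ ^ (1 - a) / (1 - a)) (𝓝[>] 0) (𝓝 0) := by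
      have := ((Real.continuous_rpow_const (by linarith : 0 ≤ 1 - a)).div_const (1 - a)).tendsto 0
      rw [Real.zero_rpow (by linarith), zero_div] at this
      exact this.mono_left nhdsWithin_le_nhds
    have h2 := ENNReal.Tendsto.mul_const (ENNReal.tendsto_ofReal h1) (Or.inr hA)
    simpa using h2
  have hε2 : 0 < ε / 2 := ENNReal.half_pos hε
  obtain ⟨δ, hδ1, hδ⟩ := ((hlim.eventually (ge_mem_nhds hε2)).and self_mem_nhdsWithin).exists
  have hc := lintegral_rpow_Ioi_ne_top hn hb ha0 hδ
  set c := ENNReal.ofReal (3 * Real.pi) *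
    ∫⁻ t in Set.Ioi δ, ENNReal.ofReal (t ^ (-a - ((n : ℝ) + b) / 2))
  refine ⟨ε / 2 / c, ENNReal.div_pos hε2.ne' hc, fun G hG hM hI x => ?_⟩
  calc _ ≤ _ := foldBound_le hb ha hG hM hδ x
    _ ≤ ε / 2 + c * (ε / 2 / c) := by gcongr
    _ ≤ ε / 2 + ε / 2 := by gcongr; exact ENNReal.mul_div_le
    _ = ε := ENNReal.add_halves ε

lemma lintegral_heatMeas (hb : 1 ≤ b) {G : ℝ × (Eu n × ℝ) → ℝ≥0∞} (hG : Measurable G) :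
    ∫⁻ z, G z ∂heatMeas n b =
      ∫⁻ t in Set.Ioi (0 : ℝ), ∫⁻ w, G (t, w) * ENNReal.ofReal (gw b w) := by
  have := (hasMoments_gaussMeas (n := n) hb).isFiniteMeasure
  rw [heatMeas, lintegral_prod _ hG.aemeasurable]
  refine lintegral_congr fun t => ?_
  refine (lintegral_withDensity_eq_lintegral_mul _
    (continuous_gw hb).measurable.ennreal_ofReal (hG.comp measurable_prodMk_left)).trans ?_
  exact lintegral_congr fun w => mul_comm _ _

lemma lintegral_enorm_heatMeas_le (hb : 1 ≤ b) {ℓ : Eu n × ℝ → ℝ} (hℓ : Measurable ℓ)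
    (hℓ' : ∀ w, |ℓ w| ≤ 1 + ‖w.1‖) {f : Eu n → ℝ} (hf : Measurable f) (x : Eu n) :
    ∫⁻ z, ‖z.1 ^ (-a) * ℓ z.2 * f (foldMap ln (spread z.1 x z.2))‖ₑ ∂heatMeas n b ≤
      foldBound ln b a (fun y => ‖f y‖ₑ) x := by
  have hm : Measurable fun z : ℝ × (Eu n × ℝ) =>
      z.1 ^ (-a) * ℓ z.2 * f (foldMap ln (spread z.1 x z.2)) :=
    ((by fun_prop : Measurable fun z : ℝ × (Eu n × ℝ) => z.1 ^ (-a)).mul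
      (hℓ.comp measurable_snd)).mul (hf.comp (continuous_foldMap_spread x).measurable)
  rw [lintegral_heatMeas hb hm.enorm, foldBound]
  refine setLIntegral_mono' measurableSet_Ioi fun t ht => ?_
  have ht0 : (0 : ℝ) < t := ht
  rw [← lintegral_const_mul' _ _ ENNReal.ofReal_ne_top]
  refine lintegral_mono fun w => ?_
  rw [enorm_mul, enorm_mul, Real.enorm_of_nonneg (by positivity : 0 ≤ t ^ (-a)),
    ENNReal.ofReal_mul (by positivity), ← ofReal_norm (ℓ w), Real.norm_eq_abs]
  calc _ ≤ ENNReal.ofReal (t ^ (-a)) * ENNReal.ofReal (1 + ‖w.1‖) *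
        ‖f (foldMap ln (spread t x w))‖ₑ * ENNReal.ofReal (gw b w) := by
        gcongr
        exact hℓ' w
    _ = _ := by ring

/-- Bounded measurable functions that are integrable against the weight. -/
structure IsData (ln : Fin n) (b : ℝ) (f : Eu n → ℝ) : Prop where
  measurable : Measurable f
  bounded : ∃ M : ℝ, ∀ y, |f y| ≤ M
  integrable : ∫⁻ y, ENNReal.ofReal (wt ln b y) * ‖f y‖ₑ ≠ ∞

lemma IsData.integrable_heatMeas {f : Eu n → ℝ} (hf : IsData ln b f) (hn : 1 ≤ n) (hb : 1 < b)
    (ha0 : 0 ≤ a) (ha : a < 1) {ℓ : Eu n × ℝ → ℝ} (hℓ : Measurable ℓ)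
    (hℓ' : ∀ w, |ℓ w| ≤ 1 + ‖w.1‖) (x : Eu n) :
    Integrable (fun z => z.1 ^ (-a) * ℓ z.2 * f (foldMap ln (spread z.1 x z.2)))
      (heatMeas n b) := by
  have hm : Measurable fun z : ℝ × (Eu n × ℝ) =>
      z.1 ^ (-a) * ℓ z.2 * f (foldMap ln (spread z.1 x z.2)) :=
    ((by fun_prop : Measurable fun z : ℝ × (Eu n × ℝ) => z.1 ^ (-a)).mul
      (hℓ.comp measurable_snd)).mul (hf.measurable.comp (continuous_foldMap_spread x).measurable)
  obtain ⟨M, hM⟩ := hf.bounded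
  refine ⟨hm.aestronglyMeasurable, ?_⟩
  refine (lintegral_enorm_heatMeas_le hb.le hℓ hℓ' hf.measurable x).trans_lt
    (foldBound_ne_top hn hb ha0 ha hf.measurable.enorm (M := ENNReal.ofReal M) (fun y => ?_)
      ENNReal.ofReal_ne_top hf.integrable x).lt_top
  rw [← ofReal_norm]
  exact ENNReal.ofReal_le_ofReal (hM y)

lemma tendstoUniformly_foldInt (hn : 1 ≤ n) (hb : 1 < b) (ha0 : 0 ≤ a) (ha : a < 1)
    {ℓ : Eu n × ℝ → ℝ} (hℓ : Measurable ℓ) (hℓ' : ∀ w, |ℓ w| ≤ 1 + ‖w.1‖) {f : Eu n → ℝ}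
    (hf : IsData ln b f) {F : ℕ → Eu n → ℝ} (hF : ∀ k, IsData ln b (F k)) {M : ℝ}
    (hM : ∀ k y, |F k y - f y| ≤ M)
    (hlim : Tendsto (fun k => ∫⁻ y, ENNReal.ofReal (wt ln b y) * ‖F k y - f y‖ₑ) atTop (𝓝 0)) :
    TendstoUniformly (fun k => foldInt ln b a ℓ (F k)) (foldInt ln b a ℓ f) atTop := by
  rw [Metric.tendstoUniformly_iff]
  intro ε hε
  obtain ⟨η, hη, h⟩ := exists_foldBound_le (ln := ln) (M := ENNReal.ofReal M) hn hb ha0 ha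
    ENNReal.ofReal_ne_top (ENNReal.ofReal_pos.2 (half_pos hε)).ne'
  filter_upwards [hlim.eventually (ge_mem_nhds hη)] with k hk x
  have hm : Measurable fun y => F k y - f y := (hF k).measurable.sub hf.measurable
  have h1 := h _ hm.enorm (fun y => by
    rw [← ofReal_norm]
    exact ENNReal.ofReal_le_ofReal (hM k y)) hk x
  have e : foldInt ln b a ℓ (F k) x - foldInt ln b a ℓ f x =
      ∫ z, z.1 ^ (-a) * ℓ z.2 * (F k (foldMap ln (spread z.1 x z.2)) -
        f (foldMap ln (spread z.1 x z.2))) ∂heatMeas n b := by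
    rw [foldInt, foldInt, ← integral_sub ((hF k).integrable_heatMeas hn hb ha0 ha hℓ hℓ' x)
      (hf.integrable_heatMeas hn hb ha0 ha hℓ hℓ' x)]
    simp only [mul_sub]
  rw [dist_comm, Real.dist_eq, e, ← Real.norm_eq_abs]
  refine lt_of_le_of_lt ?_ (half_lt_self hε)
  rw [← ENNReal.ofReal_le_ofReal_iff (half_pos hε).le, ofReal_norm]
  exact (enorm_integral_le_lintegral_enorm _).trans
    ((lintegral_enorm_heatMeas_le hb.le hℓ hℓ' hm x).trans h1)

end HeatMeasure

section Representation

open Filter Topology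

variable {n : ℕ} {ln : Fin n} {b : ℝ} {f : Eu n → ℝ} {x : Eu n}

lemma measurable_kern (x : Eu n) : Measurable (kern ln b x) := by
  have hc : Continuous fun z : Eu n × ℝ => ‖x - z.1‖ ^ 2 + 4 * (x ln * z.1 ln) * z.2 := by
    have : Continuous fun z : Eu n × ℝ => z.1 ln :=
      (EuclideanSpace.proj ln : Eu n →L[ℝ] ℝ).continuous.comp continuous_fst
    fun_prop
  have hm : Measurable fun z : Eu n × ℝ =>
      ENNReal.ofReal ((‖x - z.1‖ ^ 2 + 4 * (x ln * z.1 ln) * z.2) ^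
        (-(((n : ℝ) + b) / 2 - 1)) * (z.2 * (1 - z.2)) ^ (b / 2 - 1)) :=
    ((hc.measurable.pow_const _).mul (by fun_prop)).ennreal_ofReal
  exact hm.lintegral_prod_right' (ν := volume.restrict (Set.Ioo 0 1))

lemma kern_ne_top (hn : 1 ≤ n) (hb : 1 < b) {y : Eu n} (hx : 0 < x ln) (hy : 0 < y ln)
    (hxy : y ≠ x) : kern ln b x y ≠ ∞ := by
  have hn' : (1 : ℝ) ≤ n := by exact_mod_cast hn
  have hxy' : 0 < ‖x - y‖ := norm_pos_iff.2 (sub_ne_zero.2 hxy.symm)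
  have hβ : ∫⁻ τ in Set.Ioo (0 : ℝ) 1, ENNReal.ofReal ((τ * (1 - τ)) ^ (b / 2 - 1)) ≠ ∞ := by
    intro h
    have h1 := lintegral_sin_eq hb fun _ => 1
    simp only [mul_one] at h1
    rw [h, ENNReal.mul_top (ENNReal.ofReal_pos.2 (by positivity)).ne'] at h1
    refine absurd h1 (ne_top_of_le_ne_top (b := ∫⁻ θ in Set.Ioo 0 Real.pi, 1) (by simp) ?_)
    refine setLIntegral_mono measurable_const fun θ hθ => ?_
    rw [← ENNReal.ofReal_one]
    exact ENNReal.ofReal_le_ofReal (Real.rpow_le_one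
      (Real.sin_pos_of_pos_of_lt_pi hθ.1 hθ.2).le (Real.sin_le_one _) (by linarith))
  refine ne_top_of_le_ne_top (ENNReal.mul_ne_top (ENNReal.ofReal_ne_top
    (r := (‖x - y‖ ^ 2) ^ (-(((n : ℝ) + b) / 2 - 1)))) hβ) ?_
  rw [← lintegral_const_mul' _ _ ENNReal.ofReal_ne_top]
  refine setLIntegral_mono' measurableSet_Ioo fun τ hτ => ?_
  have hτ0 : 0 < τ := hτ.1
  have hτ1 : 0 < 1 - τ := by linarith [hτ.2]
  rw [← ENNReal.ofReal_mul (by positivity)]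
  refine ENNReal.ofReal_le_ofReal (mul_le_mul_of_nonneg_right ?_ (by positivity))
  exact Real.rpow_le_rpow_of_nonpos (by positivity)
    (le_add_of_nonneg_right (by positivity)) (by linarith)

lemma map_heatMeas_foldMap (hn : 1 ≤ n) (hb : 1 < b) (hx : 0 < x ln) :
    (heatMeas n b).map (fun z => foldMap ln (spread z.1 x z.2)) =
      ENNReal.ofReal (kernConst n b) •
        volume.withDensity fun y => ENNReal.ofReal (wt ln b y) * kern ln b x y := by
  have hw : Measurable fun y => ENNReal.ofReal (wt ln b y) * kern ln b x y :=
    (continuous_wt (by linarith)).measurable.ennreal_ofReal.mul (measurable_kern x)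
  refine Measure.ext_of_lintegral _ fun G hG => ?_
  have hs := (continuous_foldMap_spread (ln := ln) x).measurable
  have h1 := lintegral_heatMeas hb.le (hG.comp hs)
  simp only [Function.comp_apply] at h1
  rw [lintegral_map hG hs, h1, lintegral_avg_fold hn hb hG hx, lintegral_smul_measure, lintegral_withDensity_eq_lintegral_mul _ hw hG, smul_eq_mul]
  congr 1
  refine lintegral_congr fun y => ?_
  simp only [Pi.mul_apply]
  ring

lemma norm_sq_sub_reflLn (x y : Eu n) :
    ‖x - reflLn ln y‖ ^ 2 = ‖x - y‖ ^ 2 + 4 * (x ln * y ln) := by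
  have h : x - reflLn ln y = (x - y) + (2 * y ln) • EuclideanSpace.single ln (1 : ℝ) := by
    ext i
    by_cases hi : i = ln
    · subst hi
      simp [reflLn]
      ring
    · simp [reflLn, hi]
  rw [h, norm_sq_add_smul_single, PiLp.sub_apply]
  ring

lemma Kb_eq (y : Eu n) :
    Kb n ln b x y = Db n b * (kern ln b x y).toReal := by
  rw [Kb, kern, intervalIntegral.integral_of_le zero_le_one, integral_Ioc_eq_integral_Ioo,
    integral_eq_lintegral_of_nonneg_ae]
  · congr 2
    refine lintegral_congr fun τ => ?_
    rw [norm_sq_sub_reflLn]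
    ring_nf
  · filter_upwards [ae_restrict_mem measurableSet_Ioo] with τ hτ
    have hτ0 : 0 < τ := hτ.1
    have hτ1 : 0 < 1 - τ := by linarith [hτ.2]
    simp only [Pi.zero_apply]
    positivity
  · exact Measurable.aestronglyMeasurable (by fun_prop)

lemma IsData.Tb_eq (hf : IsData ln b f) (hn : 1 ≤ n) (hb : 1 < b) (hx : 0 < x ln) :
    Tb n ln b f x = Db n b / kernConst n b * foldInt ln b 0 (fun _ => 1) f x := by
  have hs := (continuous_foldMap_spread (ln := ln) x).measurable
  have hw : Measurable fun y => ENNReal.ofReal (wt ln b y) * kern ln b x y :=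
    (continuous_wt (by linarith)).measurable.ennreal_ofReal.mul (measurable_kern x)
  have : Nontrivial (Eu n) := ⟨x, 0, fun h => by simp [h] at hx⟩
  have hfin : ∀ᵐ y : Eu n, ENNReal.ofReal (wt ln b y) * kern ln b x y < ∞ := by
    filter_upwards [Measure.ae_ne volume x] with y hy
    rcases le_or_gt (y ln) 0 with h | h
    · simp [wt_of_nonpos (by linarith : 0 < b) h]
    · exact ENNReal.mul_lt_top ENNReal.ofReal_lt_top (kern_ne_top hn hb hx h hy).lt_top
  have e1 : foldInt ln b 0 (fun _ => 1) f x =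
      kernConst n b * ∫ y, (ENNReal.ofReal (wt ln b y) * kern ln b x y).toReal * f y := by
    have h1 : foldInt ln b 0 (fun _ => 1) f x =
        ∫ z, f (foldMap ln (spread z.1 x z.2)) ∂heatMeas n b := by
      simp only [foldInt, neg_zero, Real.rpow_zero, one_mul]
    have h2 := integral_map (μ := heatMeas n b) (f := f) hs.aemeasurable
      hf.measurable.aestronglyMeasurable
    rw [h1, ← h2, map_heatMeas_foldMap hn hb hx, integral_smul_measure, integral_withDensity_eq_integral_toReal_smul hw hfin,
      ENNReal.toReal_ofReal (kernConst_pos hn hb).le]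
    rfl
  rw [e1, ← mul_assoc, div_mul_cancel₀ _ (kernConst_pos hn hb).ne', Tb, ← integral_const_mul,
    setIntegral_congr_fun (g := fun y =>
      Db n b * ((ENNReal.ofReal (wt ln b y) * kern ln b x y).toReal * f y))
      (measurableSet_lt measurable_const (by fun_prop))]
  · refine setIntegral_eq_integral_of_forall_compl_eq_zero fun y hy => ?_
    rw [wt_of_nonpos (by linarith : 0 < b) (not_lt.1 hy)]
    simp
  · intro y hy
    simp only
    rw [Kb_eq, ENNReal.toReal_mul, ENNReal.toReal_ofReal (wt_nonneg _), wt_of_pos hy]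
    ring

lemma IsTest.isData (hf : IsTest ln f) (hb : 1 < b) : IsData ln b f where
  measurable := hf.smooth.continuous.measurable
  bounded := hf.compact.exists_bound_of_continuous hf.smooth.continuous
  integrable := by
    have h : Integrable fun y => wt ln b y * f y :=
      ((continuous_wt (by linarith)).mul hf.smooth.continuous).integrable_of_hasCompactSupport
        hf.compact.mul_left
    have h1 := h.2.ne
    simpa only [enorm_mul, Real.enorm_of_nonneg (wt_nonneg _)] using h1

lemma profile_sqMap (v : Eu n × ℝ) :
    (profile ln b f ∘ sqMap ln) v = (gaussMass n b)⁻¹ * f (foldMap ln v) := by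
  rw [Function.comp_apply, profile, rootLift_sqMap, foldMap]

lemma IsTest.testPot_eq_foldInt (hf : IsTest ln f) (hn : 1 ≤ n) (hb : 1 < b) (x : Eu n) :
    testPot ln b f x = (gaussMass n b)⁻¹ * foldInt ln b 0 (fun _ => 1) f x := by
  have := (hasMoments_gaussMeas (n := n) hb.le).isFiniteMeasure
  have hI := (hf.isData hb).integrable_heatMeas hn hb le_rfl one_pos (ℓ := fun _ => 1)
    measurable_const (fun w => by simp) x
  rw [testPot, pot, foldInt, heatMeas, integral_prod _ hI, ← integral_const_mul]
  refine integral_congr_ae (Eventually.of_forall fun t => ?_)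
  simp only [avg, profile_sqMap, neg_zero, Real.rpow_zero, one_mul]
  rw [integral_const_mul]

lemma IsTest.pd_testPot_eq_foldInt (hf : IsTest ln f) (hn : 1 ≤ n) (hb : 1 < b) (i : Fin n)
    (x : Eu n) :
    pd (testPot ln b f) i x =
      (gaussMass n b)⁻¹ * foldInt ln b (1 / 2) (fun w => w.1 i / 2) f x := by
  have := (hasMoments_gaussMeas (n := n) hb.le).isFiniteMeasure
  have hℓ : ∀ w : Eu n × ℝ, |w.1 i / 2| ≤ 1 + ‖w.1‖ := fun w => by
    have := PiLp.norm_apply_le w.1 i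
    rw [Real.norm_eq_abs] at this
    rw [abs_div, abs_two]
    linarith [norm_nonneg w.1, abs_nonneg (w.1 i)]
  have hm : Measurable fun w : Eu n × ℝ => w.1 i / 2 :=
    (((EuclideanSpace.proj i : Eu n →L[ℝ] ℝ).continuous.comp continuous_fst).div_const 2).measurable
  have hI := (hf.isData hb).integrable_heatMeas hn hb (by norm_num : (0 : ℝ) ≤ 1 / 2)
    (by norm_num) hm hℓ x
  have hH := contDiff_comp_sqMap (ln := ln) (hf.contDiff_profile (b := b))
  have hs := hasCompactSupport_comp_sqMap (ln := ln) (hf.hasCompactSupport_profile (b := b))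
  rw [testPot, pd_pot hn hb hH hs, pot, foldInt, heatMeas, integral_prod _ hI,
    ← integral_const_mul]
  refine setIntegral_congr_fun measurableSet_Ioi fun t ht => ?_
  have ht0 : (0 : ℝ) < t := ht
  have hst : 0 < √t := Real.sqrt_pos.2 ht0
  have h1 := integral_coord_mul_spread hb.le hH hs t x i
  have h2 : avg (gaussMeas n b) (pdFst (profile ln b f ∘ sqMap ln) i) t x =
      (√t)⁻¹ / 2 * ∫ w, w.1 i * (profile ln b f ∘ sqMap ln) (spread t x w) ∂gaussMeas n b := by
    rw [h1]
    field_simp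
  simp only [h2, profile_sqMap]
  rw [← integral_const_mul, ← integral_const_mul, Real.rpow_neg ht0.le, ← Real.sqrt_eq_rpow]
  refine integral_congr_ae (Eventually.of_forall fun w => ?_)
  simp only
  ring

end Representation

section Approximation

open Filter Topology

variable {n : ℕ} {ln : Fin n} {b p M R : ℝ} {f : Eu n → ℝ}

/-- A standard mollifier of radius `2 / (k + 1)`. -/
def mollBump (n k : ℕ) : ContDiffBump (0 : Eu n) where
  rIn := 1 / ((k : ℝ) + 1)
  rOut := 2 * (1 / ((k : ℝ) + 1))
  rIn_pos := by positivity
  rIn_lt_rOut := by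
    have : 0 < 1 / ((k : ℝ) + 1) := by positivity
    linarith

/-- Mollification of `f`. -/
def moll (f : Eu n → ℝ) (k : ℕ) : Eu n → ℝ :=
  convolution ((mollBump n k).normed volume) f (ContinuousLinearMap.lsmul ℝ ℝ) volume

lemma integrable_of_bounded_support (hf : Measurable f) (hM : ∀ y, |f y| ≤ M)
    (hR : ∀ y, f y ≠ 0 → ‖y‖ ≤ R) : Integrable f := by
  have hs : Function.support f ⊆ Metric.closedBall 0 R := fun y hy => by
    rw [mem_closedBall_zero_iff]
    exact hR y hy
  rw [← integrableOn_iff_integrable_of_support_subset hs]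
  exact Measure.integrableOn_of_bounded measure_closedBall_lt_top.ne hf.aestronglyMeasurable
    (M := M) (Eventually.of_forall hM)

lemma abs_moll_le (hM : ∀ y, |f y| ≤ M) (k : ℕ) (x : Eu n) : |moll f k x| ≤ M := by
  rw [moll, convolution_def, ← Real.norm_eq_abs]
  have h1 := (mollBump n k).integrable_normed (μ := volume)
  have h2 := norm_integral_le_of_norm_le (h1.mul_const M) (f := fun t =>
    ContinuousLinearMap.lsmul ℝ ℝ ((mollBump n k).normed volume t) (f (x - t)))
    (Eventually.of_forall fun t => ?_)
  · rwa [integral_mul_const, (mollBump n k).integral_normed, one_mul] at h2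
  · rw [ContinuousLinearMap.lsmul_apply, norm_smul,
      Real.norm_of_nonneg ((mollBump n k).nonneg_normed t)]
    exact mul_le_mul_of_nonneg_left (hM _) ((mollBump n k).nonneg_normed t)

lemma norm_le_of_moll_ne_zero (hR : ∀ y, f y ≠ 0 → ‖y‖ ≤ R) (k : ℕ) {x : Eu n}
    (hx : moll f k x ≠ 0) : ‖x‖ ≤ 2 + R := by
  obtain ⟨y, hy, z, hz, rfl⟩ := support_convolution_subset (ContinuousLinearMap.lsmul ℝ ℝ)
    (Function.mem_support.2 hx)
  rw [ContDiffBump.support_normed_eq, mem_ball_zero_iff] at hy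
  have h1 : 1 / ((k : ℝ) + 1) ≤ 1 := by
    rw [div_le_one (by positivity)]
    linarith [k.cast_nonneg (α := ℝ)]
  have h2 : (mollBump n k).rOut = 2 * (1 / ((k : ℝ) + 1)) := rfl
  exact (norm_add_le _ _).trans (add_le_add (by linarith) (hR z hz))

lemma contDiff_moll (hf : LocallyIntegrable f) (k : ℕ) : ContDiff ℝ (⊤ : ℕ∞) (moll f k) :=
  (mollBump n k).hasCompactSupport_normed.contDiff_convolution_left _
    (mollBump n k).contDiff_normed hf

lemma ae_tendsto_moll (hf : LocallyIntegrable f) :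
    ∀ᵐ x, Tendsto (fun k => moll f k x) atTop (𝓝 (f x)) := by
  refine ContDiffBump.ae_convolution_tendsto_right_of_locallyIntegrable (φ := mollBump n) (K := 2)
    ?_ (Eventually.of_forall fun k => le_rfl) hf
  have := tendsto_one_div_add_atTop_nhds_zero_nat (𝕜 := ℝ) |>.const_mul 2
  rwa [mul_zero] at this

/-- Smooth compactly supported approximations of `f` in the open half-space. -/
def approx (ln : Fin n) (f : Eu n → ℝ) (k : ℕ) (x : Eu n) : ℝ :=
  testCut ln k x * moll f k x

lemma isTest_approx (hf : LocallyIntegrable f) (k : ℕ) : IsTest ln (approx ln f k) :=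
  (isTest_testCut k).of_mul_left fun _ _ => (contDiff_moll hf k).contDiffAt

lemma abs_approx_le (hM : ∀ y, |f y| ≤ M) (k : ℕ) (x : Eu n) : |approx ln f k x| ≤ M := by
  rw [approx, abs_mul, abs_of_nonneg (testCut_nonneg k x)]
  calc _ ≤ 1 * M := mul_le_mul (testCut_le_one k x) (abs_moll_le hM k x) (abs_nonneg _) zero_le_one
    _ = M := one_mul M

lemma ae_tendsto_approx (hf : LocallyIntegrable f) :
    ∀ᵐ x : Eu n, 0 < x ln → Tendsto (fun k => approx ln f k x) atTop (𝓝 (f x)) := by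
  filter_upwards [ae_tendsto_moll hf] with x hx h
  refine hx.congr' ?_
  filter_upwards [eventually_testCut_eq_one h] with k hk
  rw [approx, hk, one_mul]

lemma lintegral_wt_closedBall_ne_top (hb : 0 < b) (c R : ℝ) :
    ∫⁻ y, ENNReal.ofReal (wt ln b y) *
      (Metric.closedBall (0 : Eu n) R).indicator (fun _ => ENNReal.ofReal c) y ≠ ∞ := by
  have h1 : ∫⁻ y in Metric.closedBall (0 : Eu n) R, ENNReal.ofReal (wt ln b y) ≠ ∞ :=
    ((continuous_wt hb.le).continuousOn.integrableOn_compact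
      (isCompact_closedBall (0 : Eu n) R)).lintegral_lt_top.ne
  have h2 : ∀ y, ENNReal.ofReal (wt ln b y) *
      (Metric.closedBall (0 : Eu n) R).indicator (fun _ => ENNReal.ofReal c) y =
      (Metric.closedBall (0 : Eu n) R).indicator
        (fun y => ENNReal.ofReal (wt ln b y) * ENNReal.ofReal c) y := fun y => by
    by_cases hy : y ∈ Metric.closedBall (0 : Eu n) R
    · rw [Set.indicator_of_mem hy, Set.indicator_of_mem hy]
    · rw [Set.indicator_of_notMem hy, Set.indicator_of_notMem hy, mul_zero]
  simp only [h2]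
  rw [lintegral_indicator Metric.isClosed_closedBall.measurableSet,
    lintegral_mul_const' _ _ ENNReal.ofReal_ne_top]
  exact ENNReal.mul_ne_top h1 ENNReal.ofReal_ne_top

lemma tendsto_lintegral_wt (hb : 0 < b) (hp : 0 < p) {G : ℕ → Eu n → ℝ} {g : Eu n → ℝ}
    (hG : ∀ k, Measurable (G k)) (hM : ∀ k y, |G k y| ≤ M) (hR : ∀ k y, G k y ≠ 0 → ‖y‖ ≤ R)
    (hlim : ∀ᵐ x : Eu n, 0 < x ln → Tendsto (fun k => G k x) atTop (𝓝 (g x))) :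
    Tendsto (fun k => ∫⁻ y, ENNReal.ofReal (wt ln b y) * ‖G k y‖ₑ ^ p) atTop
      (𝓝 (∫⁻ y, ENNReal.ofReal (wt ln b y) * ‖g y‖ₑ ^ p)) := by
  refine tendsto_lintegral_of_dominated_convergence (fun y => ENNReal.ofReal (wt ln b y) *
    (Metric.closedBall (0 : Eu n) R).indicator (fun _ => ENNReal.ofReal (M ^ p)) y)
    (fun k => (continuous_wt hb.le).measurable.ennreal_ofReal.mul ((hG k).enorm.pow_const p))
    (fun k => Eventually.of_forall fun y => ?_) (lintegral_wt_closedBall_ne_top hb _ _) ?_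
  · refine mul_le_mul_right ?_ _
    by_cases h : G k y = 0
    · simp [h, hp]
    · rw [Set.indicator_of_mem (by rw [mem_closedBall_zero_iff]; exact hR k y h), ← ofReal_norm,
        ENNReal.ofReal_rpow_of_nonneg (norm_nonneg _) hp.le]
      exact ENNReal.ofReal_le_ofReal (Real.rpow_le_rpow (norm_nonneg _) (hM k y) hp.le)
  · filter_upwards [hlim] with x hx
    rcases le_or_gt (x ln) 0 with h | h
    · simp [wt_of_nonpos hb h]
    · refine ENNReal.Tendsto.const_mul ?_ (Or.inr ENNReal.ofReal_ne_top)
      exact ((ENNReal.continuous_rpow_const (y := p)).tendsto _).comp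
        ((continuous_enorm.tendsto _).comp (hx h))

/-- Bounded measurable functions are limits of test functions in `L¹` and `Lᵖ`. -/
lemma exists_approx (hb : 1 < b) (hp : 0 < p) (hf : Measurable f) (hM : ∃ M, ∀ y, |f y| ≤ M)
    (hs : HasCompactSupport f) :
    IsData ln b f ∧ ∃ (F : ℕ → Eu n → ℝ) (L : ℝ), (∀ k, IsTest ln (F k)) ∧
      (∀ k y, |F k y - f y| ≤ L) ∧
      Tendsto (fun k => ∫⁻ y, ENNReal.ofReal (wt ln b y) * ‖F k y - f y‖ₑ) atTop (𝓝 0) ∧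
      Tendsto (fun k => ∫⁻ y, ENNReal.ofReal (wt ln b y) * ‖F k y‖ₑ ^ p) atTop
        (𝓝 (∫⁻ y, ENNReal.ofReal (wt ln b y) * ‖f y‖ₑ ^ p)) := by
  have hb0 : 0 < b := by linarith
  obtain ⟨M, hM⟩ := hM
  obtain ⟨R, hR⟩ := hs.isCompact.isBounded.exists_norm_le
  have hR : ∀ y, f y ≠ 0 → ‖y‖ ≤ R := fun y hy => hR y (subset_tsupport f hy)
  have hI := (integrable_of_bounded_support hf hM hR).locallyIntegrable
  have hT : ∀ k, IsTest ln (approx ln f k) := isTest_approx hI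
  have hFR : ∀ k y, approx ln f k y ≠ 0 → ‖y‖ ≤ 2 + R := fun k y h =>
    norm_le_of_moll_ne_zero hR k (right_ne_zero_of_mul h)
  have hFm : ∀ k, Measurable (approx ln f k) := fun k => (hT k).smooth.continuous.measurable
  have hL : ∀ k y, |approx ln f k y - f y| ≤ M + M := fun k y =>
    (abs_sub _ _).trans (add_le_add (abs_approx_le hM k y) (hM y))
  refine ⟨⟨hf, ⟨M, hM⟩, ?_⟩, approx ln f, M + M, hT, hL, ?_,
    tendsto_lintegral_wt hb0 hp hFm (abs_approx_le hM) hFR (ae_tendsto_approx hI)⟩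
  · refine ne_top_of_le_ne_top (lintegral_wt_closedBall_ne_top (ln := ln) hb0 M R)
      (lintegral_mono fun y => mul_le_mul_right ?_ _)
    by_cases h : f y = 0
    · simp [h]
    · rw [Set.indicator_of_mem (by rw [mem_closedBall_zero_iff]; exact hR y h), ← ofReal_norm]
      exact ENNReal.ofReal_le_ofReal (hM y)
  · have := tendsto_lintegral_wt (ln := ln) (R := 2 + R) (g := fun _ => 0) hb0 one_pos
      (fun k => (hFm k).sub hf) hL (fun k y h => ?_) ?_
    · simpa using this
    · by_cases h1 : approx ln f k y = 0
      · exact (hR y fun h2 => h (by simp [h1, h2])).trans (by linarith)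
      · exact hFR k y h1
    · filter_upwards [ae_tendsto_approx (ln := ln) hI] with x hx h
      have := (hx h).sub_const (f x)
      rwa [sub_self] at this

end Approximation

section Gradient

open Filter Topology

variable {n : ℕ} {ln : Fin n} {b p : ℝ} {f : Eu n → ℝ}

lemma clm_eq_sum_proj (L : Eu n →L[ℝ] ℝ) :
    L = ∑ j, L (EuclideanSpace.single j 1) • (EuclideanSpace.proj j : Eu n →L[ℝ] ℝ) := by
  ext v
  conv_lhs => rw [← (EuclideanSpace.basisFun (Fin n) ℝ).sum_repr v]
  simp [mul_comm]

lemma norm_proj_le (j : Fin n) : ‖(EuclideanSpace.proj j : Eu n →L[ℝ] ℝ)‖ ≤ 1 :=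
  ContinuousLinearMap.opNorm_le_bound _ zero_le_one fun v => by
    rw [one_mul]
    exact PiLp.norm_apply_le v j

lemma tendstoUniformly_sum_proj {A : ℕ → Fin n → Eu n → ℝ} {V : Fin n → Eu n → ℝ}
    (h : ∀ j, TendstoUniformly (fun k => A k j) (V j) atTop) :
    TendstoUniformly (fun k x => ∑ j, A k j x • (EuclideanSpace.proj j : Eu n →L[ℝ] ℝ))
      (fun x => ∑ j, V j x • (EuclideanSpace.proj j : Eu n →L[ℝ] ℝ)) atTop := by
  rw [Metric.tendstoUniformly_iff]
  intro ε hε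
  have hn : (0 : ℝ) < n + 1 := by positivity
  have h1 : ∀ᶠ k in atTop, ∀ j x, dist (V j x) (A k j x) < ε / (n + 1) :=
    eventually_all.2 fun j => Metric.tendstoUniformly_iff.1 (h j) _ (by positivity)
  filter_upwards [h1] with k hk x
  rw [dist_eq_norm, ← Finset.sum_sub_distrib]
  calc _ ≤ ∑ j : Fin n, ε / (n + 1) := by
        refine norm_sum_le_of_le _ fun j _ => ?_
        rw [← sub_smul, norm_smul, ← dist_eq_norm]
        exact (mul_le_of_le_one_right dist_nonneg (norm_proj_le j)).trans (hk j x).le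
    _ = n * (ε / (n + 1)) := by simp
    _ < ε := by
        rw [← mul_div_assoc, div_lt_iff₀ hn]
        linarith

lemma Db_pos (hn : 1 ≤ n) (hb : 1 < b) : 0 < Db n b := by
  have hn' : (1 : ℝ) ≤ n := by exact_mod_cast hn
  have h1 := Real.Gamma_pos_of_pos (by linarith : 0 < ((n : ℝ) + b - 2) / 2)
  have h2 := Real.Gamma_pos_of_pos (by linarith : 0 < b / 2)
  unfold Db
  positivity

/-- The factor relating `Tb` to `testPot`. -/
def potConst (n : ℕ) (b : ℝ) : ℝ := Db n b / kernConst n b * gaussMass n b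

lemma potConst_pos (hn : 1 ≤ n) (hb : 1 < b) : 0 < potConst n b :=
  mul_pos (div_pos (Db_pos hn hb) (kernConst_pos hn hb)) (gaussMass_pos hb.le)

lemma exists_tendsto_pd (hn : 1 ≤ n) (hb : 1 < b) (hf : IsData ln b f) {F : ℕ → Eu n → ℝ}
    {L : ℝ} (hF : ∀ k, IsTest ln (F k)) (hL : ∀ k y, |F k y - f y| ≤ L)
    (hlim : Tendsto (fun k => ∫⁻ y, ENNReal.ofReal (wt ln b y) * ‖F k y - f y‖ₑ) atTop (𝓝 0)) :
    ∃ V : Fin n → Eu n → ℝ,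
      (∀ j x, Tendsto (fun k => pd (testPot ln b (F k)) j x) atTop (𝓝 (V j x))) ∧
      ∀ j x, 0 < x ln → pd (Tb n ln b f) j x = potConst n b * V j x := by
  have hd : ∀ k, IsData ln b (F k) := fun k => (hF k).isData hb
  have hm := (gaussMass_pos (n := n) hb.le).ne'
  set m := (gaussMass n b)⁻¹ with hmd
  have hU : TendstoUniformly (fun k => testPot ln b (F k))
      (fun x => m * foldInt ln b 0 (fun _ => 1) f x) atTop := by
    have h := (lipschitzWith_smul m).uniformContinuous.comp_tendstoUniformly
      (tendstoUniformly_foldInt hn hb le_rfl one_pos (ℓ := fun _ => 1) measurable_const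
        (fun w => by simp) hf hd hL hlim)
    rw [show (fun k => testPot ln b (F k)) =
      fun k x => m * foldInt ln b 0 (fun _ => 1) (F k) x from
      funext₂ fun k x => (hF k).testPot_eq_foldInt hn hb x]
    exact h
  set V : Fin n → Eu n → ℝ := fun j x => m * foldInt ln b (1 / 2) (fun w => w.1 j / 2) f x with hV
  have hVl : ∀ j, TendstoUniformly (fun k => pd (testPot ln b (F k)) j) (V j) atTop := by
    intro j
    have hℓ : ∀ w : Eu n × ℝ, |w.1 j / 2| ≤ 1 + ‖w.1‖ := fun w => by
      have := PiLp.norm_apply_le w.1 j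
      rw [Real.norm_eq_abs] at this
      rw [abs_div, abs_two]
      linarith [norm_nonneg w.1, abs_nonneg (w.1 j)]
    have hℓm : Measurable fun w : Eu n × ℝ => w.1 j / 2 :=
      (((EuclideanSpace.proj j : Eu n →L[ℝ] ℝ).continuous.comp
        continuous_fst).div_const 2).measurable
    have h := (lipschitzWith_smul m).uniformContinuous.comp_tendstoUniformly
      (tendstoUniformly_foldInt hn hb (by norm_num : (0 : ℝ) ≤ 1 / 2) (by norm_num) hℓm hℓ
        hf hd hL hlim)
    rw [show (fun k => pd (testPot ln b (F k)) j) =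
      fun k x => m * foldInt ln b (1 / 2) (fun w => w.1 j / 2) (F k) x from
      funext₂ fun k x => (hF k).pd_testPot_eq_foldInt hn hb j x]
    exact h
  have hderiv := hasFDerivAt_of_tendstoUniformly (tendstoUniformly_sum_proj hVl)
    (f := fun k => testPot ln b (F k)) (fun k x => by
      have h := (((hF k).contDiff_testPot_infty hn hb).differentiable (by simp) x).hasFDerivAt
      rw [clm_eq_sum_proj (fderiv ℝ _ x)] at h
      exact h)
    fun x => hU.tendsto_at x
  refine ⟨V, fun j x => (hVl j).tendsto_at x, fun j x hx => ?_⟩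
  have he : Tb n ln b f =ᶠ[𝓝 x]
      fun x => potConst n b * (m * foldInt ln b 0 (fun _ => 1) f x) := by
    have ho : IsOpen {x : Eu n | 0 < x ln} :=
      isOpen_lt continuous_const (EuclideanSpace.proj ln : Eu n →L[ℝ] ℝ).continuous
    filter_upwards [ho.mem_nhds hx] with y hy
    rw [hf.Tb_eq hn hb hy, potConst, hmd]
    field_simp
  rw [pd, he.fderiv_eq, ((hderiv x).const_mul (potConst n b)).fderiv]
  simp [Finset.sum_ite_eq, eq_comm]

end Gradient

section Limit

open Filter Topology

variable {n : ℕ} {ln : Fin n} {b p : ℝ} {f g h : Eu n → ℝ}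

lemma lintegral_wt_le_of_tendsto (hb : 0 < b) (hp : 0 < p) {G : ℕ → Eu n → ℝ} {A : ℕ → ℝ≥0∞}
    {B : ℝ≥0∞} (hG : ∀ k, Measurable (G k))
    (hlim : ∀ x, 0 < x ln → g x = 0 ∨ Tendsto (fun k => G k x) atTop (𝓝 (g x)))
    (hA : ∀ k, ∫⁻ x, ENNReal.ofReal (wt ln b x) * ‖G k x‖ₑ ^ p ≤ A k)
    (hB : Tendsto A atTop (𝓝 B)) :
    ∫⁻ x, ENNReal.ofReal (wt ln b x) * ‖g x‖ₑ ^ p ≤ B := by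
  have hwm : Measurable fun x : Eu n => ENNReal.ofReal (wt ln b x) :=
    (continuous_wt hb.le).measurable.ennreal_ofReal
  calc ∫⁻ x, ENNReal.ofReal (wt ln b x) * ‖g x‖ₑ ^ p
      ≤ ∫⁻ x, liminf (fun k => ENNReal.ofReal (wt ln b x) * ‖G k x‖ₑ ^ p) atTop := by
        refine lintegral_mono fun x => ?_
        rcases le_or_gt (x ln) 0 with hx | hx
        · simp [wt_of_nonpos hb hx]
        rcases hlim x hx with h0 | h1
        · simp [h0, hp]
        · refine (Tendsto.liminf_eq ?_).ge
          exact ENNReal.Tendsto.const_mul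
            ((ENNReal.continuous_rpow_const.tendsto _).comp h1.enorm) (Or.inr ENNReal.ofReal_ne_top)
    _ ≤ liminf (fun k => ∫⁻ x, ENNReal.ofReal (wt ln b x) * ‖G k x‖ₑ ^ p) atTop :=
        lintegral_liminf_le fun k => hwm.mul ((hG k).enorm.pow_const p)
    _ ≤ liminf A atTop := liminf_le_liminf (Eventually.of_forall hA)
    _ = B := hB.liminf_eq

lemma hasDerivAt_comp_add_single (hh : ContDiff ℝ 1 h) (i : Fin n) (x : Eu n) (t : ℝ) :
    HasDerivAt (fun s : ℝ => h (x + s • EuclideanSpace.single i (1 : ℝ)))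
      (pd h i (x + t • EuclideanSpace.single i (1 : ℝ))) t := by
  have h1 : HasDerivAt (fun s : ℝ => x + s • EuclideanSpace.single i (1 : ℝ))
      (EuclideanSpace.single i (1 : ℝ)) t := by
    simpa using ((hasDerivAt_id t).smul_const (EuclideanSpace.single i (1 : ℝ))).const_add x
  exact ((hh.differentiable (by simp)) _).hasFDerivAt.comp_hasDerivAt t h1

lemma wt_le_wt_add_single (hb : 0 ≤ b) (i : Fin n) {s : ℝ} (hs : 0 ≤ s) (x : Eu n) :
    wt ln b x ≤ wt ln b (x + s • EuclideanSpace.single i (1 : ℝ)) := by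
  unfold wt
  refine Real.rpow_le_rpow (le_max_right _ _) (max_le_max ?_ le_rfl) hb
  by_cases hi : ln = i
  · simp [hi, hs]
  · simp [hi]

lemma lintegral_wt_slope_le (hb : 0 < b) (hp : 1 ≤ p) (hh : ContDiff ℝ 1 h) (i : Fin n) {s : ℝ}
    (hs : 0 < s) :
    ∫⁻ x, ENNReal.ofReal (wt ln b x) *
        ‖(h (x + s • EuclideanSpace.single i (1 : ℝ)) - h x) / s‖ₑ ^ p ≤
      ∫⁻ x, ENNReal.ofReal (wt ln b x) * ‖pd h i x‖ₑ ^ p := by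
  have hpc : Continuous (pd h i) := hh.continuous_pd i
  have hc : Continuous fun z : Eu n × ℝ =>
      pd h i (z.1 + (z.2 * s) • EuclideanSpace.single i (1 : ℝ)) := hpc.comp (by fun_prop)
  have hwm : Measurable fun x : Eu n => ENNReal.ofReal (wt ln b x) :=
    (continuous_wt hb.le).measurable.ennreal_ofReal
  have hrep : ∀ x, (h (x + s • EuclideanSpace.single i (1 : ℝ)) - h x) / s =
      ∫ θ in (0 : ℝ)..1, pd h i (x + (θ * s) • EuclideanSpace.single i (1 : ℝ)) := by
    intro x
    have hcx : Continuous fun t : ℝ => pd h i (x + t • EuclideanSpace.single i (1 : ℝ)) :=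
      hpc.comp (by fun_prop)
    rw [intervalIntegral.integral_comp_mul_right
      (fun t => pd h i (x + t • EuclideanSpace.single i (1 : ℝ))) hs.ne',
      intervalIntegral.integral_eq_sub_of_hasDerivAt
        (fun t _ => hasDerivAt_comp_add_single hh i x t) (hcx.intervalIntegrable _ _)]
    simp [div_eq_inv_mul]
  calc ∫⁻ x, ENNReal.ofReal (wt ln b x) *
        ‖(h (x + s • EuclideanSpace.single i (1 : ℝ)) - h x) / s‖ₑ ^ p
      ≤ ∫⁻ x, ∫⁻ θ in Set.Ioc (0 : ℝ) 1, ENNReal.ofReal (wt ln b x) *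
          ‖pd h i (x + (θ * s) • EuclideanSpace.single i (1 : ℝ))‖ₑ ^ p := by
        refine lintegral_mono fun x => ?_
        rw [hrep x, lintegral_const_mul' _ _ ENNReal.ofReal_ne_top]
        exact mul_le_mul_right (enorm_intervalIntegral_rpow_le hp _
          (hc.comp (by fun_prop : Continuous fun θ : ℝ => (x, θ)))) _
    _ = ∫⁻ θ in Set.Ioc (0 : ℝ) 1, ∫⁻ x, ENNReal.ofReal (wt ln b x) *
          ‖pd h i (x + (θ * s) • EuclideanSpace.single i (1 : ℝ))‖ₑ ^ p := by
        refine lintegral_lintegral_swap (Measurable.aemeasurable ?_)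
        exact (hwm.comp measurable_fst).mul (hc.measurable.enorm.pow_const p)
    _ ≤ ∫⁻ _ in Set.Ioc (0 : ℝ) 1, ∫⁻ x, ENNReal.ofReal (wt ln b x) * ‖pd h i x‖ₑ ^ p := by
        refine setLIntegral_mono measurable_const fun θ hθ => ?_
        rw [← lintegral_add_right_eq_self (fun x => ENNReal.ofReal (wt ln b x) * ‖pd h i x‖ₑ ^ p)
          ((θ * s) • EuclideanSpace.single i (1 : ℝ))]
        exact lintegral_mono fun x => mul_le_mul_left (ENNReal.ofReal_le_ofReal
          (wt_le_wt_add_single hb.le i (mul_nonneg hθ.1.le hs.le) x)) _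
    _ = _ := by simp

lemma lintegral_wt_pd_le_of_tendsto (hb : 0 < b) (hp : 1 ≤ p) (i : Fin n) {H : ℕ → Eu n → ℝ}
    {A : ℕ → ℝ≥0∞} {B : ℝ≥0∞} {W : Eu n → ℝ} (hH : ∀ k, ContDiff ℝ 1 (H k))
    (hlim : ∀ x, Tendsto (fun k => H k x) atTop (𝓝 (W x))) (hg : ∀ x, 0 < x ln → g x = W x)
    (hA : ∀ k, ∫⁻ x, ENNReal.ofReal (wt ln b x) * ‖pd (H k) i x‖ₑ ^ p ≤ A k)
    (hB : Tendsto A atTop (𝓝 B)) :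
    ∫⁻ x, ENNReal.ofReal (wt ln b x) * ‖pd g i x‖ₑ ^ p ≤ B := by
  have hp0 : 0 < p := by linarith
  have hs : ∀ m : ℕ, (0 : ℝ) < 1 / ((m : ℝ) + 1) := fun m => by positivity
  set e : Eu n := EuclideanSpace.single i (1 : ℝ) with he
  have hHm : ∀ k, Measurable (H k) := fun k => (hH k).continuous.measurable
  have hW : Measurable W := measurable_of_tendsto_metrizable hHm (tendsto_pi_nhds.2 hlim)
  refine lintegral_wt_le_of_tendsto hb hp0
    (G := fun m x => (W (x + (1 / ((m : ℝ) + 1)) • e) - W x) / (1 / ((m : ℝ) + 1)))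
    (fun m => ((hW.comp (measurable_add_const _)).sub hW).div_const _) ?_
    (fun m => ?_) (tendsto_const_nhds (x := B))
  · intro x hx
    by_cases hd : DifferentiableAt ℝ g x
    · right
      have h1 := hd.hasFDerivAt.hasLineDerivAt e
      have h2 := hasDerivAt_iff_tendsto_slope_zero.1 h1
      have h3 : Tendsto (fun m : ℕ => 1 / ((m : ℝ) + 1)) atTop (𝓝[≠] 0) :=
        tendsto_nhdsWithin_iff.2
          ⟨tendsto_one_div_add_atTop_nhds_zero_nat, Eventually.of_forall fun m => (hs m).ne'⟩
      refine (h2.comp h3).congr fun m => ?_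
      have hx' : 0 < (x + (1 / ((m : ℝ) + 1)) • e) ln := by
        have : 0 ≤ e ln := by
          rw [he]
          by_cases hi : ln = i
          · simp [hi]
          · simp [hi]
        have h4 : (x + (1 / ((m : ℝ) + 1)) • e) ln = x ln + (1 / ((m : ℝ) + 1)) * e ln := rfl
        rw [h4]
        have := hs m
        positivity
      simp only [Function.comp, zero_add, zero_smul, add_zero, smul_eq_mul, hg _ hx, hg _ hx']
      exact (div_eq_inv_mul _ _).symm
    · left
      simp [pd, fderiv_zero_of_not_differentiableAt hd]
  · exact lintegral_wt_le_of_tendsto hb hp0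
      (G := fun k x => (H k (x + (1 / ((m : ℝ) + 1)) • e) - H k x) / (1 / ((m : ℝ) + 1)))
      (fun k => (((hHm k).comp (measurable_add_const _)).sub (hHm k)).div_const _)
      (fun x _ => Or.inr (((hlim _).sub (hlim x)).div_const _))
      (fun k => (lintegral_wt_slope_le hb hp (hH k) i (hs m)).trans (hA k)) hB

lemma lintegral_wt_const_mul (hp : 0 ≤ p) {c : ℝ} (hc : 0 ≤ c) (h : Eu n → ℝ) :
    ∫⁻ x, ENNReal.ofReal (wt ln b x) * ‖c * h x‖ₑ ^ p =
      ENNReal.ofReal c ^ p * ∫⁻ x, ENNReal.ofReal (wt ln b x) * ‖h x‖ₑ ^ p := by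
  rw [← lintegral_const_mul' _ _ (ENNReal.rpow_ne_top_of_nonneg hp ENNReal.ofReal_ne_top)]
  refine lintegral_congr fun x => ?_
  rw [enorm_mul, ENNReal.mul_rpow_of_nonneg _ _ hp, Real.enorm_eq_ofReal hc]
  ring

lemma lintegral_wt_le_iff (hb : 0 < b) (hp : 0 < p) {C : ℝ} (hg : Measurable g)
    (hh : Measurable h) :
    eLpNorm g (ENNReal.ofReal p) (mub n ln b) ≤
        ENNReal.ofReal C * eLpNorm h (ENNReal.ofReal p) (mub n ln b) ↔
      ∫⁻ x, ENNReal.ofReal (wt ln b x) * ‖g x‖ₑ ^ p ≤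
        ENNReal.ofReal C ^ p * ∫⁻ x, ENNReal.ofReal (wt ln b x) * ‖h x‖ₑ ^ p := by
  rw [eLpNorm_mub hb hp hg, eLpNorm_mub hb hp hh, ← ENNReal.rpow_le_rpow_iff hp,
    ENNReal.mul_rpow_of_nonneg _ _ hp.le, ← ENNReal.rpow_mul, ← ENNReal.rpow_mul,
    one_div_mul_cancel hp.ne', ENNReal.rpow_one, ENNReal.rpow_one]

lemma measurable_pd (g : Eu n → ℝ) (i : Fin n) : Measurable (pd g i) :=
  measurable_fderiv_apply_const ℝ g _

theorem exists_eLpNorm_Tb_le (hp : 1 < p) (hn : 1 ≤ n) (hb : 1 < b) :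
    ∃ C : ℝ, 0 < C ∧ ∀ f : Eu n → ℝ, Measurable f → (∃ M : ℝ, ∀ y, |f y| ≤ M) →
      HasCompactSupport f →
      (∀ i j : Fin n, eLpNorm (pd2 (Tb n ln b f) i j) (ENNReal.ofReal p) (mub n ln b) ≤
        ENNReal.ofReal C * eLpNorm f (ENNReal.ofReal p) (mub n ln b)) ∧
      eLpNorm (fun x => pd (Tb n ln b f) ln x / x ln) (ENNReal.ofReal p) (mub n ln b) ≤
        ENNReal.ofReal C * eLpNorm f (ENNReal.ofReal p) (mub n ln b) := by
  have hp0 : 0 < p := by linarith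
  have hb0 : 0 < b := by linarith
  obtain ⟨C, hC, hCbd⟩ := exists_eLpNorm_testPot_le (ln := ln) hp hn hb
  have hc := potConst_pos (n := n) hn hb
  set c := potConst n b
  refine ⟨c * C, mul_pos hc hC, fun f hf hM hs => ?_⟩
  obtain ⟨hd, F, L, hF, hL, hlim, hlimp⟩ := exists_approx (ln := ln) hb hp0 hf hM hs
  obtain ⟨V, hV, hu⟩ := exists_tendsto_pd hn hb hd hF hL hlim
  have hsm := fun k => (hF k).contDiff_testPot_infty hn hb
  have hFm : ∀ k, Measurable (F k) := fun k => (hF k).1.continuous.measurable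
  have hdiv : ∀ g : Eu n → ℝ, Measurable fun x => pd g ln x / x ln := fun g =>
    (measurable_pd g ln).div (EuclideanSpace.proj ln : Eu n →L[ℝ] ℝ).continuous.measurable
  have htop : ENNReal.ofReal (c * C) ^ p ≠ ∞ :=
    ENNReal.rpow_ne_top_of_nonneg hp0.le ENNReal.ofReal_ne_top
  have hB := ENNReal.Tendsto.const_mul hlimp (Or.inr htop)
  have hmul : ENNReal.ofReal (c * C) ^ p = ENNReal.ofReal c ^ p * ENNReal.ofReal C ^ p := by
    rw [ENNReal.ofReal_mul hc.le, ENNReal.mul_rpow_of_nonneg _ _ hp0.le]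
  have hsc : ∀ (k : ℕ) (g : Eu n → ℝ), Measurable g →
      eLpNorm g (ENNReal.ofReal p) (mub n ln b) ≤
        ENNReal.ofReal C * eLpNorm (F k) (ENNReal.ofReal p) (mub n ln b) →
      ∫⁻ x, ENNReal.ofReal (wt ln b x) * ‖c * g x‖ₑ ^ p ≤ ENNReal.ofReal (c * C) ^ p *
        ∫⁻ x, ENNReal.ofReal (wt ln b x) * ‖F k x‖ₑ ^ p := by
    intro k g hg h
    rw [lintegral_wt_const_mul hp0.le hc.le, hmul, mul_assoc]
    exact mul_le_mul_right ((lintegral_wt_le_iff hb0 hp0 hg (hFm k)).1 h) _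
  refine ⟨fun i j => (lintegral_wt_le_iff hb0 hp0 (measurable_pd _ i) hf).2 ?_,
    (lintegral_wt_le_iff hb0 hp0 (hdiv _) hf).2 ?_⟩
  · have hvs : ∀ k, ContDiff ℝ 1 (pd (testPot ln b (F k)) j) := fun k =>
      (contDiff_top_pd (hsm k) j).of_le (by simp)
    refine lintegral_wt_pd_le_of_tendsto hb0 hp.le i
      (H := fun k x => c * pd (testPot ln b (F k)) j x) (fun k => contDiff_const.mul (hvs k))
      (fun x => (hV j x).const_mul c) (hu j) (fun k => ?_) hB
    have e : ∀ x, pd (fun x => c * pd (testPot ln b (F k)) j x) i x =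
        c * pd2 (testPot ln b (F k)) i j x := by
      intro x
      rw [pd, fderiv_const_mul ((hvs k).differentiable (by simp) x)]
      rfl
    simp only [e]
    exact hsc k _ (measurable_pd _ i) ((hCbd (F k) (hF k)).1 i j)
  · refine lintegral_wt_le_of_tendsto hb0 hp0
      (G := fun k x => c * (pd (testPot ln b (F k)) ln x / x ln))
      (fun k => (hdiv _).const_mul c) (fun x hx => Or.inr ?_)
      (fun k => hsc k _ (hdiv _) (hCbd (F k) (hF k)).2) hB
    rw [hu ln x hx, mul_div_assoc]
    exact ((hV ln x).div_const _).const_mul c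

end Limit

theorem stmt16 (n : ℕ) (hn : 2 ≤ n) (ln : Fin n) (hln : (ln : ℕ) = n - 1)
    (b : ℝ) (hb : 1 < b) (p : ℝ) (hp : 1 < p) :
    ∃ C : ℝ, 0 < C ∧
      ∀ f : Eu n → ℝ, Measurable f → (∃ M : ℝ, ∀ y, |f y| ≤ M) →
        HasCompactSupport f →
        (∑ i : Fin n, ∑ j : Fin n,
            eLpNorm (fun x => pd2 (Tb n ln b f) i j x) (ENNReal.ofReal p) (mub n ln b))
          + eLpNorm (fun x => pd (Tb n ln b f) ln x / x ln) (ENNReal.ofReal p) (mub n ln b)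
          ≤ ENNReal.ofReal C * eLpNorm f (ENNReal.ofReal p) (mub n ln b) := by
  obtain ⟨C, hC, h⟩ := exists_eLpNorm_Tb_le (ln := ln) hp (by omega : 1 ≤ n) hb
  refine ⟨(n * n + 1) * C, by positivity, fun f hf hM hs => ?_⟩
  obtain ⟨h1, h2⟩ := h f hf hM hs
  refine (add_le_add (Finset.sum_le_sum fun i _ => Finset.sum_le_sum fun j _ => h1 i j) h2).trans
    (le_of_eq ?_)
  have e : ENNReal.ofReal ((n * n + 1) * C) = (n * n + 1) * ENNReal.ofReal C := by
    rw [ENNReal.ofReal_mul (by positivity), ENNReal.ofReal_add (by positivity) zero_le_one,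
      ENNReal.ofReal_mul (by positivity), ENNReal.ofReal_natCast, ENNReal.ofReal_one]
  simp only [Finset.sum_const, Finset.card_univ, Fintype.card_fin, nsmul_eq_mul, e]
  ring
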